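/- For every integer n ≥ 2 there is a constant C = C(n) with the following property. Let g be a smooth time-dependent metric on ℝ^n over [0,T] solving the Ricci flow, let x₀ ∈ ℝ^n, r₀ > 0, K ≥ 1, and assume: (a) the closure of the time-zero ball B_0(x₀, r₀) is compact; (b) |Rm|(x,0) ≤ r₀^{−2} for every x ∈ B_0(x₀, r₀); (c) |Rm|(x,t) ≤ K/t whenever 0 < t ≤ T and d_0(x₀,x) < r₀. Then |Rm|(x,t) ≤ e^{CK} (r₀ − d_0(x₀,x))^{−2} for every (x,t) ∈ B_0(x₀, r₀) × [0,T]. -/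

import Mathlib

open Set MeasureTheory
open scoped BigOperators Matrix

noncomputable section

variable {n : ℕ}

/-- Partial derivative of `f` at `x` in the `i`-th coordinate direction. -/
def pd (f : (Fin n → ℝ) → ℝ) (i : Fin n) (x : Fin n → ℝ) : ℝ :=
  fderiv ℝ f x (Pi.single i 1)

/-- Christoffel symbols `Γ^k_{ij}` of a (time-independent) metric `G`. -/
def christoffel (G : (Fin n → ℝ) → Matrix (Fin n) (Fin n) ℝ)
    (x : Fin n → ℝ) (k i j : Fin n) : ℝ :=
  (1/2) * ∑ l, (G x)⁻¹ k l *
    (pd (fun y => G y j l) i x + pd (fun y => G y i l) j x - pd (fun y => G y i j) l x)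

/-- Ricci tensor `R_{jk}`. -/
def ricci (G : (Fin n → ℝ) → Matrix (Fin n) (Fin n) ℝ)
    (x : Fin n → ℝ) (j k : Fin n) : ℝ :=
  ∑ i, (pd (fun y => christoffel G y i j k) i x
      - pd (fun y => christoffel G y i i k) j x
      + ∑ p, (christoffel G x i i p * christoffel G x p j k
            - christoffel G x i j p * christoffel G x p i k))

/-- Scalar curvature. -/
def scalarCurv (G : (Fin n → ℝ) → Matrix (Fin n) (Fin n) ℝ) (x : Fin n → ℝ) : ℝ :=
  ∑ j, ∑ k, (G x)⁻¹ j k * ricci G x j k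

/-- Riemann tensor `R_{ijkl}`. -/
def riemann (G : (Fin n → ℝ) → Matrix (Fin n) (Fin n) ℝ)
    (x : Fin n → ℝ) (i j k l : Fin n) : ℝ :=
  ∑ m, G x l m *
    (pd (fun y => christoffel G y m j k) i x - pd (fun y => christoffel G y m i k) j x
      + ∑ p, (christoffel G x m i p * christoffel G x p j k
            - christoffel G x m j p * christoffel G x p i k))

/-- Norm of the Riemann tensor. -/
def riemNorm (G : (Fin n → ℝ) → Matrix (Fin n) (Fin n) ℝ) (x : Fin n → ℝ) : ℝ :=
  Real.sqrt (∑ i, ∑ j, ∑ k, ∑ l, ∑ a, ∑ b, ∑ c, ∑ d,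
    (G x)⁻¹ i a * (G x)⁻¹ j b * (G x)⁻¹ k c * (G x)⁻¹ l d *
      riemann G x i j k l * riemann G x a b c d)

/-- Sectional curvature of the plane spanned by `u`, `v`. -/
def sectionalCurv (G : (Fin n → ℝ) → Matrix (Fin n) (Fin n) ℝ)
    (x : Fin n → ℝ) (u v : Fin n → ℝ) : ℝ :=
  (∑ i, ∑ j, ∑ k, ∑ l, riemann G x i j k l * u i * v j * v k * u l) /
    ((∑ i, ∑ j, G x i j * u i * u j) * (∑ i, ∑ j, G x i j * v i * v j)
      - (∑ i, ∑ j, G x i j * u i * v j) ^ 2)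

/-- Length of a path with respect to the metric `G`. -/
def pathLength (G : (Fin n → ℝ) → Matrix (Fin n) (Fin n) ℝ)
    (γ : ℝ → (Fin n → ℝ)) : ℝ :=
  ∫ s in (0:ℝ)..1, Real.sqrt (∑ i, ∑ j, G (γ s) i j * deriv γ s i * deriv γ s j)

/-- Riemannian distance: infimum of lengths of C¹ paths. -/
def riemDist (G : (Fin n → ℝ) → Matrix (Fin n) (Fin n) ℝ)
    (x y : Fin n → ℝ) : ℝ :=
  sInf {L : ℝ | ∃ γ : ℝ → (Fin n → ℝ),
    ContDiffOn ℝ 1 γ (Icc 0 1) ∧ γ 0 = x ∧ γ 1 = y ∧ L = pathLength G γ}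

/-- Metric ball. -/
def rBall (G : (Fin n → ℝ) → Matrix (Fin n) (Fin n) ℝ)
    (x₀ : Fin n → ℝ) (r : ℝ) : Set (Fin n → ℝ) :=
  {x | riemDist G x₀ x < r}

/-- Completeness of `(ℝⁿ, riemDist G)`. -/
def riemComplete (G : (Fin n → ℝ) → Matrix (Fin n) (Fin n) ℝ) : Prop :=
  ∀ u : ℕ → (Fin n → ℝ),
    (∀ ε > (0:ℝ), ∃ N, ∀ p ≥ N, ∀ q ≥ N, riemDist G (u p) (u q) < ε) →
    ∃ x, ∀ ε > (0:ℝ), ∃ N, ∀ p ≥ N, riemDist G (u p) x < ε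

/-- Riemannian volume of a set. -/
def riemVol (G : (Fin n → ℝ) → Matrix (Fin n) (Fin n) ℝ)
    (S : Set (Fin n → ℝ)) : ℝ :=
  ∫ x in S, Real.sqrt ((G x).det)

/-- A smooth (time-independent) Riemannian metric. -/
def SmoothMetric (G : (Fin n → ℝ) → Matrix (Fin n) (Fin n) ℝ) : Prop :=
  (∀ i j, ContDiff ℝ (⊤ : ℕ∞) (fun x => G x i j)) ∧ ∀ x, (G x).IsSymm ∧ (G x).PosDef

/-- A smooth time-dependent metric over the time interval `I`. -/
def SmoothMetricFamily (g : (Fin n → ℝ) → ℝ → Matrix (Fin n) (Fin n) ℝ)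
    (I : Set ℝ) : Prop :=
  (∀ i j, ContDiffOn ℝ (⊤ : ℕ∞) (fun p : (Fin n → ℝ) × ℝ => g p.1 p.2 i j) (univ ×ˢ I)) ∧
  ∀ x : Fin n → ℝ, ∀ t ∈ I, (g x t).IsSymm ∧ (g x t).PosDef

/-- The Ricci flow equation `∂ₜ g = -2 Ric` over the time interval `I`. -/
def IsRicciFlow (g : (Fin n → ℝ) → ℝ → Matrix (Fin n) (Fin n) ℝ)
    (I : Set ℝ) : Prop :=
  ∀ x : Fin n → ℝ, ∀ t ∈ I, ∀ j k,
    derivWithin (fun s => g x s j k) I t = -2 * ricci (fun y => g y t) x j k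

/-- `lam ≥ mu ≥ nu` are the eigenvalues of the 3×3 matrix `M`
(characterized via the characteristic polynomial). -/
def IsEigTriple (M : Matrix (Fin 3) (Fin 3) ℝ) (lam mu nu : ℝ) : Prop :=
  nu ≤ mu ∧ mu ≤ lam ∧
  ∀ z : ℝ, (z • (1 : Matrix (Fin 3) (Fin 3) ℝ) - M).det = (z - lam) * (z - mu) * (z - nu)

/-- Hamilton's curvature operator `g^{il}(R g_{lj} - 2 R_{lj})` in dimension 3. -/
def curvOp (G : (Fin 3 → ℝ) → Matrix (Fin 3) (Fin 3) ℝ) (x : Fin 3 → ℝ) :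
    Matrix (Fin 3) (Fin 3) ℝ :=
  Matrix.of fun i j => ∑ l, (G x)⁻¹ i l * (scalarCurv G x * G x l j - 2 * ricci G x l j)

namespace RFlow

section Connections

variable {A ι : Type*} [CommRing A] [Algebra ℝ A]

/-- A family of covariant derivative operators on the module `W` over the derivations `d`. -/
structure Conn (d : ι → Derivation ℝ A A) (W : Type*) [AddCommGroup W] [Module A W] where
  D : ι → W →+ W
  leib : ∀ μ a w, D μ (a • w) = d μ a • w + a • D μ w

variable {d : ι → Derivation ℝ A A} {W : Type*} [AddCommGroup W] [Module A W]

/-- The induced connection on `W`-valued covectors. -/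
def Conn.lift (c : Conn d W) (Γ : ι → Matrix (Fin n) (Fin n) A) : Conn d (Fin n → W) where
  D μ := AddMonoidHom.mk' (fun T i => c.D μ (T i) - ∑ k, Γ μ k i • T k) (by
    intro S T; funext i
    simp only [Pi.add_apply, map_add, smul_add, Finset.sum_add_distrib]; abel)
  leib μ a w := by
    funext i
    simp only [AddMonoidHom.mk'_apply, Pi.smul_apply, Pi.add_apply, c.leib, smul_sub,
      Finset.smul_sum, smul_comm a]
    abel

theorem Conn.lift_apply (c : Conn d W) (Γ : ι → Matrix (Fin n) (Fin n) A) (μ : ι)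
    (T : Fin n → W) (i : Fin n) :
    (c.lift Γ).D μ T i = c.D μ (T i) - ∑ k, Γ μ k i • T k := rfl

/-- Entrywise derivative of a matrix. -/
def dMat (d : ι → Derivation ℝ A A) (μ : ι) (M : Matrix (Fin n) (Fin n) A) :
    Matrix (Fin n) (Fin n) A := M.map (d μ)

theorem dMat_apply (μ : ι) (M : Matrix (Fin n) (Fin n) A) (i j : Fin n) :
    dMat d μ M i j = d μ (M i j) := rfl

theorem dMat_add (μ : ι) (M N : Matrix (Fin n) (Fin n) A) :
    dMat d μ (M + N) = dMat d μ M + dMat d μ N := by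
  ext i j; simp [dMat_apply]

theorem dMat_sub (μ : ι) (M N : Matrix (Fin n) (Fin n) A) :
    dMat d μ (M - N) = dMat d μ M - dMat d μ N := by
  ext i j; simp [dMat_apply]

theorem dMat_neg (μ : ι) (M : Matrix (Fin n) (Fin n) A) :
    dMat d μ (-M) = -dMat d μ M := by
  ext i j; simp [dMat_apply]

theorem dMat_one (μ : ι) : dMat d μ (1 : Matrix (Fin n) (Fin n) A) = 0 := by
  ext i j
  rw [dMat_apply, Matrix.one_apply]
  split_ifs <;> simp

theorem dMat_mul (μ : ι) (M N : Matrix (Fin n) (Fin n) A) :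
    dMat d μ (M * N) = dMat d μ M * N + M * dMat d μ N := by
  ext i j
  simp only [dMat_apply, Matrix.mul_apply, map_sum, Derivation.leibniz, Matrix.add_apply,
    smul_eq_mul, ← Finset.sum_add_distrib]
  exact Finset.sum_congr rfl fun k _ => by ring

theorem dMat_transpose (μ : ι) (M : Matrix (Fin n) (Fin n) A) :
    dMat d μ Mᵀ = (dMat d μ M)ᵀ := rfl

/-- The connection on matrices given by the commutator with `Γ`. -/
def endConn (d : ι → Derivation ℝ A A) (Γ : ι → Matrix (Fin n) (Fin n) A) :
    Conn d (Matrix (Fin n) (Fin n) A) where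
  D μ := AddMonoidHom.mk' (fun M => dMat d μ M + Γ μ * M - M * Γ μ) (by
    intro M N; rw [dMat_add]; noncomm_ring)
  leib μ a w := by
    have : dMat d μ (a • w) = d μ a • w + a • dMat d μ w := by
      ext i j; simp [dMat_apply]; ring
    simp only [AddMonoidHom.mk'_apply, this, Matrix.mul_smul, Matrix.smul_mul, smul_sub, smul_add]
    abel

theorem endConn_apply (Γ : ι → Matrix (Fin n) (Fin n) A) (μ : ι) (M : Matrix (Fin n) (Fin n) A) :
    (endConn d Γ).D μ M = dMat d μ M + Γ μ * M - M * Γ μ := rfl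

/-- Curvature of the matrix connection. -/
def curvF (d : ι → Derivation ℝ A A) (Γ : ι → Matrix (Fin n) (Fin n) A) (μ ν : ι) :
    Matrix (Fin n) (Fin n) A :=
  dMat d μ (Γ ν) - dMat d ν (Γ μ) + Γ μ * Γ ν - Γ ν * Γ μ

theorem curvF_antisymm (Γ : ι → Matrix (Fin n) (Fin n) A) (μ ν : ι) :
    curvF d Γ μ ν = -curvF d Γ ν μ := by unfold curvF; noncomm_ring

theorem dMat_comm (hd : ∀ μ ν a, d μ (d ν a) = d ν (d μ a)) (μ ν : ι)
    (M : Matrix (Fin n) (Fin n) A) : dMat d μ (dMat d ν M) = dMat d ν (dMat d μ M) := by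
  ext i j; simp [dMat_apply, hd μ ν]

theorem jacobi (hd : ∀ μ ν a, d μ (d ν a) = d ν (d μ a)) (Γ : ι → Matrix (Fin n) (Fin n) A)
    (l μ ν : ι) :
    (endConn d Γ).D l (curvF d Γ μ ν) + (endConn d Γ).D μ (curvF d Γ ν l)
      + (endConn d Γ).D ν (curvF d Γ l μ) = 0 := by
  simp only [endConn_apply, curvF, dMat_add, dMat_sub, dMat_mul]
  rw [dMat_comm hd l μ, dMat_comm hd ν μ, dMat_comm hd ν l]
  noncomm_ring

theorem endConn_comm (hd : ∀ μ ν a, d μ (d ν a) = d ν (d μ a))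
    (Γ : ι → Matrix (Fin n) (Fin n) A) (μ ν : ι) (M : Matrix (Fin n) (Fin n) A) :
    (endConn d Γ).D μ ((endConn d Γ).D ν M) - (endConn d Γ).D ν ((endConn d Γ).D μ M)
      = curvF d Γ μ ν * M - M * curvF d Γ μ ν := by
  simp only [endConn_apply, curvF, dMat_add, dMat_sub, dMat_mul]
  rw [dMat_comm hd μ ν]
  noncomm_ring

theorem lift_comm (c : Conn d W) (Γ : ι → Matrix (Fin n) (Fin n) A) (μ ν : ι)
    (T : Fin n → W) (i : Fin n) :
    (c.lift Γ).D μ ((c.lift Γ).D ν T) i - (c.lift Γ).D ν ((c.lift Γ).D μ T) i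
      = (c.D μ (c.D ν (T i)) - c.D ν (c.D μ (T i))) - ∑ k, curvF d Γ μ ν k i • T k := by
  have key : ∀ a b : ι, ∑ k, Γ a k i • ∑ l, Γ b l k • T l = ∑ l, (Γ b * Γ a) l i • T l := by
    intro a b
    simp only [Finset.smul_sum, Matrix.mul_apply, Finset.sum_smul, smul_smul]
    rw [Finset.sum_comm]
    exact Finset.sum_congr rfl fun k _ => Finset.sum_congr rfl fun l _ => by rw [mul_comm]
  simp only [Conn.lift_apply, map_sub, map_sum, c.leib, smul_sub, Finset.sum_sub_distrib,
    Finset.sum_add_distrib, key]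
  simp only [curvF, Matrix.add_apply, Matrix.sub_apply, dMat_apply, add_smul, sub_smul,
    Finset.sum_sub_distrib, Finset.sum_add_distrib]
  abel

/-- Metric contraction of the first two indices. -/
def trH (H : Matrix (Fin n) (Fin n) A) (T : Fin n → Fin n → W) : W :=
  ∑ p, ∑ q, H p q • T p q

theorem D_trH (c : Conn d W) (Γ : ι → Matrix (Fin n) (Fin n) A) (H : Matrix (Fin n) (Fin n) A)
    (μ : ι) (hH : dMat d μ H = -(Γ μ * H) - H * (Γ μ)ᵀ) (T : Fin n → Fin n → W) :
    c.D μ (trH H T) = trH H (((c.lift Γ).lift Γ).D μ T) := by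
  have h1 : ∀ p q, d μ (H p q) = -(∑ k, Γ μ p k * H k q) - ∑ k, H p k * Γ μ q k := by
    intro p q
    have := congrFun (congrFun hH p) q
    simpa [dMat_apply, Matrix.mul_apply] using this
  simp only [trH, map_sum, c.leib, h1, Conn.lift_apply, sub_smul, neg_smul, Finset.sum_smul,
    Pi.sub_apply, Finset.sum_apply, Pi.smul_apply, smul_sub, Finset.smul_sum,
    Finset.sum_sub_distrib, Finset.sum_add_distrib, Finset.sum_neg_distrib, smul_smul]
  have e1 : ∑ p, ∑ q, ∑ k, (Γ μ p k * H k q) • T p q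
      = ∑ p, ∑ q, ∑ k, (H p q * Γ μ k p) • T k q := by
    rw [Finset.sum_comm]
    conv_rhs => rw [Finset.sum_comm]
    refine Finset.sum_congr rfl fun q _ => ?_
    rw [Finset.sum_comm]
    exact Finset.sum_congr rfl fun k _ => Finset.sum_congr rfl fun l _ => by rw [mul_comm]
  have e2 : ∑ p, ∑ q, ∑ k, (H p k * Γ μ q k) • T p q
      = ∑ p, ∑ q, ∑ k, (H p q * Γ μ k q) • T p k := by
    refine Finset.sum_congr rfl fun q _ => ?_
    rw [Finset.sum_comm]
  rw [e1, e2]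
  abel

/-- Metric pairing of `W`-valued covectors. -/
def liftB (H : Matrix (Fin n) (Fin n) A) (b : W → W → A) (S T : Fin n → W) : A :=
  ∑ i, ∑ j, H i j * b (S i) (T j)

/-- `b` is a bilinear pairing parallel with respect to `c`. -/
structure Compat (c : Conn d W) (b : W → W → A) (μ : ι) : Prop where
  addl : ∀ x y z, b (x + y) z = b x z + b y z
  addr : ∀ x y z, b x (y + z) = b x y + b x z
  smull : ∀ a x y, b (a • x) y = a * b x y
  smulr : ∀ a x y, b x (a • y) = a * b x y
  compat : ∀ x y, d μ (b x y) = b (c.D μ x) y + b x (c.D μ y)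

namespace Compat
variable {c : Conn d W} {b : W → W → A} {μ : ι}

theorem suml (h : Compat c b μ) {κ : Type*} (s : Finset κ) (f : κ → W) (y : W) :
    b (∑ k ∈ s, f k) y = ∑ k ∈ s, b (f k) y :=
  map_sum (AddMonoidHom.mk' (fun x => b x y) fun _ _ => h.addl _ _ _) f s

theorem sumr (h : Compat c b μ) {κ : Type*} (s : Finset κ) (f : κ → W) (y : W) :
    b y (∑ k ∈ s, f k) = ∑ k ∈ s, b y (f k) :=
  map_sum (AddMonoidHom.mk' (fun x => b y x) fun _ _ => h.addr _ _ _) f s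

theorem subl (h : Compat c b μ) (x y z : W) : b (x - y) z = b x z - b y z :=
  map_sub (AddMonoidHom.mk' (fun x => b x z) fun _ _ => h.addl _ _ _) x y

theorem subr (h : Compat c b μ) (x y z : W) : b z (x - y) = b z x - b z y :=
  map_sub (AddMonoidHom.mk' (fun x => b z x) fun _ _ => h.addr _ _ _) x y

theorem lift (h : Compat c b μ) (Γ : ι → Matrix (Fin n) (Fin n) A)
    (H : Matrix (Fin n) (Fin n) A) (hH : dMat d μ H = -(Γ μ * H) - H * (Γ μ)ᵀ) :
    Compat (c.lift Γ) (liftB H b) μ where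
  addl x y z := by simp [liftB, h.addl, mul_add, Finset.sum_add_distrib]
  addr x y z := by simp [liftB, h.addr, mul_add, Finset.sum_add_distrib]
  smull a x y := by
    simp only [liftB, Pi.smul_apply, h.smull, Finset.mul_sum]
    exact Finset.sum_congr rfl fun k _ => Finset.sum_congr rfl fun l _ => by ring
  smulr a x y := by
    simp only [liftB, Pi.smul_apply, h.smulr, Finset.mul_sum]
    exact Finset.sum_congr rfl fun k _ => Finset.sum_congr rfl fun l _ => by ring
  compat x y := by
    have h1 : ∀ p q, d μ (H p q) = -(∑ k, Γ μ p k * H k q) - ∑ k, H p k * Γ μ q k := by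
      intro p q
      have := congrFun (congrFun hH p) q
      simpa [dMat_apply, Matrix.mul_apply] using this
    simp only [liftB, map_sum, Derivation.leibniz, smul_eq_mul, h.compat, h1, Conn.lift_apply,
      h.subl, h.subr, h.suml, h.sumr, h.smull, h.smulr, mul_sub, mul_add, mul_neg,
      Finset.mul_sum, Finset.sum_sub_distrib, Finset.sum_add_distrib, Finset.sum_neg_distrib]
    have e1 : ∑ p, ∑ q, ∑ k, b (x p) (y q) * (Γ μ p k * H k q)
        = ∑ p, ∑ q, ∑ k, H p q * (Γ μ k p * b (x k) (y q)) := by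
      rw [Finset.sum_comm]
      conv_rhs => rw [Finset.sum_comm]
      refine Finset.sum_congr rfl fun q _ => ?_
      rw [Finset.sum_comm]
      exact Finset.sum_congr rfl fun k _ => Finset.sum_congr rfl fun l _ => by ring
    have e2 : ∑ p, ∑ q, ∑ k, b (x p) (y q) * (H p k * Γ μ q k)
        = ∑ p, ∑ q, ∑ k, H p q * (Γ μ k q * b (x p) (y k)) := by
      refine Finset.sum_congr rfl fun q _ => ?_
      rw [Finset.sum_comm]
      exact Finset.sum_congr rfl fun k _ => Finset.sum_congr rfl fun l _ => by ring
    rw [e1, e2]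
    abel

end Compat

/-- The trace pairing on matrices. -/
def trB (M N : Matrix (Fin n) (Fin n) A) : A := -(M * N).trace

theorem trB_compat (Γ : ι → Matrix (Fin n) (Fin n) A) (μ : ι) :
    Compat (endConn d Γ) (trB (n := n) (A := A)) μ where
  addl x y z := by simp [trB, add_mul]; ring
  addr x y z := by simp [trB, mul_add]; ring
  smull a x y := by simp [trB]
  smulr a x y := by simp [trB]
  compat x y := by
    have : d μ (x * y).trace = (dMat d μ (x * y)).trace := by
      simp [Matrix.trace, dMat_apply]
    rw [trB, map_neg, this, dMat_mul, trB, trB, endConn_apply, endConn_apply]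
    have h1 := Matrix.trace_mul_comm (x * y) (Γ μ)
    simp only [add_mul, mul_add, sub_mul, mul_sub, Matrix.trace_add, Matrix.trace_sub,
      Matrix.mul_assoc] at h1 ⊢
    rw [h1]; ring

/-- Bochner-type formula for `b F F`. -/
theorem laplace_pairing {d : Option (Fin n) → Derivation ℝ A A} (c : Conn d W) (b : W → W → A)
    (hb : ∀ μ, Compat c b μ) (hsymm : ∀ x y, b x y = b y x)
    (Γ : Option (Fin n) → Matrix (Fin n) (Fin n) A) (F : W) (i j : Fin n) :
    d (some i) (d (some j) (b F F)) - ∑ k, Γ (some i) k j * d (some k) (b F F)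
      = 2 * b ((c.lift Γ).D (some i) (fun p => c.D (some p) F) j) F
        + 2 * b (c.D (some i) F) (c.D (some j) F) := by
  simp only [(hb _).compat, map_add, Conn.lift_apply, (hb none).subl, (hb none).suml,
    (hb none).smull]
  simp only [hsymm F, mul_sub, Finset.mul_sum, mul_add, Finset.sum_add_distrib]
  rw [hsymm (c.D (some j) F) (c.D (some i) F)]
  have : ∑ k, 2 * (Γ (some i) k j * b (c.D (some k) F) F)
    = ∑ k, Γ (some i) k j * b (c.D (some k) F) F + ∑ k, Γ (some i) k j * b (c.D (some k) F) F := by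
    rw [← Finset.sum_add_distrib]; exact Finset.sum_congr rfl fun k _ => by ring
  rw [this]; ring

end Connections

end RFlow

namespace RFlow

section LeviCivita

variable {A : Type*} [CommRing A] [Algebra ℝ A]
  {d : Option (Fin n) → Derivation ℝ A A}
  {G H : Matrix (Fin n) (Fin n) A} {Γ : Option (Fin n) → Matrix (Fin n) (Fin n) A}

theorem curv_skew (hd : ∀ μ ν a, d μ (d ν a) = d ν (d μ a)) {μ ν : Option (Fin n)}
    (hμ : dMat d μ G = (Γ μ)ᵀ * G + G * Γ μ) (hν : dMat d ν G = (Γ ν)ᵀ * G + G * Γ ν) :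
    (curvF d Γ μ ν)ᵀ * G + G * curvF d Γ μ ν = 0 := by
  have e := dMat_comm hd μ ν G
  rw [hμ, hν] at e
  simp only [dMat_add, dMat_mul, dMat_transpose, hμ, hν] at e
  rw [← sub_eq_zero] at e
  rw [← e]
  simp only [curvF, Matrix.transpose_add, Matrix.transpose_sub, Matrix.transpose_mul]
  noncomm_ring

/-- Skewness of `G * F` in components. -/
theorem curv_skew_apply (hd : ∀ μ ν a, d μ (d ν a) = d ν (d μ a)) (hG : Gᵀ = G)
    {μ ν : Option (Fin n)}
    (hμ : dMat d μ G = (Γ μ)ᵀ * G + G * Γ μ) (hν : dMat d ν G = (Γ ν)ᵀ * G + G * Γ ν)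
    (k l : Fin n) : (G * curvF d Γ μ ν) k l = -(G * curvF d Γ μ ν) l k := by
  have e := congrFun (congrFun (curv_skew hd hμ hν) k) l
  have h : ((curvF d Γ μ ν)ᵀ * G) k l = (G * curvF d Γ μ ν) l k := by
    rw [← Matrix.transpose_apply (G * _), Matrix.transpose_mul, hG]
  rw [Matrix.add_apply, h, Matrix.zero_apply] at e
  linear_combination e

theorem bianchi_first (htor : ∀ i j k, Γ (some i) k j = Γ (some j) k i) (i j k m : Fin n) :
    curvF d Γ (some i) (some j) m k + curvF d Γ (some j) (some k) m i
      + curvF d Γ (some k) (some i) m j = 0 := by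
  have h1 : ∀ a b c : Fin n, dMat d (some a) (Γ (some b)) m c = dMat d (some a) (Γ (some c)) m b := by
    intro a b c; rw [dMat_apply, dMat_apply, htor]
  have h2 : ∀ a b c : Fin n, (Γ (some a) * Γ (some b)) m c = (Γ (some a) * Γ (some c)) m b := by
    intro a b c
    simp only [Matrix.mul_apply]
    exact Finset.sum_congr rfl fun p _ => by rw [htor b c p]
  simp only [curvF, Matrix.add_apply, Matrix.sub_apply]
  rw [h1 i j k, h1 j i k, h1 k j i, h2 i j k, h2 j i k, h2 k j i]
  ring

/-- Pair symmetry of a tensor with the algebraic symmetries of curvature. -/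
theorem pair_symm_of (h2 : ∀ a : A, 2 * a = 0 → a = 0) (R : Fin n → Fin n → Fin n → Fin n → A)
    (s1 : ∀ i j k l, R i j k l = -R j i k l) (s2 : ∀ i j k l, R i j k l = -R i j l k)
    (s3 : ∀ i j k l, R i j k l + R j k i l + R k i j l = 0) (i j k l : Fin n) :
    R i j k l = R k l i j := by
  refine sub_eq_zero.mp (h2 _ ?_)
  linear_combination s3 i j k l + s3 j k l i - s3 k l i j - s3 l i j k - s2 j k l i - s2 k l j i
    - s1 l j k i + s2 j l k i + s1 i k l j - s2 k i l j + s2 l i k j + s2 i j k l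

end LeviCivita
end RFlow

namespace RFlow

section Evolution

variable {A : Type*} [CommRing A] [Algebra ℝ A]

/-- The Ricci tensor of the connection `Γ`. -/
def ricM (d : Option (Fin n) → Derivation ℝ A A) (Γ : Option (Fin n) → Matrix (Fin n) (Fin n) A) :
    Matrix (Fin n) (Fin n) A :=
  Matrix.of fun j k => ∑ i, curvF d Γ (some i) (some j) i k

/-- Algebraic form of a Ricci flow: `G` is the metric, `H` its inverse, `Γ (some i)` the
Levi-Civita connection and `Γ none` the time component of the space-time connection. -/
structure RFData (d : Option (Fin n) → Derivation ℝ A A) (G H : Matrix (Fin n) (Fin n) A)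
    (Γ : Option (Fin n) → Matrix (Fin n) (Fin n) A) : Prop where
  hd : ∀ μ ν a, d μ (d ν a) = d ν (d μ a)
  h2 : ∀ a : A, 2 * a = 0 → a = 0
  hG : Gᵀ = G
  hGH : G * H = 1
  hcomp : ∀ μ, dMat d μ G = (Γ μ)ᵀ * G + G * Γ μ
  htor : ∀ i j k, Γ (some i) k j = Γ (some j) k i
  hRF : Γ none = -(H * ricM d Γ)

variable {d : Option (Fin n) → Derivation ℝ A A}
  {G H : Matrix (Fin n) (Fin n) A} {Γ : Option (Fin n) → Matrix (Fin n) (Fin n) A}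

namespace RFData

/-- The spatial curvature endomorphisms. -/
def F (_h : RFData d G H Γ) (i j : Fin n) : Matrix (Fin n) (Fin n) A :=
  curvF d Γ (some i) (some j)

variable (h : RFData d G H Γ)
include h

theorem hHG : H * G = 1 := mul_eq_one_comm.mp h.hGH

theorem hHt : Hᵀ = H := by
  have : (H : Matrix (Fin n) (Fin n) A) * G = Hᵀ * G := by
    rw [h.hHG, ← Matrix.transpose_one, ← h.hGH, Matrix.transpose_mul, h.hG]
  have := congrArg (· * H) this
  simp only [Matrix.mul_assoc, h.hGH, Matrix.mul_one] at this
  exact this.symm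

theorem dH (μ : Option (Fin n)) : dMat d μ H = -(Γ μ * H) - H * (Γ μ)ᵀ := by
  have e : dMat d μ (H * G) = 0 := by rw [h.hHG, dMat_one]
  rw [dMat_mul, h.hcomp] at e
  have e2 := congrArg (· * H) e
  simp only [add_mul, mul_add, Matrix.mul_assoc, h.hGH, Matrix.mul_one, Matrix.zero_mul] at e2
  rw [← Matrix.mul_assoc H G, h.hHG, Matrix.one_mul] at e2
  rw [← sub_eq_zero, ← e2]; abel

theorem F_anti (i j : Fin n) : h.F i j = -h.F j i := curvF_antisymm Γ _ _

theorem skew (μ ν : Option (Fin n)) (k l : Fin n) :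
    (G * curvF d Γ μ ν) k l = -(G * curvF d Γ μ ν) l k :=
  curv_skew_apply h.hd h.hG (h.hcomp μ) (h.hcomp ν) k l

theorem bianchi (i j k l : Fin n) :
    (G * h.F i j) l k + (G * h.F j k) l i + (G * h.F k i) l j = 0 := by
  simp only [Matrix.mul_apply, ← Finset.sum_add_distrib, ← mul_add]
  refine Finset.sum_eq_zero fun m _ => ?_
  rw [F, F, F, bianchi_first h.htor, mul_zero]

theorem pair (i j k l : Fin n) : (G * h.F i j) l k = (G * h.F k l) j i := by
  refine pair_symm_of h.h2 (fun i j k l => (G * h.F i j) l k) ?_ ?_ ?_ i j k l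
  · intro i j k l
    simp only [h.F_anti i j, Matrix.mul_neg, Matrix.neg_apply]
  · intro i j k l; exact h.skew _ _ _ _
  · intro i j k l; exact h.bianchi _ _ _ _

theorem ric_eq (j k : Fin n) : ricM d Γ j k = ∑ i, h.F i j i k := rfl

/-- Lowering the upper index through a contraction with `H`. -/
theorem sum_lower (M : Fin n → Matrix (Fin n) (Fin n) A) (k : Fin n) :
    ∑ i, M i i k = ∑ p, ∑ q, H p q * (G * M p) q k := by
  have : ∀ i, M i i k = (H * (G * M i)) i k := by
    intro i; rw [← Matrix.mul_assoc, h.hHG, Matrix.one_mul]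
  simp only [this]
  rfl

theorem ric_symm (j k : Fin n) : ricM d Γ j k = ricM d Γ k j := by
  rw [h.ric_eq, h.ric_eq, h.sum_lower (fun i => h.F i j), h.sum_lower (fun i => h.F i k),
    Finset.sum_comm]
  refine Finset.sum_congr rfl fun p _ => Finset.sum_congr rfl fun q _ => ?_
  have e : H q p = H p q := congrFun (congrFun h.hHt p) q
  have e2 : (G * h.F k p) j q = -(G * h.F k p) q j := h.skew _ _ _ _
  rw [e, h.pair, e2, h.F_anti, Matrix.mul_neg, Matrix.neg_apply, neg_neg]

/-- The covariant derivative of an endomorphism after lowering an index. -/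
theorem G_D (μ : Option (Fin n)) (M : Matrix (Fin n) (Fin n) A) :
    G * (endConn d Γ).D μ M = dMat d μ (G * M) - (Γ μ)ᵀ * (G * M) - G * M * Γ μ := by
  rw [endConn_apply, dMat_mul, h.hcomp]; noncomm_ring

/-- First covariant derivative of the curvature. -/
def T (p q j : Fin n) : Matrix (Fin n) (Fin n) A :=
  (((endConn d Γ).lift Γ).lift Γ).D (some p) h.F q j

theorem T_apply (p q j : Fin n) : h.T p q j =
    (endConn d Γ).D (some p) (h.F q j) - ∑ k, Γ (some p) k j • h.F q k
      - ∑ k, Γ (some p) k q • h.F k j := by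
  rw [T, Conn.lift_apply, Pi.sub_apply, Conn.lift_apply, Finset.sum_apply]; rfl

theorem G_T (p q i k j : Fin n) : (G * h.T p q i) k j =
    d (some p) ((G * h.F q i) k j) - ∑ m, Γ (some p) m k * (G * h.F q i) m j
      - ∑ m, (G * h.F q i) k m * Γ (some p) m j
      - ∑ m, Γ (some p) m i * (G * h.F q m) k j
      - ∑ m, Γ (some p) m q * (G * h.F m i) k j := by
  rw [h.T_apply, Matrix.mul_sub, Matrix.mul_sub, h.G_D, Matrix.mul_sum, Matrix.mul_sum]
  simp only [Matrix.sub_apply, Matrix.sum_apply, Matrix.mul_smul, Matrix.smul_apply, smul_eq_mul]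
  rw [Matrix.mul_apply (M := (Γ (some p))ᵀ), Matrix.mul_apply (N := Γ (some p))]
  rfl

theorem T_skew (p q i k j : Fin n) : (G * h.T p q i) k j = -(G * h.T p q i) j k := by
  rw [h.G_T, h.G_T]
  have s : ∀ a b k l, (G * h.F a b) k l = -(G * h.F a b) l k := fun a b k l => h.skew _ _ _ _
  have e1 : ∑ m, Γ (some p) m k * (G * h.F q i) m j = -∑ m, (G * h.F q i) j m * Γ (some p) m k := by
    rw [← Finset.sum_neg_distrib]
    exact Finset.sum_congr rfl fun m _ => by rw [s]; ring
  have e2 : ∑ m, (G * h.F q i) k m * Γ (some p) m j = -∑ m, Γ (some p) m j * (G * h.F q i) m k := by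
    rw [← Finset.sum_neg_distrib]
    exact Finset.sum_congr rfl fun m _ => by rw [s]; ring
  have e3 : ∀ f g : Fin n → Fin n, ∀ c : Fin n → A, ∑ m, c m * (G * h.F (f m) (g m)) k j =
      -∑ m, c m * (G * h.F (f m) (g m)) j k := by
    intro f g c
    rw [← Finset.sum_neg_distrib]
    exact Finset.sum_congr rfl fun m _ => by rw [s]; ring
  have e4 := e3 (fun _ => q) id fun m => Γ (some p) m i
  have e5 := e3 id (fun _ => i) fun m => Γ (some p) m q
  simp only [id] at e4 e5
  rw [e1, e2, e4, e5, s q i k j, map_neg]; ring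

theorem T_pair (p q i k j : Fin n) : (G * h.T p q i) k j = (G * h.T p j k) i q := by
  rw [h.G_T, h.G_T]
  have s := h.pair
  have e1 : ∑ m, Γ (some p) m k * (G * h.F q i) m j = ∑ m, Γ (some p) m k * (G * h.F j m) i q :=
    Finset.sum_congr rfl fun m _ => by rw [s]
  have e2 : ∑ m, (G * h.F q i) k m * Γ (some p) m j = ∑ m, Γ (some p) m j * (G * h.F m k) i q :=
    Finset.sum_congr rfl fun m _ => by rw [s, mul_comm]
  have e3 : ∑ m, Γ (some p) m i * (G * h.F q m) k j = ∑ m, Γ (some p) m i * (G * h.F j k) m q :=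
    Finset.sum_congr rfl fun m _ => by rw [s]
  have e4 : ∑ m, Γ (some p) m q * (G * h.F m i) k j = ∑ m, (G * h.F j k) i m * Γ (some p) m q :=
    Finset.sum_congr rfl fun m _ => by rw [s, mul_comm]
  rw [e1, e2, e3, e4, s]; ring

theorem T_anti (p q j : Fin n) : h.T p q j = -h.T p j q := by
  have a := h.F_anti
  rw [h.T_apply, h.T_apply, a q j, map_neg]
  have e1 : ∑ k, Γ (some p) k j • h.F q k = -∑ k, Γ (some p) k j • h.F k q := by
    rw [← Finset.sum_neg_distrib]
    exact Finset.sum_congr rfl fun m _ => by rw [a q m, smul_neg]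
  have e2 : ∑ k, Γ (some p) k q • h.F k j = -∑ k, Γ (some p) k q • h.F j k := by
    rw [← Finset.sum_neg_distrib]
    exact Finset.sum_congr rfl fun m _ => by rw [a m j, smul_neg]
  rw [e1, e2]; abel

/-- The second Bianchi identity. -/
theorem T_bianchi (i j k : Fin n) : h.T i j k + h.T j k i + h.T k i j = 0 := by
  have e := jacobi h.hd Γ (some i) (some j) (some k)
  change (endConn d Γ).D _ (h.F j k) + (endConn d Γ).D _ (h.F k i) + (endConn d Γ).D _ (h.F i j) = 0
    at e
  rw [h.T_apply, h.T_apply, h.T_apply]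
  have c : ∀ a b c : Fin n, ∑ m, Γ (some a) m b • h.F c m = -∑ m, Γ (some b) m a • h.F m c := by
    intro a b c
    rw [← Finset.sum_neg_distrib]
    exact Finset.sum_congr rfl fun m _ => by rw [h.F_anti c m, smul_neg, h.htor a b]
  rw [c i k j, c j i k, c k j i, ← e]; abel

/-- Covariant derivative of the Ricci tensor. -/
def dRic (_h : RFData d G H Γ) (k i j : Fin n) : A := (G * (endConn d Γ).D (some k) (H * ricM d Γ)) i j

theorem dRic_apply (k i j : Fin n) : h.dRic k i j = d (some k) (ricM d Γ i j)
    - ∑ m, Γ (some k) m i * ricM d Γ m j - ∑ m, ricM d Γ i m * Γ (some k) m j := by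
  rw [dRic, h.G_D, ← Matrix.mul_assoc, h.hGH, Matrix.one_mul, Matrix.sub_apply, Matrix.sub_apply,
    Matrix.mul_apply, Matrix.mul_apply]
  rfl

theorem dRic_symm (k i j : Fin n) : h.dRic k i j = h.dRic k j i := by
  rw [h.dRic_apply, h.dRic_apply, h.ric_symm i j]
  have e : ∀ i j, ∑ m, Γ (some k) m i * ricM d Γ m j = ∑ m, ricM d Γ j m * Γ (some k) m i :=
    fun i j => Finset.sum_congr rfl fun m _ => by rw [h.ric_symm m j, mul_comm]
  rw [e i j, e j i]; ring

theorem dRic_eq (k i j : Fin n) : h.dRic k i j = ∑ p, h.T k p i p j := by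
  rw [h.dRic_apply]
  simp only [h.T_apply, Matrix.sub_apply, Matrix.sum_apply, Matrix.smul_apply, smul_eq_mul,
    endConn_apply, Matrix.add_apply, Matrix.mul_apply, Finset.sum_sub_distrib,
    Finset.sum_add_distrib, h.ric_eq, dMat_apply, map_sum, Finset.mul_sum, Finset.sum_mul]
  rw [Finset.sum_comm (f := fun a b => Γ (some k) a i * h.F b a b j),
    Finset.sum_comm (f := fun a b => h.F b i b a * Γ (some k) a j),
    Finset.sum_comm (f := fun a b => Γ (some k) b a * h.F b i a j)]
  ring

theorem dS_sub (i j k : Fin n) : (curvF d Γ none (some i)) k j - (curvF d Γ none (some j)) k i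
    = ((endConn d Γ).D (some i) (H * ricM d Γ)) k j
      - ((endConn d Γ).D (some j) (H * ricM d Γ)) k i := by
  have e : ∀ i : Fin n, curvF d Γ none (some i) = dMat d none (Γ (some i))
      + (endConn d Γ).D (some i) (H * ricM d Γ) := by
    intro i
    rw [curvF, h.hRF, dMat_neg, endConn_apply]; noncomm_ring
  rw [e, e, Matrix.add_apply, Matrix.add_apply, dMat_apply, dMat_apply, h.htor i j]; ring

theorem G_Ft (i j k : Fin n) :
    (G * curvF d Γ none (some i)) k j = h.dRic k i j - h.dRic j i k := by
  have Y : ∀ i j k, (G * curvF d Γ none (some i)) k j - (G * curvF d Γ none (some j)) k i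
      = h.dRic i k j - h.dRic j k i := by
    intro i j k
    rw [dRic, dRic]
    simp only [Matrix.mul_apply (M := G)]
    rw [← Finset.sum_sub_distrib, ← Finset.sum_sub_distrib]
    exact Finset.sum_congr rfl fun m _ => by rw [← mul_sub, h.dS_sub, mul_sub]
  have s := h.skew none
  refine sub_eq_zero.mp (h.h2 _ ?_)
  have r := h.dRic_symm
  linear_combination Y i j k - Y j k i + Y k i j + s (some j) k i - s (some k) i j
    + s (some i) j k - r i j k + r j i k + r k j i

end RFData

end Evolution

end RFlow

namespace RFlow

section Evolution

variable {A : Type*} [CommRing A] [Algebra ℝ A]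
variable {d : Option (Fin n) → Derivation ℝ A A}
  {G H : Matrix (Fin n) (Fin n) A} {Γ : Option (Fin n) → Matrix (Fin n) (Fin n) A}

namespace RFData

variable (h : RFData d G H Γ)
include h

theorem eq_of_G {M N : Matrix (Fin n) (Fin n) A} (e : G * M = G * N) : M = N := by
  have := congrArg (H * ·) e
  simpa only [← Matrix.mul_assoc, h.hHG, Matrix.one_mul] using this

theorem Ft_eq (i : Fin n) :
    curvF d Γ none (some i) = trH H (fun p q => h.T p q i) := by
  apply h.eq_of_G
  ext k j
  rw [h.G_Ft, h.dRic_symm j i k]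
  have e : ∀ m, ∑ p, h.T p j k p m = ∑ p, ∑ q, H p q * (G * h.T p j k) q m :=
    fun m => h.sum_lower (fun p => h.T p j k) m
  have e2 : (G * trH H (fun p q => h.T p q i)) k j = -∑ p, h.T p j k p i := by
    rw [e, trH, Matrix.mul_sum, Matrix.sum_apply, ← Finset.sum_neg_distrib]
    refine Finset.sum_congr rfl fun p _ => ?_
    rw [Matrix.mul_sum, Matrix.sum_apply, ← Finset.sum_neg_distrib]
    refine Finset.sum_congr rfl fun q _ => ?_
    rw [Matrix.mul_smul, Matrix.smul_apply, smul_eq_mul, h.T_pair, h.T_skew]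
    ring
  rw [e2, h.dRic_symm k, h.dRic_eq, h.dRic_eq, ← Finset.sum_neg_distrib, ← Finset.sum_sub_distrib]
  refine Finset.sum_congr rfl fun p _ => ?_
  have b := congrFun (congrFun (h.T_bianchi p j k) p) i
  have b2 := congrFun (congrFun (h.T_anti j p k) p) i
  simp only [Matrix.add_apply, Matrix.neg_apply, Matrix.zero_apply] at b b2
  linear_combination b - b2

/-- Commutator terms in the evolution of the curvature. -/
def Z (i p q j : Fin n) : Matrix (Fin n) (Fin n) A :=
  (h.F i p * h.F q j - h.F q j * h.F i p) - ∑ k, h.F i p k j • h.F q k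
    - ∑ k, h.F i p k q • h.F k j

/-- Second covariant derivative of the curvature. -/
def TT (r p q j : Fin n) : Matrix (Fin n) (Fin n) A :=
  ((((endConn d Γ).lift Γ).lift Γ).lift Γ).D (some r) h.T p q j

theorem TT_apply (r p q j : Fin n) : h.TT r p q j =
    (endConn d Γ).D (some r) (h.T p q j) - ∑ k, Γ (some r) k j • h.T p q k
      - ∑ k, Γ (some r) k q • h.T p k j - ∑ k, Γ (some r) k p • h.T k q j := by
  rw [TT, Conn.lift_apply]
  simp only [Pi.sub_apply, Finset.sum_apply, Pi.smul_apply, Conn.lift_apply]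

theorem TT_comm (i p q j : Fin n) : h.TT i p q j = h.TT p i q j + h.Z i p q j := by
  have e := congrFun (lift_comm ((endConn d Γ).lift Γ) Γ (some i) (some p) h.F q) j
  have e1 := lift_comm (endConn d Γ) Γ (some i) (some p) (h.F q) j
  rw [endConn_comm h.hd] at e1
  simp only [Pi.sub_apply, Finset.sum_apply, Pi.smul_apply] at e
  rw [e1] at e
  have tor : ∑ k, Γ (some i) k p • h.T k q j = ∑ k, Γ (some p) k i • h.T k q j :=
    Finset.sum_congr rfl fun k _ => by rw [h.htor i p]
  have f : ∀ a b, h.TT a b q j = (((endConn d Γ).lift Γ).lift Γ).D (some a)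
      ((((endConn d Γ).lift Γ).lift Γ).D (some b) h.F) q j
      - ∑ k, Γ (some a) k b • h.T k q j := by
    intro a b
    rw [TT, Conn.lift_apply]
    simp only [Pi.sub_apply, Finset.sum_apply, Pi.smul_apply]
    rfl
  rw [f, f, tor, sub_add_eq_add_sub]
  congr 1
  rw [← sub_eq_iff_eq_add', e]
  rfl

theorem TT_bianchi (r i q j : Fin n) : h.TT r i q j - h.TT r j q i = h.TT r q i j := by
  have b : ∀ i q j, h.T i q j = h.T j q i + h.T q i j := by
    intro i q j
    have := h.T_bianchi i q j
    rw [h.T_anti q j i, h.T_anti j i q] at this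
    rw [← sub_eq_zero, ← this]; abel
  simp only [h.TT_apply]
  have s : ∀ (c : Fin n → A) (f g e : Fin n → Matrix (Fin n) (Fin n) A),
      (∀ k, f k = g k + e k) → ∑ k, c k • f k = ∑ k, c k • g k + ∑ k, c k • e k := by
    intro c f g e hh
    simp only [hh, smul_add, Finset.sum_add_distrib]
  rw [b i q j, map_add, s _ _ _ _ fun k => b i q k, s _ _ _ _ fun k => b i k j,
    s _ _ _ _ fun k => b k q j]
  abel

/-- Reaction term in the evolution of the curvature. -/
def Q (i j : Fin n) : Matrix (Fin n) (Fin n) A :=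
  trH H (fun p q => h.Z i p q j - h.Z j p q i)
    + ∑ k, (H * ricM d Γ) k j • h.F i k + ∑ k, (H * ricM d Γ) k i • h.F k j

theorem evol_F (i j : Fin n) :
    (((endConn d Γ).lift Γ).lift Γ).D none h.F i j = trH H (fun p q => h.TT p q i j) + h.Q i j := by
  have J := jacobi h.hd Γ none (some i) (some j)
  rw [curvF_antisymm Γ (some j) none, map_neg] at J
  have e0 : ∀ i j : Fin n, (endConn d Γ).D (some i) (curvF d Γ none (some j))
      = trH H (fun p q => h.TT i p q j) + ∑ k, Γ (some i) k j • curvF d Γ none (some k) := by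
    intro i j
    have t := D_trH ((endConn d Γ).lift Γ) Γ H (some i) (h.dH _) h.T
    have t2 := congrFun t j
    rw [Conn.lift_apply] at t2
    have t3 : trH H h.T = fun j => curvF d Γ none (some j) := by
      funext j; rw [h.Ft_eq]; simp [trH]
    rw [t3] at t2
    have t4 : trH H (fun p q => h.TT i p q j) =
        trH H (((((endConn d Γ).lift Γ).lift Γ).lift Γ).D (some i) h.T) j := by
      simp [trH, TT]
    rw [t4, ← t2, sub_add_cancel]
  have tor : ∑ k, Γ (some i) k j • curvF d Γ none (some k)
      = ∑ k, Γ (some j) k i • curvF d Γ none (some k) :=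
    Finset.sum_congr rfl fun k _ => by rw [h.htor i j]
  rw [e0, e0, tor] at J
  have J2 : (endConn d Γ).D none (h.F i j)
      = trH H (fun p q => h.TT i p q j) - trH H (fun p q => h.TT j p q i) := by
    rw [F, ← sub_eq_zero, ← J]; abel
  have c : trH H (fun p q => h.TT i p q j) - trH H (fun p q => h.TT j p q i)
      = trH H (fun p q => h.TT p q i j) + trH H (fun p q => h.Z i p q j - h.Z j p q i) := by
    simp only [trH, ← Finset.sum_sub_distrib, ← Finset.sum_add_distrib, ← smul_sub, ← smul_add]
    refine Finset.sum_congr rfl fun p _ => Finset.sum_congr rfl fun q _ => ?_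
    rw [h.TT_comm, h.TT_comm j, ← h.TT_bianchi p i q j]
    congr 1; abel
  rw [Conn.lift_apply, Pi.sub_apply, Conn.lift_apply, Finset.sum_apply]
  simp only [Pi.smul_apply]
  rw [J2, c, Q, h.hRF]
  simp only [Matrix.neg_apply, neg_smul, Finset.sum_neg_distrib]
  abel

/-- The metric pairing on `End`-valued two-forms. -/
def B (_h : RFData d G H Γ) : (Fin n → Fin n → Matrix (Fin n) (Fin n) A) →
    (Fin n → Fin n → Matrix (Fin n) (Fin n) A) → A := liftB H (liftB H trB)

theorem B_compat (μ : Option (Fin n)) : Compat (((endConn d Γ).lift Γ).lift Γ) h.B μ :=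
  ((trB_compat Γ μ).lift Γ H (h.dH μ)).lift Γ H (h.dH μ)

theorem liftB_symm {W : Type*} (b : W → W → A) (hb : ∀ x y, b x y = b y x) (S T : Fin n → W) :
    liftB H b S T = liftB H b T S := by
  rw [liftB, Finset.sum_comm]
  refine Finset.sum_congr rfl fun p _ => Finset.sum_congr rfl fun q _ => ?_
  rw [hb]
  have e : H q p = H p q := congrFun (congrFun h.hHt p) q
  rw [e]

theorem B_symm (x y : Fin n → Fin n → Matrix (Fin n) (Fin n) A) : h.B x y = h.B y x := by
  refine h.liftB_symm _ (fun x y => h.liftB_symm _ (fun x y => ?_) x y) x y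
  rw [trB, trB, Matrix.trace_mul_comm]

/-- Evolution of the squared norm of the curvature. -/
theorem evol_u : d none (h.B h.F h.F)
    = ∑ p, ∑ q, H p q * (d (some p) (d (some q) (h.B h.F h.F))
        - ∑ k, Γ (some p) k q * d (some k) (h.B h.F h.F))
      - 2 * ∑ p, ∑ q, H p q * h.B (h.T p) (h.T q) + 2 * h.B h.Q h.F := by
  have L := fun p q => laplace_pairing (((endConn d Γ).lift Γ).lift Γ) h.B h.B_compat h.B_symm
    Γ h.F p q
  have hc := h.B_compat none
  have ev : (((endConn d Γ).lift Γ).lift Γ).D none h.F = trH H (fun p q => h.TT p q) + h.Q := by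
    funext i j
    rw [h.evol_F, Pi.add_apply, Pi.add_apply]
    simp [trH]
  have e1 : h.B (trH H (fun p q => h.TT p q)) h.F = ∑ p, ∑ q, H p q * h.B (h.TT p q) h.F := by
    rw [trH, hc.suml]
    refine Finset.sum_congr rfl fun p _ => ?_
    rw [hc.suml]
    exact Finset.sum_congr rfl fun q _ => hc.smull _ _ _
  rw [hc.compat, ev, h.B_symm h.F, hc.addl, e1]
  have e2 : ∀ p q, d (some p) (d (some q) (h.B h.F h.F))
        - ∑ k, Γ (some p) k q * d (some k) (h.B h.F h.F)
      = 2 * h.B (h.TT p q) h.F + 2 * h.B (h.T p) (h.T q) := L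
  simp only [e2, mul_add, Finset.sum_add_distrib, Finset.mul_sum]
  have e3 : ∀ f : Fin n → Fin n → A, ∑ p, ∑ q, H p q * (2 * f p q) = ∑ p, ∑ q, H p q * f p q
      + ∑ p, ∑ q, H p q * f p q := by
    intro f
    simp only [← Finset.sum_add_distrib]
    exact Finset.sum_congr rfl fun p _ => Finset.sum_congr rfl fun q _ => by ring
  have e4 : ∑ p, ∑ q, 2 * (H p q * h.B (h.T p) (h.T q)) = ∑ p, ∑ q, H p q * h.B (h.T p) (h.T q)
      + ∑ p, ∑ q, H p q * h.B (h.T p) (h.T q) := by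
    simp only [← Finset.sum_add_distrib]
    exact Finset.sum_congr rfl fun p _ => Finset.sum_congr rfl fun q _ => by ring
  rw [e3 fun p q => h.B (h.TT p q) h.F, e3 fun p q => h.B (h.T p) (h.T q), e4]
  ring

end RFData

end Evolution

end RFlow

namespace RFlow

section PointEstimate

variable {A : Type*} [CommRing A] [Algebra ℝ A]
variable {d : Option (Fin n) → Derivation ℝ A A}
  {G H : Matrix (Fin n) (Fin n) A} {Γ : Option (Fin n) → Matrix (Fin n) (Fin n) A}

namespace RFData

variable (h : RFData d G H Γ)
include h

theorem ev_skew (ev : A →+* ℝ) (hG1 : G.map ev = 1) {M : Matrix (Fin n) (Fin n) A}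
    (hM : ∀ k l, (G * M) k l = -(G * M) l k) (k l : Fin n) : ev (M k l) = -ev (M l k) := by
  have e : ∀ k l, ev ((G * M) k l) = ev (M k l) := by
    intro k l
    have : (G * M).map ev = M.map ev := by rw [Matrix.map_mul, hG1, Matrix.one_mul]
    exact congrFun (congrFun this k) l
  have := congrArg ev (hM k l)
  rwa [map_neg, e, e] at this

theorem ev_trH {W : Type*} [AddCommGroup W] [Module A W] (φ : W →+ ℝ) (ev : A →+* ℝ)
    (hφ : ∀ a w, φ (a • w) = ev a * φ w) (hH1 : H.map ev = 1) (T : Fin n → Fin n → W) :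
    φ (trH H T) = ∑ p, φ (T p p) := by
  have e : ∀ p q, ev (H p q) = if p = q then 1 else 0 := by
    intro p q
    have := congrFun (congrFun hH1 p) q
    rwa [Matrix.one_apply] at this
  simp [trH, hφ, e]

theorem ev_B (ev : A →+* ℝ) (hH1 : H.map ev = 1)
    (X Y : Fin n → Fin n → Matrix (Fin n) (Fin n) A) :
    ev (h.B X Y) = -∑ i, ∑ j, ∑ k, ∑ l, ev (X i j k l) * ev (Y i j l k) := by
  have e : ∀ p q, ev (H p q) = if p = q then 1 else 0 := by
    intro p q
    have := congrFun (congrFun hH1 p) q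
    rwa [Matrix.one_apply] at this
  simp [B, liftB, trB, e, Matrix.trace, Matrix.mul_apply]

theorem ev_BF (ev : A →+* ℝ) (hG1 : G.map ev = 1) (hH1 : H.map ev = 1) :
    ev (h.B h.F h.F) = ∑ i, ∑ j, ∑ k, ∑ l, ev (h.F i j k l) ^ 2 := by
  rw [h.ev_B ev hH1]
  simp only [← Finset.sum_neg_distrib]
  refine Finset.sum_congr rfl fun i _ => Finset.sum_congr rfl fun j _ =>
    Finset.sum_congr rfl fun k _ => Finset.sum_congr rfl fun l _ => ?_
  have e : ev (h.F i j l k) = -ev (h.F i j k l) := h.ev_skew ev hG1 (h.skew _ _) l k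
  rw [e]
  change -(ev (h.F i j k l) * -ev (h.F i j k l)) = _
  ring

theorem ev_le (ev : A →+* ℝ) (hG1 : G.map ev = 1) (hH1 : H.map ev = 1) (i j k l : Fin n) :
    |ev (h.F i j k l)| ≤ √(ev (h.B h.F h.F)) := by
  apply Real.abs_le_sqrt
  rw [h.ev_BF ev hG1 hH1]
  have s : ∀ (f : Fin n → ℝ) (i : Fin n), (∀ i, 0 ≤ f i) → f i ≤ ∑ i, f i :=
    fun f i hf => Finset.single_le_sum (fun i _ => hf i) (Finset.mem_univ i)
  have p1 : ∀ i j k, 0 ≤ ∑ l, ev (h.F i j k l) ^ 2 :=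
    fun i j k => Finset.sum_nonneg fun l _ => sq_nonneg _
  have p2 : ∀ i j, 0 ≤ ∑ k, ∑ l, ev (h.F i j k l) ^ 2 :=
    fun i j => Finset.sum_nonneg fun l _ => p1 _ _ _
  have p3 : ∀ i, 0 ≤ ∑ j, ∑ k, ∑ l, ev (h.F i j k l) ^ 2 :=
    fun i => Finset.sum_nonneg fun l _ => p2 _ _
  exact (s (fun l => ev (h.F i j k l) ^ 2) l fun _ => sq_nonneg _).trans
    ((s _ k (p1 i j)).trans ((s _ j (p2 i)).trans (s _ i p3)))

theorem ev_BT_nonneg (ev : A →+* ℝ) (hG1 : G.map ev = 1) (hH1 : H.map ev = 1) :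
    0 ≤ ev (∑ p, ∑ q, H p q * h.B (h.T p) (h.T q)) := by
  have e : ∀ p q, ev (H p q) = if p = q then 1 else 0 := by
    intro p q
    have := congrFun (congrFun hH1 p) q
    rwa [Matrix.one_apply] at this
  simp only [map_sum, map_mul, e, ite_mul, one_mul, zero_mul, Finset.sum_ite_eq, Finset.mem_univ,
    if_true]
  refine Finset.sum_nonneg fun p _ => ?_
  rw [h.ev_B ev hH1]
  simp only [← Finset.sum_neg_distrib]
  refine Finset.sum_nonneg fun i _ => Finset.sum_nonneg fun j _ =>
    Finset.sum_nonneg fun k _ => Finset.sum_nonneg fun l _ => ?_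
  rw [h.ev_skew ev hG1 (h.T_skew _ _ _) l k]
  nlinarith [sq_nonneg (ev (h.T p i j k l))]

omit h in
theorem sum_abs_le {f : Fin n → ℝ} {c : ℝ} (hf : ∀ i, |f i| ≤ c) : |∑ i, f i| ≤ n * c := by
  refine (Finset.abs_sum_le_sum_abs _ _).trans ?_
  refine (Finset.sum_le_sum fun i _ => hf i).trans ?_
  simp

theorem ev_Q_le (ev : A →+* ℝ) (hH1 : H.map ev = 1) {s : ℝ} (hs0 : 0 ≤ s)
    (hs : ∀ i j k l, |ev (h.F i j k l)| ≤ s) (i j k l : Fin n) :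
    |ev (h.Q i j k l)| ≤ 10 * n ^ 2 * s ^ 2 := by
  have m : ∀ {a b : ℝ}, |a| ≤ s → |b| ≤ s → |a * b| ≤ s ^ 2 := by
    intro a b ha hb
    rw [abs_mul, sq]; exact mul_le_mul ha hb (abs_nonneg _) hs0
  have hZ : ∀ i p q j k l, |ev (h.Z i p q j k l)| ≤ 4 * n * s ^ 2 := by
    intro i p q j k l
    have e : ev (h.Z i p q j k l) = ∑ m, ev (h.F i p k m) * ev (h.F q j m l)
        - ∑ m, ev (h.F q j k m) * ev (h.F i p m l) - ∑ m, ev (h.F i p m j) * ev (h.F q m k l)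
        - ∑ m, ev (h.F i p m q) * ev (h.F m j k l) := by
      simp [Z, Matrix.mul_apply, Matrix.sum_apply]
    have b1 := sum_abs_le fun m' => m (hs i p k m') (hs q j m' l)
    have b2 := sum_abs_le fun m' => m (hs q j k m') (hs i p m' l)
    have b3 := sum_abs_le fun m' => m (hs i p m' j) (hs q m' k l)
    have b4 := sum_abs_le fun m' => m (hs i p m' q) (hs m' j k l)
    rw [e]
    rw [abs_le] at *
    constructor <;> linarith
  have hS : ∀ k j, |ev ((H * ricM d Γ) k j)| ≤ n * s := by
    intro k j
    have e : ev ((H * ricM d Γ) k j) = ∑ i, ev (h.F i k i j) := by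
      have : (H * ricM d Γ).map ev = (ricM d Γ).map ev := by rw [Matrix.map_mul, hH1, Matrix.one_mul]
      have := congrFun (congrFun this k) j
      rw [Matrix.map_apply, Matrix.map_apply, h.ric_eq, map_sum] at this
      exact this
    rw [e]
    exact sum_abs_le fun i => hs _ _ _ _
  have e : ev (h.Q i j k l) = ∑ p, (ev (h.Z i p p j k l) - ev (h.Z j p p i k l))
      + ∑ m, ev ((H * ricM d Γ) m j) * ev (h.F i m k l)
      + ∑ m, ev ((H * ricM d Γ) m i) * ev (h.F m j k l) := by
    have t := h.ev_trH (W := Matrix (Fin n) (Fin n) A)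
      (AddMonoidHom.mk' (fun M => ev (M k l)) (by intro a b; simp)) ev (by intro a b; simp) hH1
      (fun p q => h.Z i p q j - h.Z j p q i)
    simp only [AddMonoidHom.mk'_apply, Matrix.sub_apply, map_sub] at t
    rw [Q, Matrix.add_apply, Matrix.add_apply, map_add, map_add, t]
    simp [Matrix.sum_apply]
  have mm : ∀ {a b : ℝ}, |a| ≤ n * s → |b| ≤ s → |a * b| ≤ n * s ^ 2 := by
    intro a b ha hb
    rw [abs_mul, sq, ← mul_assoc]; exact mul_le_mul ha hb (abs_nonneg _) (by positivity)
  have b1 := sum_abs_le (n := n) (f := fun p => ev (h.Z i p p j k l) - ev (h.Z j p p i k l))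
    (c := 8 * n * s ^ 2) (fun p => by
      have := hZ i p p j k l
      have := hZ j p p i k l
      rw [abs_le] at *
      constructor <;> linarith)
  have b2 := sum_abs_le fun m => mm (hS m j) (hs i m k l)
  have b3 := sum_abs_le fun m => mm (hS m i) (hs m j k l)
  rw [e]
  rw [abs_le] at *
  constructor <;> nlinarith

/-- Reaction terms are cubic in the curvature. -/
theorem ev_reaction_le (ev : A →+* ℝ) (hG1 : G.map ev = 1) (hH1 : H.map ev = 1) :
    ev (2 * h.B h.Q h.F - 2 * ∑ p, ∑ q, H p q * h.B (h.T p) (h.T q))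
      ≤ 20 * n ^ 6 * (ev (h.B h.F h.F) * √(ev (h.B h.F h.F))) := by
  set u := ev (h.B h.F h.F) with hu
  have hu0 : 0 ≤ u := by
    rw [hu, h.ev_BF ev hG1 hH1]
    positivity
  have hs0 : 0 ≤ √u := Real.sqrt_nonneg u
  have hs := h.ev_le ev hG1 hH1
  have hQ := h.ev_Q_le ev hH1 hs0 hs
  have hQF : |ev (h.B h.Q h.F)| ≤ n * (n * (n * (n * (10 * n ^ 2 * √u ^ 2 * √u)))) := by
    rw [h.ev_B ev hH1, abs_neg]
    refine sum_abs_le fun i => sum_abs_le fun j => sum_abs_le fun k => sum_abs_le fun l => ?_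
    rw [abs_mul]
    exact mul_le_mul (hQ _ _ _ _) (hs _ _ _ _) (abs_nonneg _) (by positivity)
  have h1 := h.ev_BT_nonneg ev hG1 hH1
  rw [map_sub, map_mul, map_mul, map_ofNat]
  rw [Real.sq_sqrt hu0] at hQF
  have := (abs_le.mp hQF).2
  nlinarith

end RFData

end PointEstimate

section LinearChange

variable {A : Type*} [CommRing A] [Algebra ℝ A]
variable {d : Option (Fin n) → Derivation ℝ A A}
  {G H : Matrix (Fin n) (Fin n) A} {Γ : Option (Fin n) → Matrix (Fin n) (Fin n) A}

/-- Derivations in a new constant frame. -/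
def dC (e : Option (Fin n) → Option (Fin n) → ℝ) (d : Option (Fin n) → Derivation ℝ A A)
    (μ : Option (Fin n)) : Derivation ℝ A A := ∑ ρ, e ρ μ • d ρ

/-- Connection coefficients in a new constant frame. -/
def ΓC (e : Option (Fin n) → Option (Fin n) → ℝ) (E E' : Matrix (Fin n) (Fin n) A)
    (Γ : Option (Fin n) → Matrix (Fin n) (Fin n) A) (μ : Option (Fin n)) :
    Matrix (Fin n) (Fin n) A := ∑ ρ, e ρ μ • (E' * Γ ρ * E)

theorem dC_apply (e : Option (Fin n) → Option (Fin n) → ℝ) (μ : Option (Fin n)) (a : A) :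
    dC e d μ a = ∑ ρ, e ρ μ • d ρ a := by
  rw [dC]
  exact map_sum (AddMonoidHom.mk' (fun D : Derivation ℝ A A => D a) fun _ _ => rfl)
    (fun ρ => e ρ μ • d ρ) Finset.univ

theorem dMat_dC (e : Option (Fin n) → Option (Fin n) → ℝ) (μ : Option (Fin n))
    (M : Matrix (Fin n) (Fin n) A) : dMat (dC e d) μ M = ∑ ρ, e ρ μ • dMat d ρ M := by
  ext i j
  rw [dMat_apply, dC_apply, Matrix.sum_apply]; rfl

theorem dMat_sum (μ : Option (Fin n)) {κ : Type*} (s : Finset κ)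
    (M : κ → Matrix (Fin n) (Fin n) A) : dMat d μ (∑ k ∈ s, M k) = ∑ k ∈ s, dMat d μ (M k) := by
  ext i j
  simp [dMat_apply, Matrix.sum_apply]

theorem dMat_smul (μ : Option (Fin n)) (c : ℝ)
    (M : Matrix (Fin n) (Fin n) A) : dMat d μ (c • M) = c • dMat d μ M := by
  ext i j
  simp [dMat_apply]

theorem curvF_change (e : Option (Fin n) → Option (Fin n) → ℝ) {E E' : Matrix (Fin n) (Fin n) A}
    (hE : ∀ μ, dMat d μ E = 0) (hE' : ∀ μ, dMat d μ E' = 0) (hEE : E * E' = 1)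
    (μ ν : Option (Fin n)) :
    curvF (dC e d) (ΓC e E E' Γ) μ ν
      = ∑ ρ, ∑ σ, (e ρ μ * e σ ν) • (E' * curvF d Γ ρ σ * E) := by
  have hm : ∀ X Y : Matrix (Fin n) (Fin n) A, E' * X * E * (E' * Y * E) = E' * (X * Y) * E := by
    intro X Y
    calc _ = E' * X * (E * E') * Y * E := by noncomm_ring
      _ = _ := by rw [hEE]; noncomm_ring
  have hd : ∀ ρ σ, dMat d ρ (E' * Γ σ * E) = E' * dMat d ρ (Γ σ) * E := by
    intro ρ σ
    rw [dMat_mul, dMat_mul, hE, hE']; noncomm_ring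
  have t1 : ∀ μ ν, dMat (dC e d) μ (ΓC e E E' Γ ν)
      = ∑ ρ, ∑ σ, (e ρ μ * e σ ν) • (E' * dMat d ρ (Γ σ) * E) := by
    intro μ ν
    rw [dMat_dC, ΓC]
    simp only [dMat_sum, dMat_smul, hd, Finset.smul_sum, smul_smul]
  have t2 : ∀ μ ν, ΓC e E E' Γ μ * ΓC e E E' Γ ν
      = ∑ ρ, ∑ σ, (e ρ μ * e σ ν) • (E' * (Γ ρ * Γ σ) * E) := by
    intro μ ν
    simp only [ΓC, Finset.sum_mul, Finset.mul_sum, Matrix.smul_mul, Matrix.mul_smul, hm, smul_smul]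
    rw [Finset.sum_comm]
    refine Finset.sum_congr rfl fun p _ => Finset.sum_congr rfl fun q _ => ?_
    rw [mul_comm]
  rw [curvF, t1, t1, t2, t2]
  rw [Finset.sum_comm (f := fun ρ σ => (e ρ ν * e σ μ) • (E' * dMat d ρ (Γ σ) * E)),
    Finset.sum_comm (f := fun ρ σ => (e ρ ν * e σ μ) • (E' * (Γ ρ * Γ σ) * E))]
  simp only [← Finset.sum_sub_distrib, ← Finset.sum_add_distrib]
  refine Finset.sum_congr rfl fun p _ => Finset.sum_congr rfl fun q _ => ?_
  rw [mul_comm (e q ν), ← smul_sub, ← smul_add, ← smul_sub]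
  congr 1
  rw [curvF]; noncomm_ring

/-- Space-time frame induced by a spatial frame. -/
def frameOpt (E : Matrix (Fin n) (Fin n) ℝ) : Option (Fin n) → Option (Fin n) → ℝ
  | none, none => 1
  | none, some _ => 0
  | some _, none => 0
  | some i, some a => E i a

theorem sum_reorder {M : Type*} [AddCommMonoid M] (f : Fin n → Fin n → Fin n → Fin n → M) :
    ∑ a, ∑ b, ∑ i, ∑ j, f a b i j = ∑ i, ∑ j, ∑ b, ∑ a, f a b i j := by
  calc _ = ∑ a, ∑ i, ∑ b, ∑ j, f a b i j :=
          Finset.sum_congr rfl fun a _ => Finset.sum_comm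
      _ = ∑ i, ∑ a, ∑ b, ∑ j, f a b i j := Finset.sum_comm
      _ = ∑ i, ∑ a, ∑ j, ∑ b, f a b i j :=
          Finset.sum_congr rfl fun a _ => Finset.sum_congr rfl fun a _ => Finset.sum_comm
      _ = ∑ i, ∑ j, ∑ a, ∑ b, f a b i j :=
          Finset.sum_congr rfl fun a _ => Finset.sum_comm
      _ = _ := Finset.sum_congr rfl fun a _ => Finset.sum_congr rfl fun a _ => Finset.sum_comm

theorem liftB_change {W : Type*} [AddCommGroup W] [Module A W] (b b' : W → W → A)
    (E : Matrix (Fin n) (Fin n) A) {H' : Matrix (Fin n) (Fin n) A} (hH : H = E * H' * Eᵀ)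
    {c : Conn d W} {μ : Option (Fin n)} (hb : Compat c b μ) (X Y : Fin n → W) (φ : W → W)
    (hφ : ∀ x y, b' (φ x) (φ y) = b x y) :
    liftB H' b' (fun a => φ (∑ i, E i a • X i)) (fun a => φ (∑ i, E i a • Y i)) = liftB H b X Y := by
  simp only [liftB, hφ, hb.suml, hb.sumr, hb.smull, hb.smulr, hH, Matrix.mul_apply,
    Finset.mul_sum, Finset.sum_mul, Matrix.transpose_apply]
  rw [sum_reorder]
  exact Finset.sum_congr rfl fun i _ => Finset.sum_congr rfl fun j _ => Finset.sum_congr rfl fun b _ =>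
    Finset.sum_congr rfl fun a _ => by ring

namespace RFData

variable (h : RFData d G H Γ) {E E' : Matrix (Fin n) (Fin n) ℝ}
include h

omit h in
theorem dMat_const (μ : Option (Fin n)) (M : Matrix (Fin n) (Fin n) ℝ) :
    dMat d μ (M.map (algebraMap ℝ A)) = 0 := by
  ext i j
  rw [dMat_apply, Matrix.map_apply, Derivation.map_algebraMap]; rfl

omit h in
theorem map_inv (hE : E * E' = 1) :
    E.map (algebraMap ℝ A) * E'.map (algebraMap ℝ A) = 1 := by
  rw [← Matrix.map_mul, hE, Matrix.map_one _ (map_zero _) (map_one _)]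

omit h in
theorem curvF_frame (hE : E * E' = 1) (i j : Fin n) :
    curvF (dC (frameOpt E) d) (ΓC (frameOpt E) (E.map (algebraMap ℝ A)) (E'.map (algebraMap ℝ A)) Γ)
      (some i) (some j) = ∑ p, ∑ q, (E p i * E q j) • (E'.map (algebraMap ℝ A) *
        curvF d Γ (some p) (some q) * E.map (algebraMap ℝ A)) := by
  rw [curvF_change _ (fun μ => dMat_const μ E) (fun μ => dMat_const μ E') (map_inv hE)]
  simp [Fintype.sum_option, frameOpt]

omit h in
theorem ricM_frame (hE : E * E' = 1) :
    ricM (dC (frameOpt E) d)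
        (ΓC (frameOpt E) (E.map (algebraMap ℝ A)) (E'.map (algebraMap ℝ A)) Γ)
      = (E.map (algebraMap ℝ A))ᵀ * ricM d Γ * E.map (algebraMap ℝ A) := by
  ext b c
  have key : ∀ (i : Fin n) (M : Matrix (Fin n) (Fin n) A),
      ∑ a, E i a • (E'.map (algebraMap ℝ A) * M * E.map (algebraMap ℝ A)) a c
        = (M * E.map (algebraMap ℝ A)) i c := by
    intro i M
    have : M * E.map (algebraMap ℝ A) = E.map (algebraMap ℝ A) *
      (E'.map (algebraMap ℝ A) * M * E.map (algebraMap ℝ A)) := by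
      rw [← Matrix.mul_assoc, ← Matrix.mul_assoc, map_inv hE, Matrix.one_mul]
    rw [this, Matrix.mul_apply (M := E.map (algebraMap ℝ A))]
    exact Finset.sum_congr rfl fun a _ => by rw [Matrix.map_apply, Algebra.smul_def]
  have l : ricM (dC (frameOpt E) d)
        (ΓC (frameOpt E) (E.map (algebraMap ℝ A)) (E'.map (algebraMap ℝ A)) Γ) b c
      = ∑ q, ∑ p, E q b • (curvF d Γ (some p) (some q) * E.map (algebraMap ℝ A)) p c := by
    simp only [ricM, Matrix.of_apply, curvF_frame hE, Matrix.sum_apply, Matrix.smul_apply]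
    rw [Finset.sum_comm]
    conv_rhs => rw [Finset.sum_comm]
    refine Finset.sum_congr rfl fun p _ => ?_
    rw [Finset.sum_comm]
    refine Finset.sum_congr rfl fun q _ => ?_
    rw [← key, Finset.smul_sum]
    exact Finset.sum_congr rfl fun a _ => by rw [smul_smul, mul_comm]
  rw [l, Matrix.mul_assoc, Matrix.mul_apply]
  refine Finset.sum_congr rfl fun q _ => ?_
  rw [← Finset.smul_sum, Matrix.transpose_apply, Matrix.map_apply, ← Algebra.smul_def]
  congr 1
  simp only [Matrix.mul_apply, ricM, Matrix.of_apply, Finset.sum_mul]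
  rw [Finset.sum_comm]

/-- A Ricci flow in a new linear coordinate system. -/
theorem frame (hE : E * E' = 1) : RFData (dC (frameOpt E) d)
    ((E.map (algebraMap ℝ A))ᵀ * G * E.map (algebraMap ℝ A))
    (E'.map (algebraMap ℝ A) * H * (E'.map (algebraMap ℝ A))ᵀ)
    (ΓC (frameOpt E) (E.map (algebraMap ℝ A)) (E'.map (algebraMap ℝ A)) Γ) := by
  have hEE : E.map (algebraMap ℝ A) * E'.map (algebraMap ℝ A) = 1 := map_inv hE
  have hEE' : E'.map (algebraMap ℝ A) * E.map (algebraMap ℝ A) = 1 := mul_eq_one_comm.mp hEE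
  have hcE := fun μ => dMat_const (d := d) μ E
  set P := E.map (algebraMap ℝ A) with hP
  set P' := E'.map (algebraMap ℝ A) with hP'
  have ht : Pᵀ * P'ᵀ = 1 := by rw [← Matrix.transpose_mul, hEE', Matrix.transpose_one]
  have ht' : P'ᵀ * Pᵀ = 1 := by rw [← Matrix.transpose_mul, hEE, Matrix.transpose_one]
  refine ⟨?_, h.h2, ?_, ?_, ?_, ?_, ?_⟩
  · intro μ ν a
    simp only [dC_apply, map_sum, Derivation.map_smul, Finset.smul_sum]
    rw [Finset.sum_comm]
    refine Finset.sum_congr rfl fun p _ => Finset.sum_congr rfl fun q _ => ?_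
    rw [smul_comm, h.hd]
  · rw [Matrix.transpose_mul, Matrix.transpose_mul, h.hG, Matrix.transpose_transpose,
      Matrix.mul_assoc]
  · calc _ = Pᵀ * G * (P * P') * H * P'ᵀ := by noncomm_ring
      _ = Pᵀ * (G * H) * P'ᵀ := by rw [hEE]; noncomm_ring
      _ = 1 := by rw [h.hGH, Matrix.mul_one, ht]
  · intro μ
    rw [dMat_dC, ΓC, Matrix.transpose_sum, Finset.sum_mul, Finset.mul_sum,
      ← Finset.sum_add_distrib]
    refine Finset.sum_congr rfl fun ρ _ => ?_
    rw [dMat_mul, dMat_mul, dMat_transpose, hcE, h.hcomp, Matrix.transpose_smul,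
      Matrix.smul_mul, Matrix.mul_smul, ← smul_add]
    congr 1
    rw [Matrix.transpose_mul, Matrix.transpose_mul]
    have e1 : Pᵀ * ((Γ ρ)ᵀ * P'ᵀ) * (Pᵀ * G * P) = Pᵀ * (Γ ρ)ᵀ * G * P := by
      calc _ = Pᵀ * (Γ ρ)ᵀ * (P'ᵀ * Pᵀ) * G * P := by noncomm_ring
        _ = _ := by rw [ht']; noncomm_ring
    have e2 : Pᵀ * G * P * (P' * Γ ρ * P) = Pᵀ * G * Γ ρ * P := by
      calc _ = Pᵀ * G * (P * P') * Γ ρ * P := by noncomm_ring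
        _ = _ := by rw [hEE]; noncomm_ring
    rw [e1, e2]
    simp only [Matrix.transpose_zero]
    noncomm_ring
  · intro i j k
    have e : ∀ i j k, ΓC (frameOpt E) P P' Γ (some i) k j
        = ∑ p, ∑ q, ∑ m, (E p i * E q j) • (P' k m * Γ (some p) m q) := by
      intro i j k
      rw [ΓC, Fintype.sum_option]
      simp only [frameOpt, zero_smul, zero_add]
      simp only [Matrix.sum_apply, Matrix.smul_apply, Matrix.mul_apply, Finset.sum_mul, Finset.smul_sum]
      refine Finset.sum_congr rfl fun p _ => Finset.sum_congr rfl fun q _ =>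
        Finset.sum_congr rfl fun m _ => ?_
      rw [hP, Matrix.map_apply, mul_smul, mul_comm, ← Algebra.smul_def]
    rw [e, e, Finset.sum_comm]
    refine Finset.sum_congr rfl fun p _ => Finset.sum_congr rfl fun q _ =>
        Finset.sum_congr rfl fun m _ => ?_
    rw [h.htor q p, mul_comm]
  · rw [ricM_frame hE]
    have : ΓC (frameOpt E) P P' Γ none = P' * Γ none * P := by
      simp [ΓC, Fintype.sum_option, frameOpt]
    rw [this, h.hRF]
    calc _ = -(P' * H * 1 * ricM d Γ * P) := by noncomm_ring
      _ = _ := by rw [← ht']; noncomm_ring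

theorem frame_B (hE : E * E' = 1) :
    (h.frame hE).B (h.frame hE).F (h.frame hE).F = h.B h.F h.F := by
  have hEE : E.map (algebraMap ℝ A) * E'.map (algebraMap ℝ A) = 1 := map_inv hE
  have hcomp1 := (trB_compat (d := d) Γ none).lift Γ H (h.dH none)
  have hcomp0 := (trB_compat (d := d) Γ none)
  have hF : (h.frame hE).F = fun a => (fun (X : Fin n → Matrix (Fin n) (Fin n) A) (b : Fin n) =>
      (fun M => E'.map (algebraMap ℝ A) * M * E.map (algebraMap ℝ A))
        (∑ j, (E.map (algebraMap ℝ A)) j b • X j)) (∑ i, (E.map (algebraMap ℝ A)) i a • h.F i) := by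
    funext a b
    rw [F, curvF_frame hE]
    simp only [Finset.sum_apply, Pi.smul_apply, Finset.mul_sum, Finset.sum_mul, Finset.smul_sum,
      Matrix.mul_smul, Matrix.smul_mul, Matrix.map_apply]
    rw [Finset.sum_comm]
    refine Finset.sum_congr rfl fun q _ => Finset.sum_congr rfl fun p _ => ?_
    rw [algebraMap_smul, algebraMap_smul, smul_smul, mul_comm]
    rfl
  have hH : H = E.map (algebraMap ℝ A) * (E'.map (algebraMap ℝ A) * H * (E'.map (algebraMap ℝ A))ᵀ)
      * (E.map (algebraMap ℝ A))ᵀ := by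
    set P := E.map (algebraMap ℝ A)
    set P' := E'.map (algebraMap ℝ A)
    calc _ = (P * P') * H * (P * P')ᵀ := by rw [hEE]; simp
      _ = _ := by rw [Matrix.transpose_mul]; noncomm_ring
  rw [hF, B, B]
  refine liftB_change (liftB H trB) (liftB _ trB) (E.map (algebraMap ℝ A)) hH hcomp1 h.F h.F
    (fun (X : Fin n → Matrix (Fin n) (Fin n) A) (b : Fin n) =>
      (fun M => E'.map (algebraMap ℝ A) * M * E.map (algebraMap ℝ A))
        (∑ j, (E.map (algebraMap ℝ A)) j b • X j)) fun x y => ?_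
  refine liftB_change trB trB (E.map (algebraMap ℝ A)) hH hcomp0 x y
    (fun M => E'.map (algebraMap ℝ A) * M * E.map (algebraMap ℝ A)) fun M N => ?_
  set P := E.map (algebraMap ℝ A)
  set P' := E'.map (algebraMap ℝ A)
  have e : P' * M * P * (P' * N * P) = P' * (M * N * P) := by
    calc _ = P' * M * (P * P') * N * P := by noncomm_ring
      _ = _ := by rw [hEE]; noncomm_ring
  simp only [trB, e]
  rw [Matrix.trace_mul_comm, Matrix.mul_assoc, hEE, Matrix.mul_one]

theorem frame_lap (hE : E * E' = 1) (u : A) :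
    ∑ a, ∑ b, (E'.map (algebraMap ℝ A) * H * (E'.map (algebraMap ℝ A))ᵀ) a b *
      (dC (frameOpt E) d (some a) (dC (frameOpt E) d (some b) u)
        - ∑ c, ΓC (frameOpt E) (E.map (algebraMap ℝ A)) (E'.map (algebraMap ℝ A)) Γ (some a) c b
          * dC (frameOpt E) d (some c) u)
    = ∑ p, ∑ q, H p q * (d (some p) (d (some q) u) - ∑ k, Γ (some p) k q * d (some k) u) := by
  have hEE : E.map (algebraMap ℝ A) * E'.map (algebraMap ℝ A) = 1 := map_inv hE
  have hH : H = E.map (algebraMap ℝ A) * (E'.map (algebraMap ℝ A) * H * (E'.map (algebraMap ℝ A))ᵀ)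
      * (E.map (algebraMap ℝ A))ᵀ := by
    set P := E.map (algebraMap ℝ A)
    set P' := E'.map (algebraMap ℝ A)
    calc _ = (P * P') * H * (P * P')ᵀ := by rw [hEE]; simp
      _ = _ := by rw [Matrix.transpose_mul]; noncomm_ring
  have hD : ∀ b, dC (frameOpt E) d (some b) u = ∑ i, E i b • d (some i) u := by
    intro b; simp [dC_apply, Fintype.sum_option, frameOpt]
  have hDD : ∀ a b, dC (frameOpt E) d (some a) (dC (frameOpt E) d (some b) u)
      = ∑ p, ∑ q, (E p a * E q b) • d (some p) (d (some q) u) := by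
    intro a b
    rw [hD, dC_apply, Fintype.sum_option]
    simp only [frameOpt, zero_smul, zero_add]
    simp only [map_sum, Derivation.map_smul, Finset.smul_sum, smul_smul]
  have hΓ : ∀ a b, ∑ c, ΓC (frameOpt E) (E.map (algebraMap ℝ A)) (E'.map (algebraMap ℝ A)) Γ
      (some a) c b * dC (frameOpt E) d (some c) u
      = ∑ p, ∑ q, (E p a * E q b) • ∑ k, Γ (some p) k q * d (some k) u := by
    intro a b
    have e1 : ∀ c, ΓC (frameOpt E) (E.map (algebraMap ℝ A)) (E'.map (algebraMap ℝ A)) Γ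
      (some a) c b = ∑ p, E p a • (E'.map (algebraMap ℝ A) * (Γ (some p) * E.map (algebraMap ℝ A))) c b := by
      intro c
      simp [ΓC, Fintype.sum_option, frameOpt, Matrix.sum_apply, Matrix.mul_assoc]
    simp only [e1, hD, Finset.sum_mul]
    rw [Finset.sum_comm]
    refine Finset.sum_congr rfl fun p _ => ?_
    have e2 : ∀ M : Matrix (Fin n) (Fin n) A, ∑ c, (E'.map (algebraMap ℝ A) * M) c b *
        ∑ i, E i c • d (some i) u = ∑ i, M i b * d (some i) u := by
      intro M
      have : M = E.map (algebraMap ℝ A) * (E'.map (algebraMap ℝ A) * M) := by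
        rw [← Matrix.mul_assoc, hEE, Matrix.one_mul]
      conv_rhs => rw [this]
      simp only [Finset.mul_sum, Matrix.mul_apply (M := E.map (algebraMap ℝ A)), Finset.sum_mul]
      rw [Finset.sum_comm]
      refine Finset.sum_congr rfl fun i _ => Finset.sum_congr rfl fun c _ => ?_
      rw [Matrix.map_apply, ← Algebra.smul_def, mul_smul_comm, smul_mul_assoc]
    simp only [smul_mul_assoc, ← Finset.smul_sum, e2, mul_smul]
    congr 1
    simp only [Matrix.mul_apply, Finset.sum_mul, Finset.smul_sum]
    rw [Finset.sum_comm]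
    refine Finset.sum_congr rfl fun i _ => Finset.sum_congr rfl fun c _ => ?_
    rw [Matrix.map_apply, Algebra.smul_def]; ring
  simp only [hDD, hΓ, ← Finset.sum_sub_distrib, ← smul_sub]
  generalize (fun p q => d (some p) (d (some q) u) - ∑ k, Γ (some p) k q * d (some k) u) = D
  generalize E'.map (algebraMap ℝ A) * H * (E'.map (algebraMap ℝ A))ᵀ = H' at hH ⊢
  rw [hH]
  simp only [Matrix.mul_apply, Finset.mul_sum, Finset.sum_mul, Matrix.transpose_apply,
    Matrix.map_apply]
  rw [sum_reorder]
  refine Finset.sum_congr rfl fun i _ => Finset.sum_congr rfl fun j _ => Finset.sum_congr rfl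
    fun b _ => Finset.sum_congr rfl fun a _ => ?_
  rw [Algebra.smul_def, map_mul]; ring

end RFData

end LinearChange

end RFlow

namespace RFlow

section

variable {A : Type*} [CommRing A] [Algebra ℝ A]
variable {d : Option (Fin n) → Derivation ℝ A A}
  {G H : Matrix (Fin n) (Fin n) A} {Γ : Option (Fin n) → Matrix (Fin n) (Fin n) A}

namespace RFData

variable (h : RFData d G H Γ)
include h

/-- Pointwise differential inequality for the squared norm of the curvature. -/
theorem point_estimate (ev : A →ₐ[ℝ] ℝ) {E E' : Matrix (Fin n) (Fin n) ℝ} (hE : E * E' = 1)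
    (hEG : Eᵀ * G.map ev * E = 1) :
    ev (d none (h.B h.F h.F)) ≤ ∑ p, ∑ q, ev (H p q) * (ev (d (some p) (d (some q) (h.B h.F h.F)))
        - ∑ k, ev (Γ (some p) k q) * ev (d (some k) (h.B h.F h.F)))
      + 20 * n ^ 6 * (ev (h.B h.F h.F) * √(ev (h.B h.F h.F))) := by
  have hm : ∀ M : Matrix (Fin n) (Fin n) ℝ, (M.map (algebraMap ℝ A)).map (ev : A →+* ℝ) = M := by
    intro M; ext i j; simp
  have hG1 : ((E.map (algebraMap ℝ A))ᵀ * G * E.map (algebraMap ℝ A)).map (ev : A →+* ℝ) = 1 := by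
    rw [Matrix.map_mul, Matrix.map_mul, hm, ← Matrix.transpose_map, hm]; exact hEG
  have hH1 : (E'.map (algebraMap ℝ A) * H * (E'.map (algebraMap ℝ A))ᵀ).map (ev : A →+* ℝ) = 1 := by
    have := congrArg (fun M => M.map (ev : A →+* ℝ)) (h.frame hE).hGH
    simp only [Matrix.map_mul (L := (E.map (algebraMap ℝ A))ᵀ * G * E.map (algebraMap ℝ A)), hG1,
      Matrix.one_mul] at this
    rw [this, Matrix.map_one _ (map_zero _) (map_one _)]
  have r := (h.frame hE).ev_reaction_le ev hG1 hH1
  have e := (h.frame hE).evol_u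
  rw [h.frame_lap hE] at e
  rw [h.frame_B hE] at e r
  have hn : dC (frameOpt E) d none (h.B h.F h.F) = d none (h.B h.F h.F) := by
    simp [dC_apply, Fintype.sum_option, frameOpt]
  rw [hn] at e
  rw [e]
  have e2 : ∀ X Y Z : A, X - Y + Z = X + (Z - Y) := by intros; ring
  rw [e2, map_add]
  refine add_le_add (le_of_eq ?_) r
  simp only [map_sum, map_mul, map_sub]

theorem ev_B_eq (ev : A →ₐ[ℝ] ℝ) : ev (h.B h.F h.F) =
    ∑ i, ∑ j, ∑ k, ∑ l, ∑ a, ∑ b, ∑ c, ∑ e, ev (H i a) * ev (H j b) * ev (H k c) * ev (H l e)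
      * ev ((G * h.F i j) l k) * ev ((G * h.F a b) e c) := by
  have key : ∀ i j a b, trB (h.F i j) (h.F a b) =
      ∑ k, ∑ l, ∑ c, ∑ e, H k c * H l e * (G * h.F i j) l k * (G * h.F a b) e c := by
    intro i j a b
    have s : (G * h.F i j)ᵀ = -(G * h.F i j) := by
      ext k l; exact h.skew _ _ _ _
    have e1 : trB (h.F i j) (h.F a b) = (H * ((G * h.F i j)ᵀ * H * (G * h.F a b))ᵀ).trace := by
      rw [s, trB]
      have : -(G * h.F i j) * H * (G * h.F a b) = -(G * (h.F i j * h.F a b)) := by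
        calc _ = -(G * h.F i j * (H * G) * h.F a b) := by noncomm_ring
          _ = _ := by rw [h.hHG]; noncomm_ring
      rw [this, ← Matrix.trace_transpose (H * _), Matrix.transpose_mul, Matrix.transpose_transpose,
        h.hHt, Matrix.neg_mul, Matrix.trace_neg, Matrix.trace_mul_comm _ H, ← Matrix.mul_assoc,
        h.hHG, Matrix.one_mul]
    rw [e1]
    simp only [Matrix.trace, Matrix.diag_apply, Matrix.mul_apply (M := H), Matrix.transpose_apply,
      Matrix.mul_apply (N := G * h.F a b), Matrix.mul_apply (N := H), Finset.mul_sum,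
      Finset.sum_mul]
    refine Finset.sum_congr rfl fun k _ => ?_
    calc _ = ∑ c, ∑ l, ∑ e, H k c * ((G * h.F i j) l k * H l e * (G * h.F a b) e c) :=
          Finset.sum_congr rfl fun c _ => Finset.sum_comm
      _ = _ := by
        rw [Finset.sum_comm]
        refine Finset.sum_congr rfl fun l _ => Finset.sum_congr rfl fun c _ =>
          Finset.sum_congr rfl fun e _ => ?_
        ring
  have e0 : h.B h.F h.F = ∑ i, ∑ a, ∑ j, ∑ b, ∑ k, ∑ l, ∑ c, ∑ e, H i a * (H j b *
      (H k c * H l e * (G * h.F i j) l k * (G * h.F a b) e c)) := by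
    simp only [B, liftB, key, Finset.mul_sum]
  rw [e0]
  simp only [map_sum, map_mul]
  refine Finset.sum_congr rfl fun i _ => ?_
  rw [Finset.sum_comm]
  refine Finset.sum_congr rfl fun j _ => ?_
  have r1 : ∀ f : Fin n → Fin n → Fin n → Fin n → ℝ, ∑ a, ∑ b, ∑ k, ∑ l, f a b k l
      = ∑ k, ∑ l, ∑ a, ∑ b, f a b k l := by
    intro f
    rw [sum_reorder]
    exact Finset.sum_congr rfl fun i _ => Finset.sum_congr rfl fun j _ => Finset.sum_comm
  rw [r1]
  refine Finset.sum_congr rfl fun k _ => Finset.sum_congr rfl fun l _ =>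
    Finset.sum_congr rfl fun a _ => Finset.sum_congr rfl fun b _ =>
    Finset.sum_congr rfl fun c _ => Finset.sum_congr rfl fun e _ => ?_
  ring

end RFData

end

end RFlow

namespace RFlow

section SmoothAlgebra

open scoped ContDiff

theorem extend_val_apply {X : Type*} {S : Set X} (f : S → ℝ) {p : X} (hp : p ∈ S) :
    Function.extend Subtype.val f 0 p = f ⟨p, hp⟩ :=
  Subtype.val_injective.extend_apply f 0 ⟨p, hp⟩

variable {X : Type*} [NormedAddCommGroup X] [NormedSpace ℝ X] {S : Set X}

/-- The algebra of real functions on `S` that are smooth on `S`. -/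
def smoothAlg (S : Set X) : Subalgebra ℝ (S → ℝ) where
  carrier := {f | ContDiffOn ℝ ∞ (Function.extend Subtype.val f (0 : X → ℝ)) S}
  mul_mem' := by
    intro a b ha hb
    refine (ContDiffOn.mul ha hb).congr fun p hp => ?_
    simp only [extend_val_apply _ hp, Pi.mul_apply]
  add_mem' := by
    intro a b ha hb
    refine (ContDiffOn.add ha hb).congr fun p hp => ?_
    simp only [extend_val_apply _ hp, Pi.add_apply]
  algebraMap_mem' := by
    intro r
    refine (contDiffOn_const (c := r)).congr fun p hp => ?_
    simp only [extend_val_apply _ hp, Pi.algebraMap_apply, Algebra.algebraMap_self_apply]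

/-- Evaluation at a point of `S`. -/
def evS {p : X} (hp : p ∈ S) : smoothAlg S →ₐ[ℝ] ℝ :=
  (Pi.evalAlgHom ℝ (fun _ : S => ℝ) ⟨p, hp⟩).comp (smoothAlg S).val

/-- Extension by zero of an element of the algebra. -/
def extS (a : smoothAlg S) : X → ℝ := Function.extend Subtype.val a.1 0

theorem extS_apply (a : smoothAlg S) {p : X} (hp : p ∈ S) : extS a p = evS hp a :=
  extend_val_apply _ hp

theorem extS_contDiffOn (a : smoothAlg S) : ContDiffOn ℝ ∞ (extS a) S := a.2

/-- The element of the algebra given by a function smooth on `S`. -/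
def ofS (f : X → ℝ) (hf : ContDiffOn ℝ ∞ f S) : smoothAlg S :=
  ⟨fun p => f p, hf.congr fun p hp => by rw [extend_val_apply _ hp]⟩

@[simp] theorem evS_ofS {f : X → ℝ} (hf : ContDiffOn ℝ ∞ f S) {p : X} (hp : p ∈ S) :
    evS hp (ofS f hf) = f p := rfl

theorem smoothAlg_ext {a b : smoothAlg S} (h : ∀ p (hp : p ∈ S), evS hp a = evS hp b) : a = b :=
  Subtype.ext (funext fun p => h p.1 p.2)

theorem extS_differentiable (a : smoothAlg S) {p : X} (hp : p ∈ S) :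
    DifferentiableWithinAt ℝ (extS a) S p :=
  ((extS_contDiffOn a).differentiableOn (by simp)) p hp

theorem extS_fderivWithin (hs : UniqueDiffOn ℝ S) (a : smoothAlg S) :
    ContDiffOn ℝ ∞ (fderivWithin ℝ (extS a) S) S :=
  (extS_contDiffOn a).fderivWithin hs (by simp)

theorem fderivWithin_congr_ev {a : smoothAlg S} {f : X → ℝ} {p : X} (hp : p ∈ S)
    (h : ∀ q (hq : q ∈ S), evS hq a = f q) :
    fderivWithin ℝ (extS a) S p = fderivWithin ℝ f S p :=
  fderivWithin_congr (fun q hq => by rw [extS_apply a hq, h q hq]) (by rw [extS_apply a hp, h p hp])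

/-- Directional derivative as a derivation of the algebra of smooth functions. -/
def dirD (hs : UniqueDiffOn ℝ S) (v : X) : Derivation ℝ (smoothAlg S) (smoothAlg S) :=
  Derivation.mk' (
    { toFun := fun a => ofS (fun p => fderivWithin ℝ (extS a) S p v)
        ((extS_fderivWithin hs a).clm_apply contDiffOn_const)
      map_add' := by
        intro a b
        refine smoothAlg_ext fun p hp => ?_
        rw [map_add]; simp only [evS_ofS]
        rw [fderivWithin_congr_ev hp (f := extS a + extS b)
          (fun q hq => by rw [map_add, Pi.add_apply, extS_apply _ hq, extS_apply _ hq]),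
          fderivWithin_add (hs p hp) (extS_differentiable a hp) (extS_differentiable b hp)]
        rfl
      map_smul' := by
        intro r a
        refine smoothAlg_ext fun p hp => ?_
        rw [map_smul]; simp only [evS_ofS]
        rw [fderivWithin_congr_ev hp (f := r • extS a)
          (fun q hq => by rw [map_smul, Pi.smul_apply, extS_apply _ hq]),
          fderivWithin_const_smul (hs p hp) (extS_differentiable a hp)]
        rfl } : smoothAlg S →ₗ[ℝ] smoothAlg S) (by
    intro a b
    refine smoothAlg_ext fun p hp => ?_
    simp only [smul_eq_mul, map_add, map_mul, LinearMap.coe_mk, AddHom.coe_mk, evS_ofS]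
    rw [fderivWithin_congr_ev hp (f := extS a * extS b)
      (fun q hq => by rw [map_mul, Pi.mul_apply, extS_apply _ hq, extS_apply _ hq]),
      fderivWithin_mul (hs p hp) (extS_differentiable a hp) (extS_differentiable b hp)]
    simp only [add_apply, smul_apply, smul_eq_mul,
      extS_apply _ hp])

theorem evS_dirD (hs : UniqueDiffOn ℝ S) (v : X) (a : smoothAlg S) {p : X} (hp : p ∈ S) :
    evS hp (dirD hs v a) = fderivWithin ℝ (extS a) S p v := rfl

theorem dirD_comm (hs : UniqueDiffOn ℝ S) (hc : S ⊆ closure (interior S)) (v w : X)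
    (a : smoothAlg S) : dirD hs v (dirD hs w a) = dirD hs w (dirD hs v a) := by
  refine smoothAlg_ext fun p hp => ?_
  rw [evS_dirD, evS_dirD]
  have e : ∀ w, fderivWithin ℝ (extS (dirD hs w a)) S p =
      (fderivWithin ℝ (fderivWithin ℝ (extS a) S) S p).flip w := by
    intro w
    rw [fderivWithin_congr_ev (f := fun q => fderivWithin ℝ (extS a) S q w) hp
      (fun q hq => evS_dirD hs w a hq)]
    have hd : DifferentiableWithinAt ℝ (fderivWithin ℝ (extS a) S) S p :=
      (extS_fderivWithin hs a).differentiableOn (by simp) p hp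
    rw [fderivWithin_clm_apply (hs p hp) hd (differentiableWithinAt_const w)]
    simp
  rw [e, e]
  simp only [ContinuousLinearMap.flip_apply]
  have := (extS_contDiffOn a p hp).isSymmSndFDerivWithinAt
    (by rw [minSmoothness_of_isRCLikeNormedField]; exact WithTop.coe_le_coe.mpr le_top) hs (hc hp) hp
  exact this.eq v w

theorem eq_zero_of_two_mul (a : smoothAlg S) (h : 2 * a = 0) : a = 0 := by
  refine smoothAlg_ext fun p hp => ?_
  have := congrArg (evS hp) h
  rw [map_mul, map_zero] at this
  rw [map_zero]
  have e : evS hp (2 : smoothAlg S) = 2 := map_ofNat _ 2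
  rw [e] at this
  linarith

end SmoothAlgebra

end RFlow

namespace RFlow

section Concrete

open scoped ContDiff

/-- The space-time slab `ℝⁿ × [0,T]`. -/
abbrev slab (n : ℕ) (T : ℝ) : Set ((Fin n → ℝ) × ℝ) := univ ×ˢ Icc 0 T

theorem mem_slab {T t : ℝ} (ht : t ∈ Icc 0 T) {x : Fin n → ℝ} : (x, t) ∈ slab n T :=
  ⟨mem_univ _, ht⟩

theorem slab_uniqueDiff {T : ℝ} (hT : 0 < T) : UniqueDiffOn ℝ (slab n T) :=
  uniqueDiffOn_univ.prod (uniqueDiffOn_Icc hT)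

theorem slab_subset {T : ℝ} (hT : 0 < T) : slab n T ⊆ closure (interior (slab n T)) := by
  rw [interior_prod_eq, closure_prod_eq, interior_univ, closure_univ, interior_Icc,
    closure_Ioo hT.ne]

/-- Coordinate directions in space-time. -/
def stDir (μ : Option (Fin n)) : (Fin n → ℝ) × ℝ :=
  μ.elim (0, 1) (fun i => (Pi.single i 1, 0))

/-- Standing assumptions: a smooth Ricci flow on `ℝⁿ × [0,T]`. -/
structure IsRFOn (g : (Fin n → ℝ) → ℝ → Matrix (Fin n) (Fin n) ℝ) (T : ℝ) : Prop where
  pos : 0 < T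
  smooth : SmoothMetricFamily g (Icc 0 T)
  flow : IsRicciFlow g (Icc 0 T)

variable {g : (Fin n → ℝ) → ℝ → Matrix (Fin n) (Fin n) ℝ} {T : ℝ}

namespace IsRFOn

variable (h : IsRFOn g T)

/-- Coordinate derivations. -/
def d (h : IsRFOn g T) (μ : Option (Fin n)) : Derivation ℝ (smoothAlg (slab n T)) (smoothAlg (slab n T)) :=
  dirD (slab_uniqueDiff h.pos) (stDir μ)

/-- The metric. -/
def G (h : IsRFOn g T) : Matrix (Fin n) (Fin n) (smoothAlg (slab n T)) :=
  Matrix.of fun i j => ofS (fun p => g p.1 p.2 i j) (h.smooth.1 i j)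

theorem ev_G {p : (Fin n → ℝ) × ℝ} (hp : p ∈ slab n T) (i j : Fin n) :
    evS hp (h.G i j) = g p.1 p.2 i j := rfl

theorem map_G {p : (Fin n → ℝ) × ℝ} (hp : p ∈ slab n T) :
    h.G.map (evS hp) = g p.1 p.2 := rfl

theorem ev_det {p : (Fin n → ℝ) × ℝ} (hp : p ∈ slab n T) :
    evS hp h.G.det = (g p.1 p.2).det := by
  rw [← h.map_G hp]
  exact AlgHom.map_det (evS hp) h.G

theorem det_ne (h : IsRFOn g T) {p : (Fin n → ℝ) × ℝ} (hp : p ∈ slab n T) : (g p.1 p.2).det ≠ 0 :=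
  (h.smooth.2 p.1 p.2 hp.2).2.det_pos.ne'

/-- The inverse metric. -/
def H (h : IsRFOn g T) : Matrix (Fin n) (Fin n) (smoothAlg (slab n T)) :=
  (ofS (fun p => (extS h.G.det p)⁻¹) ((extS_contDiffOn _).inv fun p hp => by
    rw [extS_apply _ hp, h.ev_det hp]; exact h.det_ne hp)) • h.G.adjugate

theorem GH : h.G * h.H = 1 := by
  rw [H, Matrix.mul_smul, Matrix.mul_adjugate, smul_smul]
  conv_rhs => rw [← one_smul (smoothAlg (slab n T)) (1 : Matrix (Fin n) (Fin n) _)]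
  congr 1
  refine smoothAlg_ext (S := slab n T) fun p hp => ?_
  rw [map_mul, evS_ofS, extS_apply _ hp, map_one]
  exact inv_mul_cancel₀ (by rw [h.ev_det hp]; exact h.det_ne hp)

theorem map_H {p : (Fin n → ℝ) × ℝ} (hp : p ∈ slab n T) :
    h.H.map (evS hp) = (g p.1 p.2)⁻¹ := by
  symm
  apply Matrix.inv_eq_right_inv
  rw [← h.map_G hp]
  rw [← Matrix.map_mul, h.GH]
  exact Matrix.map_one _ (map_zero _) (map_one _)

theorem ev_H {p : (Fin n → ℝ) × ℝ} (hp : p ∈ slab n T) (i j : Fin n) :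
    evS hp (h.H i j) = (g p.1 p.2)⁻¹ i j := by
  rw [← h.map_H hp]; rfl

theorem G_symm : h.Gᵀ = h.G := by
  ext i j : 1
  refine smoothAlg_ext (S := slab n T) fun p hp => ?_
  exact congrFun (congrFun (h.smooth.2 p.1 p.2 hp.2).1 i) j

/-- The Levi-Civita connection. -/
def Γs (h : IsRFOn g T) (i : Fin n) : Matrix (Fin n) (Fin n) (smoothAlg (slab n T)) :=
  Matrix.of fun k j => (1/2 : ℝ) • ∑ l, h.H k l *
    (h.d (some i) (h.G j l) + h.d (some j) (h.G i l) - h.d (some l) (h.G i j))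

/-- The space-time connection. -/
def Γ (h : IsRFOn g T) (μ : Option (Fin n)) : Matrix (Fin n) (Fin n) (smoothAlg (slab n T)) :=
  μ.elim (-(h.H * ricM h.d (fun μ => μ.elim 0 h.Γs))) h.Γs

theorem slice_hasFDerivAt (a : smoothAlg (slab n T)) {x : Fin n → ℝ} {t : ℝ} (ht : t ∈ Icc 0 T) :
    HasFDerivAt (fun y => extS a (y, t))
      ((fderivWithin ℝ (extS a) (slab n T) (x, t)).comp (ContinuousLinearMap.inl ℝ _ ℝ)) x := by
  have h1 := (extS_differentiable a (p := (x, t)) ⟨mem_univ _, ht⟩).hasFDerivWithinAt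
  have h2 : HasFDerivWithinAt (fun y : Fin n → ℝ => (y, t)) (ContinuousLinearMap.inl ℝ _ ℝ) univ x :=
    (hasFDerivAt_prodMk_left x t).hasFDerivWithinAt
  exact (h1.comp x h2 fun y _ => mem_slab ht).hasFDerivAt (by simp)

theorem pd_slice (a : smoothAlg (slab n T)) {t : ℝ} (ht : t ∈ Icc 0 T) (i : Fin n)
    (x : Fin n → ℝ) : pd (fun y => extS a (y, t)) i x = extS (h.d (some i) a) (x, t) := by
  rw [pd, (slice_hasFDerivAt a ht).fderiv, extS_apply _ (mem_slab ht), d, evS_dirD]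
  simp [stDir]

theorem pd_slice_of {f : (Fin n → ℝ) → ℝ} {a : smoothAlg (slab n T)} {t : ℝ} (ht : t ∈ Icc 0 T)
    (hf : ∀ y, f y = extS a (y, t)) (i : Fin n) (x : Fin n → ℝ) :
    pd f i x = extS (h.d (some i) a) (x, t) := by
  rw [funext hf, h.pd_slice a ht]

theorem time_hasDerivWithinAt (a : smoothAlg (slab n T)) {x : Fin n → ℝ} {t : ℝ}
    (ht : t ∈ Icc 0 T) :
    HasDerivWithinAt (fun s => extS a (x, s)) (extS (h.d none a) (x, t)) (Icc 0 T) t := by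
  have h1 := (extS_differentiable a (p := (x, t)) ⟨mem_univ _, ht⟩).hasFDerivWithinAt
  have h2 : HasDerivWithinAt (fun s : ℝ => (x, s)) ((0 : Fin n → ℝ), (1:ℝ)) (Icc 0 T) t :=
    (hasDerivWithinAt_const t _ x).prodMk (hasDerivWithinAt_id t _)
  have := h1.comp_hasDerivWithinAt t h2 fun s hs => ⟨mem_univ _, hs⟩
  rw [extS_apply _ (mem_slab ht), d, evS_dirD]
  exact this

theorem christoffel_eq {t : ℝ} (ht : t ∈ Icc 0 T) (x : Fin n → ℝ) (k i j : Fin n) :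
    christoffel (fun y => g y t) x k i j = extS (h.Γ (some i) k j) (x, t) := by
  have hp : (x, t) ∈ slab n T := ⟨mem_univ _, ht⟩
  have e : ∀ i j k, pd (fun y => g y t i j) k x = evS hp (h.d (some k) (h.G i j)) := by
    intro i j k
    rw [h.pd_slice_of ht (a := h.G i j)
      (fun y => by rw [extS_apply _ (mem_slab ht), h.ev_G]), extS_apply _ hp]
  rw [extS_apply _ hp, christoffel]
  simp only [Γ, Option.elim, Γs, Matrix.of_apply, map_smul, map_sum, map_mul, map_sub, map_add,
    e, h.ev_H hp, smul_eq_mul]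

theorem curvF_entry {t : ℝ} (ht : t ∈ Icc 0 T) (x : Fin n → ℝ) (i j m k : Fin n) :
    pd (fun y => christoffel (fun y => g y t) y m j k) i x
      - pd (fun y => christoffel (fun y => g y t) y m i k) j x
      + ∑ p, (christoffel (fun y => g y t) x m i p * christoffel (fun y => g y t) x p j k
            - christoffel (fun y => g y t) x m j p * christoffel (fun y => g y t) x p i k)
      = extS (curvF h.d h.Γ (some i) (some j) m k) (x, t) := by
  have hp : (x, t) ∈ slab n T := ⟨mem_univ _, ht⟩
  rw [h.pd_slice_of ht (fun y => h.christoffel_eq ht y m j k),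
    h.pd_slice_of ht (fun y => h.christoffel_eq ht y m i k)]
  simp only [h.christoffel_eq ht, extS_apply _ hp, curvF, Matrix.add_apply, Matrix.sub_apply,
    dMat_apply, Matrix.mul_apply, map_add, map_sub, map_sum, map_mul, Finset.sum_sub_distrib]
  ring

theorem ricci_eq {t : ℝ} (ht : t ∈ Icc 0 T) (x : Fin n → ℝ) (j k : Fin n) :
    ricci (fun y => g y t) x j k = extS (ricM h.d h.Γ j k) (x, t) := by
  have hp : (x, t) ∈ slab n T := ⟨mem_univ _, ht⟩
  simp only [ricci, h.curvF_entry ht, ricM, Matrix.of_apply, extS_apply _ hp, map_sum]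

theorem riemann_eq {t : ℝ} (ht : t ∈ Icc 0 T) (x : Fin n → ℝ) (i j k l : Fin n) :
    riemann (fun y => g y t) x i j k l
      = extS ((h.G * curvF h.d h.Γ (some i) (some j)) l k) (x, t) := by
  have hp : (x, t) ∈ slab n T := ⟨mem_univ _, ht⟩
  simp only [riemann, h.curvF_entry ht, Matrix.mul_apply, extS_apply _ hp, map_sum, map_mul,
    h.ev_G]

theorem dG_none (j k : Fin n) : h.d none (h.G j k) = -(2 * ricM h.d h.Γ j k) := by
  refine smoothAlg_ext (S := slab n T) fun p hp => ?_
  obtain ⟨x, t⟩ := p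
  have e := h.flow x t hp.2 j k
  rw [h.ricci_eq hp.2] at e
  have e2 := ((h.time_hasDerivWithinAt (h.G j k) (x := x) hp.2).congr
    (f₁ := fun s => g x s j k) (fun s hs => by rw [extS_apply _ (mem_slab hs), h.ev_G])
    (by rw [extS_apply _ hp, h.ev_G])).derivWithin (uniqueDiffOn_Icc h.pos t hp.2)
  rw [e2, extS_apply _ hp, extS_apply _ hp] at e
  rw [e, map_neg, map_mul]
  have : evS hp (2 : smoothAlg (slab n T)) = 2 := map_ofNat _ 2
  rw [this]; ring

theorem ric_symm : (ricM h.d h.Γ)ᵀ = ricM h.d h.Γ := by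
  ext j k : 1
  rw [Matrix.transpose_apply]
  have e1 := h.dG_none j k
  have e2 := h.dG_none k j
  have e3 : h.G j k = h.G k j := congrFun (congrFun h.G_symm k) j
  rw [e3, e2] at e1
  have := eq_zero_of_two_mul (ricM h.d h.Γ k j - ricM h.d h.Γ j k) (by linear_combination -e1)
  exact sub_eq_zero.mp this

theorem G_Γs (i l j : Fin n) : (h.G * h.Γs i) l j = (1/2 : ℝ) •
    (h.d (some i) (h.G j l) + h.d (some j) (h.G i l) - h.d (some l) (h.G i j)) := by
  have e : h.Γs i = (1/2 : ℝ) • (h.H * (Matrix.of fun l j =>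
      (h.d (some i) (h.G j l) + h.d (some j) (h.G i l) - h.d (some l) (h.G i j)))) := by
    ext k j : 1
    simp only [Γs, Matrix.of_apply, Matrix.smul_apply, Matrix.mul_apply]
  rw [e, Matrix.mul_smul, ← Matrix.mul_assoc, h.GH, Matrix.one_mul]
  rfl

theorem rfData : RFData h.d h.G h.H h.Γ where
  hd := fun μ ν a => dirD_comm _ (slab_subset h.pos) _ _ a
  h2 := eq_zero_of_two_mul
  hG := h.G_symm
  hGH := h.GH
  hcomp := by
    have gs : ∀ j k, h.G j k = h.G k j := fun j k => congrFun (congrFun h.G_symm k) j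
    rintro (_ | i)
    · have e : h.Γ none = -(h.H * ricM h.d h.Γ) := rfl
      have hH : h.Hᵀ * h.G = 1 := by
        have := congrArg Matrix.transpose h.GH
        rwa [Matrix.transpose_mul, h.G_symm, Matrix.transpose_one] at this
      rw [e, Matrix.transpose_neg, Matrix.transpose_mul, Matrix.neg_mul, Matrix.mul_assoc, hH,
        Matrix.mul_neg, ← Matrix.mul_assoc, h.GH, h.ric_symm, Matrix.mul_one, Matrix.one_mul]
      ext j k : 1
      rw [dMat_apply, h.dG_none, Matrix.add_apply, Matrix.neg_apply]; ring
    · have e : h.Γ (some i) = h.Γs i := rfl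
      have e2 : (h.Γs i)ᵀ * h.G = (h.G * h.Γs i)ᵀ := by rw [Matrix.transpose_mul, h.G_symm]
      rw [e, e2]
      ext j l : 1
      rw [dMat_apply, Matrix.add_apply, Matrix.transpose_apply, h.G_Γs, h.G_Γs, gs l j, ← smul_add]
      refine smoothAlg_ext (S := slab n T) fun p hp => ?_
      simp only [map_smul, map_add, map_sub, smul_eq_mul]
      ring
  htor := by
    intro i j k
    simp only [Γ, Option.elim, Γs, Matrix.of_apply]
    congr 1
    refine Finset.sum_congr rfl fun l _ => ?_
    have gs : ∀ j k, h.G j k = h.G k j := fun j k => congrFun (congrFun h.G_symm k) j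
    rw [gs j i, add_comm (h.d (some j) (h.G i l))]
  hRF := rfl

/-- The squared norm of the curvature tensor as a smooth function. -/
def u (h : IsRFOn g T) : smoothAlg (slab n T) := h.rfData.B h.rfData.F h.rfData.F

theorem riemNorm_eq {t : ℝ} (ht : t ∈ Icc 0 T) (x : Fin n → ℝ) :
    riemNorm (fun y => g y t) x = √(extS h.u (x, t)) := by
  have hp : (x, t) ∈ slab n T := ⟨mem_univ _, ht⟩
  rw [riemNorm, extS_apply _ hp, u, h.rfData.ev_B_eq]
  simp only [h.ev_H hp, h.riemann_eq ht, extS_apply _ hp]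
  rfl

end IsRFOn

end Concrete

end RFlow

namespace RFlow

section Jet

/-- `f` is differentiable with `f 0 = a`, `f' 0 = b`, `f'' 0 = c`. -/
def HasJet (f : ℝ → ℝ) (a b c : ℝ) : Prop :=
  ∃ f' : ℝ → ℝ, (∀ h, HasDerivAt f (f' h) h) ∧ HasDerivAt f' c 0 ∧ f 0 = a ∧ f' 0 = b

theorem HasJet.const (a : ℝ) : HasJet (fun _ => a) a 0 0 :=
  ⟨fun _ => 0, fun h => hasDerivAt_const h a, hasDerivAt_const 0 0, rfl, rfl⟩

theorem HasJet.quad (a b c : ℝ) : HasJet (fun h => a + h * b + h ^ 2 * c) a b (2 * c) := by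
  refine ⟨fun h => b + 2 * h * c, fun h => ?_, ?_, by ring, by ring⟩
  · have := (((hasDerivAt_id h).mul_const b).const_add a).add ((hasDerivAt_pow 2 h).mul_const c)
    exact this.congr_deriv (by simp)
  · have := ((((hasDerivAt_id (0:ℝ)).const_mul 2).mul_const c)).const_add b
    exact this.congr_deriv (by ring)

theorem HasJet.add {f g : ℝ → ℝ} {a b c a' b' c' : ℝ} (hf : HasJet f a b c)
    (hg : HasJet g a' b' c') : HasJet (fun h => f h + g h) (a + a') (b + b') (c + c') := by
  obtain ⟨f', h1, h2, rfl, rfl⟩ := hf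
  obtain ⟨g', k1, k2, rfl, rfl⟩ := hg
  exact ⟨fun h => f' h + g' h, fun h => (h1 h).add (k1 h), h2.add k2, rfl, rfl⟩

theorem HasJet.mul {f g : ℝ → ℝ} {a b c a' b' c' : ℝ} (hf : HasJet f a b c)
    (hg : HasJet g a' b' c') :
    HasJet (fun h => f h * g h) (a * a') (b * a' + a * b') (c * a' + 2 * (b * b') + a * c') := by
  obtain ⟨f', h1, h2, rfl, rfl⟩ := hf
  obtain ⟨g', k1, k2, rfl, rfl⟩ := hg
  refine ⟨fun h => f' h * g h + f h * g' h, fun h => (h1 h).mul (k1 h), ?_, rfl, rfl⟩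
  exact ((h2.mul (k1 0)).add ((h1 0).mul k2)).congr_deriv (by ring)

theorem HasJet.sum {ι : Type*} (s : Finset ι) {f : ι → ℝ → ℝ} {a b c : ι → ℝ}
    (hf : ∀ i ∈ s, HasJet (f i) (a i) (b i) (c i)) :
    HasJet (fun h => ∑ i ∈ s, f i h) (∑ i ∈ s, a i) (∑ i ∈ s, b i) (∑ i ∈ s, c i) := by
  classical
  induction s using Finset.induction_on with
  | empty => simpa using HasJet.const 0
  | insert i s hi ih =>
    simp only [Finset.sum_insert hi]
    exact (hf i (by simp)).add (ih fun j hj => hf j (by simp [hj]))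

theorem HasJet.congr {f : ℝ → ℝ} {a b c c' : ℝ} (hf : HasJet f a b c) (hc : c' = c) :
    HasJet f a b c' := hc ▸ hf

theorem HasJet.unique {f f' : ℝ → ℝ} {f'' : ℝ → ℝ} {a b c : ℝ} (hf : HasJet f a b c)
    (h1 : ∀ h, HasDerivAt f (f' h) h) (h2 : ∀ h, HasDerivAt f' (f'' h) h) : c = f'' 0 := by
  obtain ⟨k, k1, k2, -, -⟩ := hf
  have : k = f' := funext fun h => (k1 h).unique (h1 h)
  subst this
  exact k2.unique (h2 0)

theorem second_diff_bound {f f' f'' : ℝ → ℝ} {δ h : ℝ} (hh : 0 ≤ h)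
    (h1 : ∀ s, HasDerivAt f (f' s) s) (h2 : ∀ s, HasDerivAt f' (f'' s) s)
    (hb : ∀ s, |s| ≤ h → |f'' s - f'' 0| ≤ δ) :
    |f h + f (-h) - 2 * f 0 - h ^ 2 * f'' 0| ≤ 2 * δ * h ^ 2 := by
  have hδ : 0 ≤ δ := le_trans (abs_nonneg _) (hb 0 (by simpa using hh))
  have e1 : ∀ s, HasDerivAt (fun s => f' s - f' (-s) - 2 * s * f'' 0)
      (f'' s + f'' (-s) - 2 * f'' 0) s := by
    intro s
    have := ((h2 s).sub ((h2 (-s)).comp s (hasDerivAt_neg s))).sub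
      (((hasDerivAt_id s).const_mul 2).mul_const (f'' 0))
    exact this.congr_deriv (by ring)
  have b1 : ∀ s ∈ Icc 0 h, ‖f' s - f' (-s) - 2 * s * f'' 0‖ ≤ 2 * δ * s := by
    intro s hs
    have := Convex.norm_image_sub_le_of_norm_hasDerivWithin_le (s := Icc 0 s)
      (f := fun s => f' s - f' (-s) - 2 * s * f'' 0) (C := 2 * δ)
      (fun r _ => (e1 r).hasDerivWithinAt) (fun r hr => by
        have i1 := hb r (by rw [abs_of_nonneg hr.1]; exact hr.2.trans hs.2)
        have i2 := hb (-r) (by rw [abs_neg, abs_of_nonneg hr.1]; exact hr.2.trans hs.2)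
        rw [Real.norm_eq_abs]
        calc |f'' r + f'' (-r) - 2 * f'' 0| = |(f'' r - f'' 0) + (f'' (-r) - f'' 0)| := by ring_nf
          _ ≤ _ := (abs_add_le _ _).trans (by linarith))
      (convex_Icc 0 s) (left_mem_Icc.2 hs.1) (right_mem_Icc.2 hs.1)
    simpa [abs_of_nonneg hs.1] using this
  have e0 : ∀ s, HasDerivAt (fun s => f s + f (-s) - 2 * f 0 - s ^ 2 * f'' 0)
      (f' s - f' (-s) - 2 * s * f'' 0) s := by
    intro s
    have := (((h1 s).add ((h1 (-s)).comp s (hasDerivAt_neg s))).sub_const (2 * f 0)).sub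
      ((hasDerivAt_pow 2 s).mul_const (f'' 0))
    exact this.congr_deriv (by simp; ring)
  have := Convex.norm_image_sub_le_of_norm_hasDerivWithin_le (s := Icc 0 h)
    (f := fun s => f s + f (-s) - 2 * f 0 - s ^ 2 * f'' 0) (C := 2 * δ * h)
    (fun r _ => (e0 r).hasDerivWithinAt)
    (fun r hr => (b1 r hr).trans (mul_le_mul_of_nonneg_left hr.2 (by positivity)))
    (convex_Icc 0 h) (left_mem_Icc.2 hh) (right_mem_Icc.2 hh)
  simp only [Real.norm_eq_abs, neg_zero, sub_zero, abs_of_nonneg hh] at this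
  convert this using 1
  · congr 1; ring
  · ring

theorem uniform_second_diff {P : Type*} [NormedAddCommGroup P] [NormedSpace ℝ P]
    {Φ : ℝ × P → ℝ} (hΦ : ContDiff ℝ 2 Φ) {K : Set P} (hK : IsCompact K) {δ : ℝ} (hδ : 0 < δ) :
    ∃ h₀ > 0, ∀ h, 0 ≤ h → h < h₀ → ∀ p ∈ K, ∀ a b c, HasJet (fun s => Φ (s, p)) a b c →
      |Φ (h, p) + Φ (-h, p) - 2 * Φ (0, p) - h ^ 2 * c| ≤ δ * h ^ 2 := by
  set Φ1 : ℝ × P → ℝ := fun q => fderiv ℝ Φ q (1, 0)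
  have c1 : ContDiff ℝ 1 Φ1 := (hΦ.fderiv_right (m := 1) (by norm_num)).clm_apply contDiff_const
  set Φ2 : ℝ × P → ℝ := fun q => fderiv ℝ Φ1 q (1, 0)
  have c2 : Continuous Φ2 :=
    (c1.continuous_fderiv (by norm_num)).clm_apply continuous_const
  have hd : ∀ {Ψ : ℝ × P → ℝ}, ContDiff ℝ 1 Ψ → ∀ s p,
      HasDerivAt (fun s => Ψ (s, p)) (fderiv ℝ Ψ (s, p) (1, 0)) s := by
    intro Ψ hΨ s p
    exact ((hΨ.differentiable (by norm_num)).differentiableAt.hasFDerivAt).comp_hasDerivAt s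
      ((hasDerivAt_id s).prodMk (hasDerivAt_const s p))
  have hev : ∀ᶠ s in nhds (0:ℝ), ∀ p ∈ K, |Φ2 (s, p) - Φ2 (0, p)| < δ / 2 := by
    refine hK.eventually_forall_of_forall_eventually fun p _ => ?_
    have cc : Continuous fun q : ℝ × P => |Φ2 (q.1, q.2) - Φ2 (0, q.2)| := by fun_prop
    exact cc.continuousAt.eventually_lt continuousAt_const (by simpa using by positivity)
  obtain ⟨h₀, h0, hh⟩ := Metric.eventually_nhds_iff.mp hev
  refine ⟨h₀, h0, fun h hh0 hlt p hp a b c hj => ?_⟩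
  rw [hj.unique (fun s => hd (hΦ.of_le (by norm_num)) s p) (fun s => hd c1 s p)]
  have := second_diff_bound (δ := δ / 2) hh0 (fun s => hd (hΦ.of_le (by norm_num)) s p)
    (fun s => hd c1 s p) (fun s hs => (hh (y := s) (by
      rw [Real.dist_eq, sub_zero]; exact hs.trans_lt hlt) p hp).le)
  linarith

end Jet

end RFlow

namespace RFlow

variable {g : (Fin n → ℝ) → ℝ → Matrix (Fin n) (Fin n) ℝ} {T : ℝ}

namespace IsRFOn

open scoped ContDiff

variable (h : IsRFOn g T)

/-- The spatial derivative in a constant direction. -/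
def dV (h : IsRFOn g T) (V : Fin n → ℝ) : Derivation ℝ (smoothAlg (slab n T)) (smoothAlg (slab n T)) :=
  dirD (slab_uniqueDiff h.pos) (V, 0)

theorem dV_eq (V : Fin n → ℝ) (a : smoothAlg (slab n T)) :
    h.dV V a = ∑ p, V p • h.d (some p) a := by
  refine smoothAlg_ext (S := slab n T) fun q hq => ?_
  simp only [map_sum, map_smul, dV, d, evS_dirD, stDir, Option.elim]
  have : ((V, 0) : (Fin n → ℝ) × ℝ) = ∑ p, V p • ((Pi.single p 1, 0) : (Fin n → ℝ) × ℝ) := by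
    ext i
    · simp [Prod.fst_sum, Pi.single_apply]
    · simp [Prod.snd_sum]
  conv_lhs => rw [this]
  simp only [map_sum, map_smul]

theorem ev_dV {p : (Fin n → ℝ) × ℝ} (hp : p ∈ slab n T) (V : Fin n → ℝ)
    (a : smoothAlg (slab n T)) :
    evS hp (h.dV V a) = ∑ i, V i * evS hp (h.d (some i) a) := by
  rw [h.dV_eq]; simp only [map_sum, map_smul, smul_eq_mul]

theorem ext_dV (a : smoothAlg (slab n T)) (V : Fin n → ℝ) {x : Fin n → ℝ} {t : ℝ}
    (ht : t ∈ Icc 0 T) :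
    extS (h.dV V a) (x, t) = ∑ i, V i * extS (h.d (some i) a) (x, t) := by
  rw [extS_apply _ (mem_slab ht), h.ev_dV]
  simp only [extS_apply _ (mem_slab ht)]

theorem slice_contDiff (a : smoothAlg (slab n T)) {t : ℝ} (ht : t ∈ Icc 0 T) :
    ContDiff ℝ ∞ fun y => extS a (y, t) := by
  rw [← contDiffOn_univ]
  exact (extS_contDiffOn a).comp (contDiff_prodMk_left t).contDiffOn fun y _ => mem_slab ht

theorem slice_curve (a : smoothAlg (slab n T)) {t : ℝ} (ht : t ∈ Icc 0 T) {c : ℝ → Fin n → ℝ}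
    {c' : Fin n → ℝ} {s : ℝ} (hc : HasDerivAt c c' s) :
    HasDerivAt (fun s => extS a (c s, t)) (extS (h.dV c' a) (c s, t)) s := by
  have := (slice_hasFDerivAt a ht).comp_hasDerivAt s hc
  refine this.congr_deriv ?_
  rw [extS_apply _ (mem_slab ht), dV, evS_dirD]
  simp

theorem jet_slice (a : smoothAlg (slab n T)) {t : ℝ} (ht : t ∈ Icc 0 T) (x V Z : Fin n → ℝ) :
    HasJet (fun s => extS a (x + s • V + s ^ 2 • Z, t)) (extS a (x, t)) (extS (h.dV V a) (x, t))
      (extS (h.dV V (h.dV V a)) (x, t) + 2 * extS (h.dV Z a) (x, t)) := by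
  have hc : ∀ s : ℝ, HasDerivAt (fun s : ℝ => x + s • V + s ^ 2 • Z) (V + (2 * s) • Z) s := by
    intro s
    have := (((hasDerivAt_id s).smul_const V).const_add x).add ((hasDerivAt_pow 2 s).smul_const Z)
    exact this.congr_deriv (by simp)
  refine ⟨fun s => extS (h.dV V a) (x + s • V + s ^ 2 • Z, t)
    + 2 * s * extS (h.dV Z a) (x + s • V + s ^ 2 • Z, t), fun s => ?_, ?_, by simp, by simp⟩
  · refine (h.slice_curve a ht (hc s)).congr_deriv ?_
    simp only [h.ext_dV _ _ ht, Pi.add_apply, Pi.smul_apply, smul_eq_mul, Finset.mul_sum,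
      ← Finset.sum_add_distrib]
    exact Finset.sum_congr rfl fun i _ => by ring
  · have k1 := h.slice_curve (h.dV V a) ht (hc 0)
    have k2 := h.slice_curve (h.dV Z a) ht (hc 0)
    have := k1.add (((hasDerivAt_id (0:ℝ)).const_mul 2).mul k2)
    refine this.congr_deriv ?_
    simp

/-- The connection form in direction `V`. -/
def ΓV (h : IsRFOn g T) (V : Fin n → ℝ) : Matrix (Fin n) (Fin n) (smoothAlg (slab n T)) :=
  ∑ p, V p • h.Γ (some p)

theorem ΓV_apply (V : Fin n → ℝ) (i j : Fin n) : h.ΓV V i j = ∑ p, V p • h.Γ (some p) i j := by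
  simp [ΓV, Matrix.sum_apply]

/-- The value of the connection matrix in direction `V`. -/
def Γx (h : IsRFOn g T) (x : Fin n → ℝ) (t : ℝ) (V : Fin n → ℝ) : Matrix (Fin n) (Fin n) ℝ :=
  Matrix.of fun i j => ∑ p, V p * extS (h.Γ (some p) i j) (x, t)

theorem map_ΓV {x : Fin n → ℝ} {t : ℝ} (ht : t ∈ Icc 0 T) (V : Fin n → ℝ) :
    (h.ΓV V).map (evS (mem_slab ht (x := x))) = h.Γx x t V := by
  ext i j
  simp only [Matrix.map_apply, ΓV_apply, map_sum, map_smul, Γx, Matrix.of_apply, smul_eq_mul,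
    extS_apply _ (mem_slab ht)]

/-- Second order normal curve through `x` in direction `V`. -/
def ncurve (h : IsRFOn g T) (t : ℝ) (x V : Fin n → ℝ) (s : ℝ) : Fin n → ℝ :=
  x + s • V + s ^ 2 • (-(1/2 : ℝ) • h.Γx x t V *ᵥ V)

theorem laplace_jet (a : smoothAlg (slab n T)) {t : ℝ} (ht : t ∈ Icc 0 T) (x V : Fin n → ℝ) :
    HasJet (fun s => extS a (h.ncurve t x V s, t)) (extS a (x, t)) (extS (h.dV V a) (x, t))
      (∑ p, ∑ q, V p * V q * (extS (h.d (some p) (h.d (some q) a)) (x, t)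
        - ∑ k, extS (h.Γ (some p) k q) (x, t) * extS (h.d (some k) a) (x, t))) := by
  have key := h.jet_slice a ht x V (-(1/2 : ℝ) • h.Γx x t V *ᵥ V)
  have e1 : extS (h.dV V (h.dV V a)) (x, t) =
      ∑ p, ∑ q, V p * V q * extS (h.d (some p) (h.d (some q) a)) (x, t) := by
    rw [h.ext_dV _ _ ht]
    refine Finset.sum_congr rfl fun p _ => ?_
    rw [h.dV_eq, map_sum]
    simp only [extS_apply _ (mem_slab ht), map_sum, Finset.mul_sum]
    refine Finset.sum_congr rfl fun q _ => ?_
    rw [Derivation.map_smul, map_smul, smul_eq_mul]; ring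
  have e2 : extS (h.dV (-(1/2 : ℝ) • h.Γx x t V *ᵥ V) a) (x, t) = -(1/2) * ∑ p, ∑ q, V p * V q *
      ∑ k, extS (h.Γ (some p) k q) (x, t) * extS (h.d (some k) a) (x, t) := by
    rw [h.ext_dV _ _ ht]
    simp only [Pi.smul_apply, smul_eq_mul, Matrix.mulVec, dotProduct, Γx,
      Matrix.of_apply, Finset.sum_mul, Finset.mul_sum]
    rw [Finset.sum_comm]
    rw [Finset.sum_comm' (t' := Finset.univ) (s' := fun _ => Finset.univ) (by simp)]
    rw [Finset.sum_comm]
    conv_lhs => enter [2, q]; rw [Finset.sum_comm]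
    rw [Finset.sum_comm]
    refine Finset.sum_congr rfl fun p _ => Finset.sum_congr rfl fun q _ =>
      Finset.sum_congr rfl fun k _ => ?_
    ring
  rw [e1, e2] at key
  refine key.congr ?_
  simp only [mul_sub, Finset.sum_sub_distrib]
  ring

@[simp] theorem ncurve_zero (t : ℝ) (x V : Fin n → ℝ) : h.ncurve t x V 0 = x := by
  simp [ncurve]

theorem ncurve_contDiff (t : ℝ) (x V : Fin n → ℝ) : ContDiff ℝ ∞ (h.ncurve t x V) := by
  unfold ncurve; fun_prop

/-- Discrete form of the evolution inequality of `|Rm|²` at a point where `E` is an orthonormal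
frame. -/
theorem discrete_heat {x : Fin n → ℝ} {t : ℝ} (ht : t ∈ Ioc 0 T) {E : Matrix (Fin n) (Fin n) ℝ}
    (hE : Eᵀ * g x t * E = 1) {δ : ℝ} (hδ : 0 < δ) :
    ∃ h₀ > 0, ∀ s, 0 < s → s < h₀ → s ^ 2 ≤ t ∧
      -(s ^ 2 * (20 * n ^ 6 * (extS h.u (x, t) * √(extS h.u (x, t))) + δ)) ≤
      ∑ a, (extS h.u (h.ncurve t x (Eᵀ a) s, t) + extS h.u (h.ncurve t x (Eᵀ a) (-s), t)
        - 2 * extS h.u (x, t)) + (extS h.u (x, t - s ^ 2) - extS h.u (x, t)) := by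
  have ht' : t ∈ Icc 0 T := ⟨ht.1.le, ht.2⟩
  have hp : (x, t) ∈ slab n T := mem_slab ht'
  have hEE : E * (Eᵀ * g x t) = 1 := mul_eq_one_comm.mp hE
  have hinv : (g x t)⁻¹ = E * Eᵀ := by
    apply Matrix.inv_eq_left_inv
    rw [Matrix.mul_assoc, hEE]
  have pe := h.rfData.point_estimate (evS hp) hEE hE
  simp only [h.ev_H hp, hinv] at pe
  set U := extS h.u (x, t) with hU
  set D : Fin n → ℝ := fun a => ∑ p, ∑ q, Eᵀ a p * Eᵀ a q *
    (extS (h.d (some p) (h.d (some q) h.u)) (x, t)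
        - ∑ k, extS (h.Γ (some p) k q) (x, t) * extS (h.d (some k) h.u) (x, t)) with hD
  have hsum : extS (h.d none h.u) (x, t) ≤ ∑ a, D a + 20 * n ^ 6 * (U * √U) := by
    rw [hU]
    simp only [hD, extS_apply _ hp]
    refine pe.trans (le_of_eq ?_)
    congr 1
    conv_rhs => rw [Finset.sum_comm]
    refine Finset.sum_congr rfl fun p _ => ?_
    conv_rhs => rw [Finset.sum_comm]
    refine Finset.sum_congr rfl fun q _ => ?_
    rw [Matrix.mul_apply, Finset.sum_mul]
    rfl
  set δ' := δ / (n + 1 : ℝ) with hδ'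
  have hδ'0 : 0 < δ' := by positivity
  have hx : ∀ a : Fin n, ∃ h₀ > 0, ∀ s, 0 ≤ s → s < h₀ →
      |extS h.u (h.ncurve t x (Eᵀ a) s, t) + extS h.u (h.ncurve t x (Eᵀ a) (-s), t)
        - 2 * U - s ^ 2 * D a| ≤ δ' * s ^ 2 := by
    intro a
    have cd : ContDiff ℝ 2 (fun q : ℝ × ℝ => extS h.u (h.ncurve t x (Eᵀ a) q.1, t)) :=
      (((slice_contDiff h.u ht').comp (h.ncurve_contDiff t x (Eᵀ a))).comp contDiff_fst).of_le
        (WithTop.coe_le_coe.mpr le_top)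
    obtain ⟨h₀, h0, hh⟩ := uniform_second_diff cd (isCompact_singleton (x := (0:ℝ))) hδ'0
    refine ⟨h₀, h0, fun s hs hs' => ?_⟩
    have := hh s hs hs' 0 rfl _ _ _ (h.laplace_jet h.u ht' x (Eᵀ a))
    simpa only [h.ncurve_zero] using this
  choose r hr0 hr using hx
  have htime : ∃ ε > 0, ∀ s', 0 < s' → s' < ε → s' ≤ t ∧
      |extS h.u (x, t - s') - U + s' * extS (h.d none h.u) (x, t)| ≤ δ' * s' := by
    have := (h.time_hasDerivWithinAt h.u (x := x) ht').isLittleO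
    have := this.def hδ'0
    rw [Filter.eventually_iff, mem_nhdsWithin_iff_exists_mem_nhds_inter] at this
    obtain ⟨N, hN, hsub⟩ := this
    obtain ⟨ε, ε0, hε⟩ := Metric.mem_nhds_iff.mp hN
    refine ⟨min ε t, lt_min ε0 ht.1, fun s' h1 h2 => ?_⟩
    have hst : s' ≤ t := (h2.trans_le (min_le_right _ _)).le
    refine ⟨hst, ?_⟩
    have := hsub (a := t - s') ⟨hε (by
      rw [Metric.mem_ball, Real.dist_eq]; ring_nf
      rw [abs_neg, abs_of_pos h1]; exact h2.trans_le (min_le_left _ _)),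
      ⟨by linarith, by linarith [ht.2]⟩⟩
    simp only [mem_ofPred_eq, smul_eq_mul, Real.norm_eq_abs] at this
    have e : |t - s' - t| = s' := by
      rw [show t - s' - t = -s' by ring, abs_neg, abs_of_pos h1]
    rw [e] at this
    refine le_trans (le_of_eq ?_) this
    congr 1; ring
  obtain ⟨ε, ε0, hε⟩ := htime
  obtain ⟨m, hm0, hm⟩ : ∃ m > 0, ∀ a, m ≤ r a := by
    rcases isEmpty_or_nonempty (Fin n) with he | he
    · exact ⟨1, one_pos, fun a => he.elim a⟩
    · obtain ⟨a, ha⟩ := Finite.exists_min r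
      exact ⟨r a, hr0 a, ha⟩
  refine ⟨min m (min ε 1), lt_min hm0 (lt_min ε0 one_pos), fun s hs hs' => ?_⟩
  have s1 : s < 1 := hs'.trans_le ((min_le_right _ _).trans (min_le_right _ _))
  have s2 : s ^ 2 < ε := by
    have : s < ε := hs'.trans_le ((min_le_right _ _).trans (min_le_left _ _))
    nlinarith
  obtain ⟨hst, htm⟩ := hε (s ^ 2) (by positivity) s2
  refine ⟨hst, ?_⟩
  have hA : ∀ a, s ^ 2 * D a - δ' * s ^ 2 ≤ extS h.u (h.ncurve t x (Eᵀ a) s, t)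
      + extS h.u (h.ncurve t x (Eᵀ a) (-s), t) - 2 * U := by
    intro a
    have := (abs_le.mp (hr a s hs.le (hs'.trans_le ((min_le_left _ _).trans (hm a))))).1
    linarith
  have hB := Finset.sum_le_sum fun a (_ : a ∈ Finset.univ) => hA a
  rw [Finset.sum_sub_distrib, ← Finset.mul_sum, Finset.sum_const, Finset.card_univ,
    Fintype.card_fin, nsmul_eq_mul] at hB
  have hC := (abs_le.mp htm).1
  have hs2 : 0 < s ^ 2 := by positivity
  have hDD : δ' * s ^ 2 + n * (δ' * s ^ 2) = δ * s ^ 2 := by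
    rw [hδ']; field_simp; ring
  have := mul_le_mul_of_nonneg_left hsum hs2.le
  linarith

end IsRFOn

end RFlow

namespace RFlow

section QuadForm

/-- The quadratic form of a matrix. -/
def nq (M : Matrix (Fin n) (Fin n) ℝ) (v : Fin n → ℝ) : ℝ := ∑ i, ∑ j, M i j * v i * v j

/-- The bilinear form of a matrix. -/
def nb (M : Matrix (Fin n) (Fin n) ℝ) (v w : Fin n → ℝ) : ℝ := v ⬝ᵥ M *ᵥ w

theorem nb_eq_sum (M : Matrix (Fin n) (Fin n) ℝ) (v w : Fin n → ℝ) :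
    nb M v w = ∑ i, ∑ j, M i j * v i * w j := by
  simp only [nb, Matrix.mulVec, dotProduct, Finset.mul_sum]
  exact Finset.sum_congr rfl fun i _ => Finset.sum_congr rfl fun j _ => by ring

theorem nq_eq (M : Matrix (Fin n) (Fin n) ℝ) (v : Fin n → ℝ) : nq M v = nb M v v :=
  (nb_eq_sum M v v).symm

variable (M N : Matrix (Fin n) (Fin n) ℝ) (u v w : Fin n → ℝ) (c : ℝ)

theorem nb_add_left : nb M (u + v) w = nb M u w + nb M v w := add_dotProduct _ _ _
theorem nb_add_right : nb M u (v + w) = nb M u v + nb M u w := by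
  rw [nb, Matrix.mulVec_add, dotProduct_add]; rfl
theorem nb_sub_right : nb M u (v - w) = nb M u v - nb M u w := by
  rw [nb, Matrix.mulVec_sub, dotProduct_sub]; rfl
theorem nb_smul_left : nb M (c • u) w = c * nb M u w := smul_dotProduct _ _ _
theorem nb_smul_right : nb M u (c • w) = c * nb M u w := by
  rw [nb, Matrix.mulVec_smul, dotProduct_smul]; rfl
theorem nb_add_mat : nb (M + N) u v = nb M u v + nb N u v := by
  rw [nb, Matrix.add_mulVec, dotProduct_add]; rfl
theorem nb_mul_right (B : Matrix (Fin n) (Fin n) ℝ) : nb (M * B) u v = nb M u (B *ᵥ v) := by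
  rw [nb, ← Matrix.mulVec_mulVec]; rfl
theorem nb_transpose_mul (B : Matrix (Fin n) (Fin n) ℝ) : nb (Bᵀ * M) u v = nb M (B *ᵥ u) v := by
  rw [nb, ← Matrix.mulVec_mulVec, Matrix.mulVec_transpose, dotProduct_comm,
    ← Matrix.dotProduct_mulVec, dotProduct_comm]; rfl
theorem nb_comm {M : Matrix (Fin n) (Fin n) ℝ} (hM : Mᵀ = M) (u v : Fin n → ℝ) :
    nb M u v = nb M v u := by
  rw [nb, dotProduct_comm, ← Matrix.vecMul_transpose, hM, ← Matrix.dotProduct_mulVec]; rfl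

end QuadForm

variable {g : (Fin n → ℝ) → ℝ → Matrix (Fin n) (Fin n) ℝ} {T : ℝ}

namespace IsRFOn

open scoped ContDiff

variable (h : IsRFOn g T)

theorem comp_V (V : Fin n → ℝ) : dMat h.dV V h.G = (h.ΓV V)ᵀ * h.G + h.G * h.ΓV V := by
  have e : dMat h.dV V h.G = ∑ p, V p • dMat h.d (some p) h.G := by
    ext i j : 1
    rw [dMat_apply, h.dV_eq, Matrix.sum_apply]; rfl
  rw [e, ΓV, Matrix.transpose_sum, Finset.sum_mul, Finset.mul_sum, ← Finset.sum_add_distrib]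
  refine Finset.sum_congr rfl fun p _ => ?_
  rw [h.rfData.hcomp, smul_add, Matrix.transpose_smul, Matrix.smul_mul, Matrix.mul_smul]

theorem Γx_comm (x : Fin n → ℝ) (t : ℝ) (V W : Fin n → ℝ) :
    h.Γx x t V *ᵥ W = h.Γx x t W *ᵥ V := by
  ext i
  simp only [Matrix.mulVec, dotProduct, Γx, Matrix.of_apply, Finset.sum_mul]
  rw [Finset.sum_comm]
  refine Finset.sum_congr rfl fun p _ => Finset.sum_congr rfl fun q _ => ?_
  rw [h.rfData.htor q p i]; ring

/-- Derivative of the connection matrix `Γ_V` in direction `ξ`. -/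
def dΓx (h : IsRFOn g T) (x : Fin n → ℝ) (t : ℝ) (ξ V : Fin n → ℝ) : Matrix (Fin n) (Fin n) ℝ :=
  Matrix.of fun i j => ∑ p, V p * ∑ q, ξ q * extS (h.d (some q) (h.Γ (some p) i j)) (x, t)

theorem map_dΓ {x : Fin n → ℝ} {t : ℝ} (ht : t ∈ Icc 0 T) (ξ V : Fin n → ℝ) :
    (dMat h.dV ξ (h.ΓV V)).map (evS (mem_slab ht (x := x))) = h.dΓx x t ξ V := by
  ext i j
  simp only [Matrix.map_apply, ΓV_apply, dMat_apply, map_sum, Derivation.map_smul, map_smul, dΓx,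
    Matrix.of_apply, smul_eq_mul, extS_apply _ (mem_slab ht), h.ev_dV]

theorem dΓx_comm (x : Fin n → ℝ) (t : ℝ) (ξ V W : Fin n → ℝ) :
    h.dΓx x t ξ V *ᵥ W = h.dΓx x t ξ W *ᵥ V := by
  ext i
  simp only [Matrix.mulVec, dotProduct, dΓx, Matrix.of_apply, Finset.sum_mul]
  rw [Finset.sum_comm]
  refine Finset.sum_congr rfl fun p _ => Finset.sum_congr rfl fun q _ => ?_
  rw [h.rfData.htor q p i]; ring

theorem map_dG {x : Fin n → ℝ} {t : ℝ} (ht : t ∈ Icc 0 T) (V : Fin n → ℝ) :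
    (dMat h.dV V h.G).map (evS (mem_slab ht (x := x)))
      = (h.Γx x t V)ᵀ * g x t + g x t * h.Γx x t V := by
  rw [h.comp_V, Matrix.map_add _ (map_add _), Matrix.map_mul, Matrix.map_mul, Matrix.transpose_map,
    h.map_ΓV ht, h.map_G]

theorem map_ddG {x : Fin n → ℝ} {t : ℝ} (ht : t ∈ Icc 0 T) (V : Fin n → ℝ) :
    (dMat h.dV V (dMat h.dV V h.G)).map (evS (mem_slab ht (x := x)))
      = ((h.dΓx x t V V)ᵀ * g x t + (h.Γx x t V)ᵀ * ((h.Γx x t V)ᵀ * g x t + g x t * h.Γx x t V))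
      + (((h.Γx x t V)ᵀ * g x t + g x t * h.Γx x t V) * h.Γx x t V + g x t * h.dΓx x t V V) := by
  conv_lhs => rw [h.comp_V, dMat_add, dMat_mul, dMat_mul, dMat_transpose]
  simp only [Matrix.map_add _ (map_add (evS (mem_slab ht (x := x)))), Matrix.map_mul,
    Matrix.transpose_map, h.map_ΓV ht, h.map_G, h.map_dG ht, h.map_dΓ ht]

/-- Acceleration of the second order normal curve. -/
def zf (h : IsRFOn g T) (t : ℝ) (x V : Fin n → ℝ) : Fin n → ℝ := -(1/2 : ℝ) • h.Γx x t V *ᵥ V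

/-- First variation of `zf`. -/
def zf' (h : IsRFOn g T) (t : ℝ) (x ξ V W : Fin n → ℝ) : Fin n → ℝ :=
  -(1/2 : ℝ) • (h.dΓx x t ξ V *ᵥ V + (2 : ℝ) • h.Γx x t V *ᵥ W)

/-- Speed squared of the varied path. -/
def vq (h : IsRFOn g T) (t : ℝ) (x ξ V W : Fin n → ℝ) (s : ℝ) : ℝ :=
  nq (g (h.ncurve t x V s) t) (ξ + s • W + s ^ 2 • h.zf' t x ξ V W)

/-- The curvature endomorphism in directions `V`, `ξ`. -/
def Rx (h : IsRFOn g T) (x : Fin n → ℝ) (t : ℝ) (V ξ : Fin n → ℝ) : Matrix (Fin n) (Fin n) ℝ :=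
  h.dΓx x t V ξ - h.dΓx x t ξ V + h.Γx x t V * h.Γx x t ξ - h.Γx x t ξ * h.Γx x t V

theorem second_variation {t : ℝ} (ht : t ∈ Icc 0 T) (x ξ V W : Fin n → ℝ) :
    ∃ b, HasJet (h.vq t x ξ V W) (nq (g x t) ξ) b
      (2 * (nq (g x t) (W + h.Γx x t V *ᵥ ξ) + nb (g x t) ξ (h.Rx x t V ξ *ᵥ V))) := by
  have hX : ∀ i, HasJet (fun s => (ξ + s • W + s ^ 2 • h.zf' t x ξ V W) i) (ξ i) (W i)
      (2 * h.zf' t x ξ V W i) := fun i => HasJet.quad _ _ _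
  have hG : ∀ i j, HasJet (fun s => g (h.ncurve t x V s) t i j) (g x t i j)
      (extS (h.dV V (h.G i j)) (x, t))
      (extS (h.dV V (h.dV V (h.G i j))) (x, t) + 2 * extS (h.dV (h.zf t x V) (h.G i j)) (x, t)) := by
    intro i j
    have := h.jet_slice (h.G i j) ht x V (h.zf t x V)
    have e : ∀ y, extS (h.G i j) (y, t) = g y t i j := fun y => by
      rw [extS_apply _ (mem_slab ht)]; rfl
    simp only [e] at this
    exact this
  have key := HasJet.sum Finset.univ fun i _ => HasJet.sum Finset.univ fun j _ =>
    ((hG i j).mul (hX i)).mul (hX j)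
  refine ⟨_, key.congr ?_⟩
  have hp : (x, t) ∈ slab n T := mem_slab ht
  have hM : (g x t)ᵀ = g x t := (h.smooth.2 x t ht).1
  set B := h.Γx x t V with hB
  set Z := h.zf t x V with hZ
  set Z' := h.zf' t x ξ V W with hZ'
  have hdG : ∀ V i j, extS (h.dV V (h.G i j)) (x, t)
      = ((h.Γx x t V)ᵀ * g x t + g x t * h.Γx x t V) i j := fun V i j => by
    rw [← h.map_dG ht, extS_apply _ hp]; rfl
  have hddG : ∀ i j, extS (h.dV V (h.dV V (h.G i j))) (x, t) = (((h.dΓx x t V V)ᵀ * g x t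
      + Bᵀ * (Bᵀ * g x t + g x t * B))
      + ((Bᵀ * g x t + g x t * B) * B + g x t * h.dΓx x t V V)) i j := fun i j => by
    rw [← h.map_ddG ht, extS_apply _ hp]; rfl
  simp only [hdG, hddG]
  set M1 := Bᵀ * g x t + g x t * B with hM1
  set M2 := ((h.dΓx x t V V)ᵀ * g x t + Bᵀ * M1) + (M1 * B + g x t * h.dΓx x t V V) with hM2
  set M3 := (h.Γx x t Z)ᵀ * g x t + g x t * h.Γx x t Z with hM3
  have hsum : (∑ i, ∑ j, (((M2 i j + 2 * M3 i j) * ξ i + 2 * (M1 i j * W i)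
      + g x t i j * (2 * Z' i)) * ξ j + 2 * ((M1 i j * ξ i + g x t i j * W i) * W j)
      + g x t i j * ξ i * (2 * Z' j))) = nb M2 ξ ξ + 2 * nb M3 ξ ξ + 2 * nb M1 W ξ
      + 2 * nb (g x t) Z' ξ + 2 * nb M1 ξ W + 2 * nb (g x t) W W + 2 * nb (g x t) ξ Z' := by
    simp only [nb_eq_sum, Finset.mul_sum, ← Finset.sum_add_distrib]
    exact Finset.sum_congr rfl fun i _ => Finset.sum_congr rfl fun j _ => by ring
  rw [hsum]
  have c1 : h.dΓx x t V V *ᵥ ξ = h.dΓx x t V ξ *ᵥ V := h.dΓx_comm x t V V ξ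
  have c2 : B *ᵥ ξ = h.Γx x t ξ *ᵥ V := h.Γx_comm x t V ξ
  have c3 : h.Γx x t Z *ᵥ ξ = -(1/2 : ℝ) • (h.Γx x t ξ *ᵥ (B *ᵥ V)) := by
    rw [h.Γx_comm, hZ, zf, Matrix.mulVec_smul]
  have c4 : Z' = -(1/2 : ℝ) • (h.dΓx x t ξ V *ᵥ V + (2 : ℝ) • B *ᵥ W) := rfl
  have c5 : h.Rx x t V ξ *ᵥ V = h.dΓx x t V ξ *ᵥ V - h.dΓx x t ξ V *ᵥ V + B *ᵥ (B *ᵥ ξ)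
      - h.Γx x t ξ *ᵥ (B *ᵥ V) := by
    rw [Rx, Matrix.sub_mulVec, Matrix.add_mulVec, Matrix.sub_mulVec, ← Matrix.mulVec_mulVec,
      ← Matrix.mulVec_mulVec, c2]
  rw [nb_comm hM Z' ξ, nq_eq, c5, c4, hM3, hM2, hM1]
  simp only [nb_add_mat, nb_transpose_mul]
  simp only [nb_add_mat, nb_mul_right, c1, c3, nb_add_left, nb_add_right,
    nb_sub_right, nb_smul_left, nb_smul_right]
  rw [nb_comm hM (h.dΓx x t V ξ *ᵥ V) ξ, nb_comm hM (h.Γx x t ξ *ᵥ (B *ᵥ V)) ξ,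
    nb_comm hM (B *ᵥ (B *ᵥ ξ)) ξ, nb_comm hM (B *ᵥ W) ξ, nb_comm hM (B *ᵥ ξ) W,
    ← nb_mul_right Bᵀ, nb_transpose_mul]
  ring

end IsRFOn

end RFlow

namespace RFlow

variable {g : (Fin n → ℝ) → ℝ → Matrix (Fin n) (Fin n) ℝ} {T : ℝ}

namespace IsRFOn

open scoped ContDiff

variable (h : IsRFOn g T)

/-- The Ricci tensor as a matrix. -/
def rc (h : IsRFOn g T) (x : Fin n → ℝ) (t : ℝ) : Matrix (Fin n) (Fin n) ℝ :=
  Matrix.of fun j k => extS (ricM h.d h.Γ j k) (x, t)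

/-- Values of the spatial curvature endomorphisms. -/
def Fm (h : IsRFOn g T) (x : Fin n → ℝ) (t : ℝ) (p q : Fin n) : Matrix (Fin n) (Fin n) ℝ :=
  Matrix.of fun i j => extS (h.rfData.F p q i j) (x, t)

theorem Rx_eq {t : ℝ} (ht : t ∈ Icc 0 T) (x V ξ : Fin n → ℝ) :
    h.Rx x t V ξ = ∑ p, ∑ q, (V p * ξ q) • h.Fm x t p q := by
  have hp : (x, t) ∈ slab n T := mem_slab ht
  set Gm : Fin n → Matrix (Fin n) (Fin n) ℝ := fun p => (h.Γ (some p)).map (evS hp) with hGm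
  set dm : Fin n → Fin n → Matrix (Fin n) (Fin n) ℝ :=
    fun q p => (dMat h.d (some q) (h.Γ (some p))).map (evS hp) with hdm
  have e1 : ∀ V, h.Γx x t V = ∑ p, V p • Gm p := by
    intro V; ext i j
    simp [Γx, Matrix.sum_apply, hGm, extS_apply _ hp]
  have e2 : ∀ ξ V, h.dΓx x t ξ V = ∑ p, ∑ q, (V p * ξ q) • dm q p := by
    intro ξ V; ext i j
    simp only [dΓx, Matrix.of_apply, Matrix.sum_apply, Matrix.smul_apply, hdm, extS_apply _ hp,
      Matrix.map_apply, dMat_apply, Finset.mul_sum, smul_eq_mul, mul_assoc]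
  have e3 : ∀ p q, h.Fm x t p q = dm p q - dm q p + Gm p * Gm q - Gm q * Gm p := by
    intro p q
    have : h.Fm x t p q = (h.rfData.F p q).map (evS hp) := by
      ext i j; simp [Fm, extS_apply _ hp]
    rw [this, RFData.F, curvF, hdm, hGm, Matrix.map_sub _ (map_sub _), Matrix.map_add _ (map_add _),
      Matrix.map_sub _ (map_sub _), Matrix.map_mul, Matrix.map_mul]
  rw [Rx, e2, e2, e1, e1, Finset.sum_mul_sum, Finset.sum_mul_sum]
  simp only [e3, smul_sub, smul_add, Finset.sum_sub_distrib, Finset.sum_add_distrib,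
    Matrix.smul_mul, Matrix.mul_smul, smul_smul]
  have s1 : ∑ p, ∑ q, (ξ p * V q) • dm q p = ∑ p, ∑ q, (V p * ξ q) • dm p q := by
    rw [Finset.sum_comm]; simp only [mul_comm]
  have s2 : ∑ p, ∑ q, (V q * ξ p) • (Gm p * Gm q) = ∑ p, ∑ q, (V p * ξ q) • (Gm q * Gm p) :=
    Finset.sum_comm
  have s3 : ∑ p, ∑ q, (ξ q * V p) • (Gm p * Gm q) = ∑ p, ∑ q, (V p * ξ q) • (Gm p * Gm q) := by
    simp only [mul_comm (ξ _)]
  rw [s1, s2, s3]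

theorem skew_Rx {t : ℝ} (ht : t ∈ Icc 0 T) (x V ξ v w : Fin n → ℝ) :
    nb (g x t) v (h.Rx x t V ξ *ᵥ w) = -nb (g x t) w (h.Rx x t V ξ *ᵥ v) := by
  have hp : (x, t) ∈ slab n T := mem_slab ht
  have hs : ∀ p q k l, (g x t * h.Fm x t p q) k l = -(g x t * h.Fm x t p q) l k := by
    intro p q k l
    have e : ∀ k l, (g x t * h.Fm x t p q) k l = evS hp ((h.G * h.rfData.F p q) k l) := by
      intro k l
      simp only [Matrix.mul_apply, map_sum, map_mul, h.ev_G, Fm, Matrix.of_apply, extS_apply _ hp]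
    rw [e, e, ← map_neg]
    exact congrArg _ (h.rfData.skew _ _ k l)
  have hs2 : ∀ k l, (g x t * h.Rx x t V ξ) k l = -(g x t * h.Rx x t V ξ) l k := by
    intro k l
    rw [h.Rx_eq ht]
    simp only [Finset.mul_sum, Matrix.mul_smul, Matrix.sum_apply, Matrix.smul_apply, smul_eq_mul]
    rw [← Finset.sum_neg_distrib]
    refine Finset.sum_congr rfl fun p _ => ?_
    rw [← Finset.sum_neg_distrib]
    refine Finset.sum_congr rfl fun q _ => ?_
    rw [hs]; ring
  rw [← nb_mul_right, ← nb_mul_right, nb_eq_sum, nb_eq_sum, Finset.sum_comm, ← Finset.sum_neg_distrib]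
  refine Finset.sum_congr rfl fun p _ => ?_
  rw [← Finset.sum_neg_distrib]
  refine Finset.sum_congr rfl fun q _ => ?_
  rw [hs2]; ring

theorem sum_Rx {t : ℝ} (ht : t ∈ Icc 0 T) (x ξ : Fin n → ℝ) {P : Matrix (Fin n) (Fin n) ℝ}
    (hP : Pᵀ * g x t * P = 1) :
    ∑ a, nb (g x t) ξ (h.Rx x t (Pᵀ a) ξ *ᵥ (Pᵀ a)) = -nq (h.rc x t) ξ := by
  have hp : (x, t) ∈ slab n T := mem_slab ht
  have hM : (g x t)ᵀ = g x t := (h.smooth.2 x t ht).1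
  have hPP : P * Pᵀ * g x t = 1 := by
    rw [Matrix.mul_assoc]; exact mul_eq_one_comm.mp hP
  have e1 : ∀ a, nb (g x t) ξ (h.Rx x t (Pᵀ a) ξ *ᵥ (Pᵀ a)) =
      -∑ p, ∑ q, ∑ r, (P p a * P r a) * (ξ q * (g x t *ᵥ (h.Fm x t p q *ᵥ ξ)) r) := by
    intro a
    rw [h.skew_Rx ht, h.Rx_eq ht, Matrix.sum_mulVec]
    simp only [Matrix.sum_mulVec, Matrix.smul_mulVec, nb, Matrix.mulVec_sum, Matrix.mulVec_smul,
      dotProduct_sum, dotProduct_smul, smul_eq_mul]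
    congr 1
    refine Finset.sum_congr rfl fun p _ => Finset.sum_congr rfl fun q _ => ?_
    rw [dotProduct, Finset.mul_sum]
    refine Finset.sum_congr rfl fun r _ => ?_
    simp only [Matrix.transpose_apply]; ring
  simp only [e1]
  rw [Finset.sum_neg_distrib, neg_inj]
  have e2 : ∑ a, ∑ p, ∑ q, ∑ r, (P p a * P r a) * (ξ q * (g x t *ᵥ (h.Fm x t p q *ᵥ ξ)) r)
      = ∑ p, ∑ q, ξ q * ((P * Pᵀ) *ᵥ (g x t *ᵥ (h.Fm x t p q *ᵥ ξ))) p := by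
    rw [Finset.sum_comm]
    refine Finset.sum_congr rfl fun p _ => ?_
    rw [Finset.sum_comm]
    refine Finset.sum_congr rfl fun q _ => ?_
    rw [Finset.sum_comm, Matrix.mulVec, dotProduct, Finset.mul_sum]
    refine Finset.sum_congr rfl fun r _ => ?_
    rw [Matrix.mul_apply, ← Finset.sum_mul]
    simp only [Matrix.transpose_apply]; ring
  rw [e2]
  simp only [Matrix.mulVec_mulVec, ← Matrix.mul_assoc, hPP, Matrix.one_mul]
  rw [Finset.sum_comm]
  refine Finset.sum_congr rfl fun q _ => ?_
  rw [← Finset.mul_sum]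
  simp only [Matrix.mulVec, dotProduct]
  rw [Finset.sum_comm, Finset.mul_sum]
  refine Finset.sum_congr rfl fun s _ => ?_
  simp only [Fm, rc, Matrix.of_apply, h.rfData.ric_eq, extS_apply _ hp, map_sum, ← Finset.sum_mul]
  ring

theorem uniform_time (a : smoothAlg (slab n T)) {t : ℝ} (ht : t ∈ Icc 0 T) {K : Set (Fin n → ℝ)}
    (hK : IsCompact K) {δ : ℝ} (hδ : 0 < δ) : ∃ ε > 0, ∀ s, 0 ≤ s → s < ε → s ≤ t → ∀ x ∈ K,
      |extS a (x, t - s) - extS a (x, t) + s * extS (h.d none a) (x, t)| ≤ δ * s := by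
  have hc : ContinuousOn (extS (h.d none a)) (K ×ˢ Icc 0 T) :=
    (extS_contDiffOn _).continuousOn.mono (prod_mono (subset_univ _) Subset.rfl)
  have huc := (hK.prod isCompact_Icc).uniformContinuousOn_of_continuous hc
  rw [Metric.uniformContinuousOn_iff] at huc
  obtain ⟨ε, ε0, hε⟩ := huc δ hδ
  refine ⟨ε, ε0, fun s h0 h1 h2 x hx => ?_⟩
  have hsub : Icc (t - s) t ⊆ Icc 0 T := Icc_subset_Icc (by linarith) ht.2
  have hd : ∀ r ∈ Icc (t - s) t, HasDerivWithinAt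
      (fun r => extS a (x, r) - r * extS (h.d none a) (x, t))
      (extS (h.d none a) (x, r) - extS (h.d none a) (x, t)) (Icc (t - s) t) r := by
    intro r hr
    have := ((h.time_hasDerivWithinAt a (x := x) (hsub hr)).mono hsub).sub
      ((hasDerivWithinAt_id r _).mul_const (extS (h.d none a) (x, t)))
    exact this.congr_deriv (by simp)
  have := Convex.norm_image_sub_le_of_norm_hasDerivWithin_le (C := δ) hd (fun r hr => by
      have := hε (x, r) ⟨hx, hsub hr⟩ (x, t) ⟨hx, ht⟩ (by
        rw [Prod.dist_eq, dist_self, Real.dist_eq, max_eq_right (abs_nonneg _), abs_lt]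
        constructor <;> linarith [hr.1, hr.2])
      exact this.le)
    (convex_Icc _ _) (right_mem_Icc.2 (by linarith)) (left_mem_Icc.2 (by linarith : t - s ≤ t))
  simp only [Real.norm_eq_abs] at this
  rw [show |t - s - t| = s by rw [show t - s - t = -s by ring, abs_neg, abs_of_nonneg h0]] at this
  refine le_trans (le_of_eq ?_) this
  congr 1; ring

end IsRFOn

end RFlow

namespace RFlow

variable {g : (Fin n → ℝ) → ℝ → Matrix (Fin n) (Fin n) ℝ} {T : ℝ}

theorem nq_smul (M : Matrix (Fin n) (Fin n) ℝ) (c : ℝ) (v : Fin n → ℝ) :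
    nq M (c • v) = c ^ 2 * nq M v := by
  rw [nq_eq, nb_smul_left, nb_smul_right, nq_eq]; ring

theorem nq_nonneg {M : Matrix (Fin n) (Fin n) ℝ} (hM : M.PosDef) (v : Fin n → ℝ) : 0 ≤ nq M v := by
  rw [nq_eq]
  have := hM.posSemidef.dotProduct_mulVec_nonneg v
  rwa [star_trivial] at this

theorem nq_pos {M : Matrix (Fin n) (Fin n) ℝ} (hM : M.PosDef) {v : Fin n → ℝ} (hv : v ≠ 0) :
    0 < nq M v := by
  rw [nq_eq]
  have := hM.dotProduct_mulVec_pos hv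
  rwa [star_trivial] at this

theorem continuous_nq {X : Type*} [TopologicalSpace X] {M : X → Matrix (Fin n) (Fin n) ℝ}
    {v : X → Fin n → ℝ} {S : Set X} (hM : ∀ i j, ContinuousOn (fun x => M x i j) S)
    (hv : ContinuousOn v S) : ContinuousOn (fun x => nq (M x) (v x)) S := by
  have hv' := continuousOn_pi.1 hv
  exact continuousOn_finsetSum _ fun i _ => continuousOn_finsetSum _ fun j _ =>
    ((hM i j).mul (hv' i)).mul (hv' j)

namespace IsRFOn

open scoped ContDiff

variable (h : IsRFOn g T)

section Smoothness

variable {X : Type*} [NormedAddCommGroup X] [NormedSpace ℝ X] {t : ℝ}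

include h in
theorem contDiff_g (ht : t ∈ Icc 0 T) (i j : Fin n) : ContDiff ℝ ∞ fun y => g y t i j := by
  have e : (fun y => g y t i j) = fun y => extS (h.G i j) (y, t) := by
    funext y; rw [extS_apply _ (mem_slab ht), h.ev_G]
  rw [e]; exact slice_contDiff (h.G i j) ht

theorem contDiff_Γx (ht : t ∈ Icc 0 T) {c V : X → Fin n → ℝ} (hc : ContDiff ℝ ∞ c)
    (hV : ContDiff ℝ ∞ V) (i j : Fin n) : ContDiff ℝ ∞ fun p => h.Γx (c p) t (V p) i j :=
  by
  simp only [Γx, Matrix.of_apply]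
  exact ContDiff.sum fun q _ => (contDiff_pi.1 hV q).mul ((slice_contDiff _ ht).comp hc)

theorem contDiff_dΓx (ht : t ∈ Icc 0 T) {c ξ V : X → Fin n → ℝ} (hc : ContDiff ℝ ∞ c)
    (hξ : ContDiff ℝ ∞ ξ) (hV : ContDiff ℝ ∞ V) (i j : Fin n) :
    ContDiff ℝ ∞ fun p => h.dΓx (c p) t (ξ p) (V p) i j :=
  by
  simp only [dΓx, Matrix.of_apply]
  exact ContDiff.sum fun q _ => (contDiff_pi.1 hV q).mul <| ContDiff.sum fun r _ =>
    (contDiff_pi.1 hξ r).mul ((slice_contDiff _ ht).comp hc)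

theorem contDiff_mulVec {A : X → Matrix (Fin n) (Fin n) ℝ} {V : X → Fin n → ℝ}
    (hA : ∀ i j, ContDiff ℝ ∞ fun p => A p i j) (hV : ContDiff ℝ ∞ V) :
    ContDiff ℝ ∞ fun p => A p *ᵥ V p :=
  contDiff_pi.2 fun i => by
    simp only [Matrix.mulVec, dotProduct]
    exact ContDiff.sum fun j _ => (hA i j).mul (contDiff_pi.1 hV j)

theorem contDiff_ncurve (ht : t ∈ Icc 0 T) {c V : X → Fin n → ℝ} {s : X → ℝ}
    (hc : ContDiff ℝ ∞ c) (hV : ContDiff ℝ ∞ V) (hs : ContDiff ℝ ∞ s) :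
    ContDiff ℝ ∞ fun p => h.ncurve t (c p) (V p) (s p) := by
  unfold ncurve
  refine (hc.add (hs.smul hV)).add ((hs.pow 2).smul ?_)
  exact ContDiff.const_smul _ (contDiff_mulVec (h.contDiff_Γx ht hc hV) hV)

theorem contDiff_zf' (ht : t ∈ Icc 0 T) {c ξ V W : X → Fin n → ℝ}
    (hc : ContDiff ℝ ∞ c) (hξ : ContDiff ℝ ∞ ξ) (hV : ContDiff ℝ ∞ V) (hW : ContDiff ℝ ∞ W) :
    ContDiff ℝ ∞ fun p => h.zf' t (c p) (ξ p) (V p) (W p) := by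
  unfold zf'
  refine ContDiff.const_smul _ ((contDiff_mulVec (h.contDiff_dΓx ht hc hξ hV) hV).add ?_)
  exact ContDiff.const_smul _ (contDiff_mulVec (h.contDiff_Γx ht hc hV) hW)

theorem contDiff_vq (ht : t ∈ Icc 0 T) {c ξ V W : X → Fin n → ℝ} {s : X → ℝ}
    (hc : ContDiff ℝ ∞ c) (hξ : ContDiff ℝ ∞ ξ) (hV : ContDiff ℝ ∞ V) (hW : ContDiff ℝ ∞ W)
    (hs : ContDiff ℝ ∞ s) :
    ContDiff ℝ ∞ fun p => h.vq t (c p) (ξ p) (V p) (W p) (s p) := by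
  have hz := h.contDiff_zf' ht hc hξ hV hW
  have hX : ContDiff ℝ ∞ fun p => ξ p + s p • W p + s p ^ 2 • h.zf' t (c p) (ξ p) (V p) (W p) :=
    (hξ.add (hs.smul hW)).add ((hs.pow 2).smul hz)
  have hn := h.contDiff_ncurve ht hc hV hs
  simp only [vq, nq]
  exact ContDiff.sum fun i _ => ContDiff.sum fun j _ =>
    (((h.contDiff_g ht i j).comp hn).mul (contDiff_pi.1 hX i)).mul (contDiff_pi.1 hX j)

end Smoothness

theorem zf'_smul (t : ℝ) (x ξ V W : Fin n → ℝ) (c : ℝ) :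
    h.zf' t x (c • ξ) V (c • W) = c • h.zf' t x ξ V W := by
  have e : h.dΓx x t (c • ξ) V = c • h.dΓx x t ξ V := by
    ext i j
    simp only [dΓx, Matrix.of_apply, Matrix.smul_apply, Pi.smul_apply, smul_eq_mul, Finset.mul_sum]
    exact Finset.sum_congr rfl fun p _ => Finset.sum_congr rfl fun q _ => by ring
  rw [zf', zf', e, Matrix.mulVec_smul, Matrix.smul_mulVec, smul_comm (2:ℝ), ← smul_add, smul_comm]

theorem vq_smul (t : ℝ) (x ξ V W : Fin n → ℝ) (c s : ℝ) :
    h.vq t x (c • ξ) V (c • W) s = c ^ 2 * h.vq t x ξ V W s := by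
  rw [vq, vq, zf'_smul, ← nq_smul]
  congr 1
  simp only [smul_add, smul_comm c]

theorem vq_zero (t : ℝ) (x ξ V W : Fin n → ℝ) : h.vq t x ξ V W 0 = nq (g x t) ξ := by
  simp [vq]

include h in
theorem g_continuousOn (i j : Fin n) :
    ContinuousOn (fun p : (Fin n → ℝ) × ℝ => g p.1 p.2 i j) (slab n T) :=
  (h.smooth.1 i j).continuousOn

include h in
theorem metric_lower {K : Set (Fin n → ℝ)} (hK : IsCompact K) :
    ∃ c > 0, ∀ x ∈ K, ∀ s ∈ Icc 0 T, ∀ v, c * ‖v‖ ^ 2 ≤ nq (g x s) v := by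
  set Z : Set (((Fin n → ℝ) × ℝ) × (Fin n → ℝ)) := (K ×ˢ Icc 0 T) ×ˢ Metric.sphere 0 1 with hZ
  have hZc : IsCompact Z := (hK.prod isCompact_Icc).prod (isCompact_sphere _ _)
  have hf : ContinuousOn (fun z : ((Fin n → ℝ) × ℝ) × (Fin n → ℝ) => nq (g z.1.1 z.1.2) z.2) Z := by
    refine continuous_nq (fun i j => ?_) continuous_snd.continuousOn
    exact (h.g_continuousOn i j).comp continuous_fst.continuousOn fun z hz =>
      ⟨mem_univ _, hz.1.2⟩
  have key : ∃ c > 0, ∀ z ∈ Z, c ≤ nq (g z.1.1 z.1.2) z.2 := by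
    rcases Z.eq_empty_or_nonempty with he | hne
    · exact ⟨1, one_pos, fun z hz => by simp [he] at hz⟩
    · obtain ⟨z, hz, hmin⟩ := hZc.exists_isMinOn hne hf
      refine ⟨_, nq_pos (h.smooth.2 z.1.1 z.1.2 hz.1.2).2 ?_, hmin⟩
      intro h0
      have := hz.2
      simp [h0] at this
  obtain ⟨c, c0, hc⟩ := key
  refine ⟨c, c0, fun x hx s hs v => ?_⟩
  rcases eq_or_ne v 0 with rfl | hv
  · simp [nq]
  have hv' : 0 < ‖v‖ := norm_pos_iff.2 hv
  have := hc ((x, s), ‖v‖⁻¹ • v) ⟨⟨hx, hs⟩, by simp [norm_smul, hv'.ne']⟩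
  simp only [nq_smul] at this
  rw [inv_pow, inv_mul_eq_div, le_div_iff₀ (by positivity)] at this
  exact this

/-- Uniform second order expansion of the speed squared along parallel-type variations. -/
theorem uniform_vq {t : ℝ} (ht : t ∈ Icc 0 T) {K : Set (Fin n → ℝ)} (hK : IsCompact K) (B M : ℝ)
    {δ : ℝ} (hδ : 0 < δ) : ∃ h₀ > 0, ∀ s, 0 ≤ s → s < h₀ → ∀ x ∈ K, ∀ ξ v : Fin n → ℝ,
      ‖ξ‖ ≤ B → ‖v‖ ≤ B → ∀ μ, |μ| ≤ M → ∀ η ∈ Icc (0:ℝ) 1,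
      h.vq t x ξ (η • v) (μ • v - η • h.Γx x t ξ *ᵥ v) s
        + h.vq t x ξ (η • v) (μ • v - η • h.Γx x t ξ *ᵥ v) (-s) - 2 * nq (g x t) ξ
        ≤ 2 * s ^ 2 * (μ ^ 2 * nq (g x t) v + η ^ 2 * nb (g x t) ξ (h.Rx x t v ξ *ᵥ v))
          + δ * s ^ 2 := by
  set X := (Fin n → ℝ) × (Fin n → ℝ) × (Fin n → ℝ) × ℝ × ℝ with hX
  set Φ : ℝ × X → ℝ := fun p =>
    h.vq t p.2.1 p.2.2.1 (p.2.2.2.2.2 • p.2.2.2.1)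
      (p.2.2.2.2.1 • p.2.2.2.1 - p.2.2.2.2.2 • (h.Γx p.2.1 t p.2.2.1 *ᵥ p.2.2.2.1)) p.1 with hΦ
  have c2 : ContDiff ℝ ∞ fun p : ℝ × X => p.2 := contDiff_snd
  have cx : ContDiff ℝ ∞ fun p : ℝ × X => p.2.1 := contDiff_fst.comp c2
  have cξ : ContDiff ℝ ∞ fun p : ℝ × X => p.2.2.1 := contDiff_fst.comp (contDiff_snd.comp c2)
  have cv : ContDiff ℝ ∞ fun p : ℝ × X => p.2.2.2.1 :=
    contDiff_fst.comp (contDiff_snd.comp (contDiff_snd.comp c2))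
  have cμ : ContDiff ℝ ∞ fun p : ℝ × X => p.2.2.2.2.1 :=
    contDiff_fst.comp (contDiff_snd.comp (contDiff_snd.comp (contDiff_snd.comp c2)))
  have cη : ContDiff ℝ ∞ fun p : ℝ × X => p.2.2.2.2.2 :=
    contDiff_snd.comp (contDiff_snd.comp (contDiff_snd.comp (contDiff_snd.comp c2)))
  have hΦs : ContDiff ℝ ∞ Φ := by
    refine h.contDiff_vq ht cx cξ (cη.smul cv) ?_ contDiff_fst
    exact (cμ.smul cv).sub (cη.smul (contDiff_mulVec (h.contDiff_Γx ht cx cξ) cv))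
  have hKK : IsCompact (K ×ˢ Metric.closedBall (0 : Fin n → ℝ) B ×ˢ
      Metric.closedBall (0 : Fin n → ℝ) B ×ˢ Icc (-M) M ×ˢ Icc (0:ℝ) 1) :=
    hK.prod ((isCompact_closedBall _ _).prod ((isCompact_closedBall _ _).prod
      (isCompact_Icc.prod isCompact_Icc)))
  obtain ⟨h₀, h0, H⟩ := uniform_second_diff (hΦs.of_le (by norm_cast)) hKK hδ
  refine ⟨h₀, h0, fun s hs0 hs x hx ξ v hξ hv μ hμ η hη => ?_⟩
  obtain ⟨b, hb⟩ := h.second_variation ht x ξ (η • v) (μ • v - η • h.Γx x t ξ *ᵥ v)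
  have := H s hs0 hs (x, ξ, v, μ, η) ⟨hx, by simpa using hξ, by simpa using hv, abs_le.1 hμ, hη⟩
    _ _ _ hb
  have e1 : μ • v - η • h.Γx x t ξ *ᵥ v + h.Γx x t (η • v) *ᵥ ξ = μ • v := by
    rw [h.Γx_comm x t (η • v) ξ, Matrix.mulVec_smul]
    simp
  have e2 : h.Rx x t (η • v) ξ *ᵥ (η • v) = η ^ 2 • (h.Rx x t v ξ *ᵥ v) := by
    have : h.Rx x t (η • v) ξ = η • h.Rx x t v ξ := by
      rw [h.Rx_eq ht, h.Rx_eq ht, Finset.smul_sum]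
      refine Finset.sum_congr rfl fun p _ => ?_
      rw [Finset.smul_sum]
      refine Finset.sum_congr rfl fun q _ => ?_
      rw [smul_smul]; simp [mul_assoc]
    rw [this, Matrix.mulVec_smul, Matrix.smul_mulVec, smul_smul, sq]
  rw [e1, e2, nq_smul, nb_smul_right] at this
  have := (abs_le.1 this).2
  simp only [hΦ, vq_zero] at this
  linarith

end IsRFOn

end RFlow

namespace RFlow

variable {g : (Fin n → ℝ) → ℝ → Matrix (Fin n) (Fin n) ℝ} {T : ℝ}

theorem sqrt_le_tangent {S Y : ℝ} (hS : 0 < S) (hY : 0 ≤ Y) :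
    √Y ≤ S + (Y - S ^ 2) / (2 * S) := by
  rw [Real.sqrt_le_left (by
    have : S + (Y - S ^ 2) / (2 * S) = (S ^ 2 + Y) / (2 * S) := by field_simp; ring
    rw [this]; positivity)]
  have : S + (Y - S ^ 2) / (2 * S) = (S ^ 2 + Y) / (2 * S) := by field_simp; ring
  rw [this, div_pow, le_div_iff₀ (by positivity)]
  nlinarith [sq_nonneg (S ^ 2 - Y)]

namespace IsRFOn

open scoped Topology

variable (h : IsRFOn g T)

theorem uniform_nq_time {t : ℝ} (ht : t ∈ Icc 0 T) {K : Set (Fin n → ℝ)}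
    (hK : IsCompact K) {δ : ℝ} (hδ : 0 < δ) : ∃ ε > 0, ∀ s, 0 < s → s < ε → s ≤ t → ∀ x ∈ K, ∀ ξ,
      nq (g x (t - s)) ξ ≤ nq (g x t) ξ + 2 * s * nq (h.rc x t) ξ + δ * s * ‖ξ‖ ^ 2 := by
  set δ' := δ / (n ^ 2 + 1) with hδ'
  have hd0 : 0 < δ' := by positivity
  have H : ∀ᶠ s in 𝓝[>] (0:ℝ), ∀ i j, s ≤ t → ∀ x ∈ K,
      |g x (t - s) i j - g x t i j - 2 * s * h.rc x t i j| ≤ δ' * s := by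
    rw [Filter.eventually_all]; intro i
    rw [Filter.eventually_all]; intro j
    obtain ⟨ε, e0, hε⟩ := h.uniform_time (h.G i j) ht hK hd0
    filter_upwards [Ioo_mem_nhdsGT e0] with s hs hst x hx
    have := hε s hs.1.le hs.2 hst x hx
    have e : extS (h.d none (h.G i j)) (x, t) = -(2 * h.rc x t i j) := by
      rw [h.dG_none, rc, Matrix.of_apply, extS_apply _ (mem_slab ht), extS_apply _ (mem_slab ht)]
      rw [map_neg, map_mul]; congr 2
    rw [e, extS_apply _ (mem_slab ht), extS_apply _ (mem_slab ⟨by linarith, by linarith [ht.2, hs.1]⟩),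
      h.ev_G, h.ev_G] at this
    convert this using 2; ring
  rw [Filter.Eventually, mem_nhdsGT_iff_exists_Ioo_subset] at H
  obtain ⟨ε, e0, hε⟩ := H
  refine ⟨ε, e0, fun s hs0 hs hst x hx ξ => ?_⟩
  have hb := fun i j => hε ⟨hs0, hs⟩ i j hst x hx
  have e : nq (g x (t - s)) ξ - nq (g x t) ξ - 2 * s * nq (h.rc x t) ξ =
      ∑ i, ∑ j, (g x (t - s) i j - g x t i j - 2 * s * h.rc x t i j) * ξ i * ξ j := by
    simp only [nq, Finset.mul_sum, ← Finset.sum_sub_distrib]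
    exact Finset.sum_congr rfl fun i _ => Finset.sum_congr rfl fun j _ => by ring
  have b : ∑ i, ∑ j, (g x (t - s) i j - g x t i j - 2 * s * h.rc x t i j) * ξ i * ξ j ≤
      ∑ _i : Fin n, ∑ _j : Fin n, δ' * s * ‖ξ‖ ^ 2 := by
    refine Finset.sum_le_sum fun i _ => Finset.sum_le_sum fun j _ => ?_
    refine (le_abs_self _).trans ?_
    rw [abs_mul, abs_mul, mul_assoc, sq]
    have h1 := norm_le_pi_norm ξ i
    have h2 := norm_le_pi_norm ξ j
    rw [Real.norm_eq_abs] at h1 h2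
    gcongr
    exact hb i j
  have : (n:ℝ) * (n * (δ' * s * ‖ξ‖ ^ 2)) ≤ δ * s * ‖ξ‖ ^ 2 := by
    have : (n:ℝ) ^ 2 * δ' ≤ δ := by
      rw [hδ', mul_div_assoc', div_le_iff₀ (by positivity)]
      nlinarith
    have h3 : 0 ≤ s * ‖ξ‖ ^ 2 := by positivity
    nlinarith
  simp only [Finset.sum_const, Finset.card_univ, Fintype.card_fin, nsmul_eq_mul] at b
  linarith

set_option maxHeartbeats 1000000 in
/-- Pointwise second order variation inequality for the integrand `√(λ² + |ξ|²)`, uniform on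
compact sets. -/
theorem pointwise_variation {t : ℝ} (ht : t ∈ Ioc 0 T) {K : Set (Fin n → ℝ)} (hK : IsCompact K)
    {lam : ℝ} (hl : 0 < lam) (M : ℝ) {δ : ℝ} (hδ : 0 < δ) :
    ∃ h₀ > 0, ∀ s, 0 < s → s < h₀ → s ^ 2 ≤ t ∧ ∀ x ∈ K, ∀ (ξ : Fin n → ℝ)
      (P : Matrix (Fin n) (Fin n) ℝ), Pᵀ * g x t * P = 1 → ∀ η ∈ Icc (0:ℝ) 1, ∀ μ S : ℝ,
      S = √(lam ^ 2 + nq (g x t) ξ) → |μ| ≤ M * S →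
      ∑ a, (√(lam ^ 2 + h.vq t x ξ (η • Pᵀ a) (μ • Pᵀ a - η • h.Γx x t ξ *ᵥ Pᵀ a) s)
        + √(lam ^ 2 + h.vq t x ξ (η • Pᵀ a) (μ • Pᵀ a - η • h.Γx x t ξ *ᵥ Pᵀ a) (-s)) - 2 * S)
        + (√(lam ^ 2 + nq (g x (t - s ^ 2)) ξ) - S)
        ≤ s ^ 2 * ((n * μ ^ 2 + (1 - η ^ 2) * nq (h.rc x t) ξ) / S + δ * S) := by
  have ht' : t ∈ Icc 0 T := ⟨ht.1.le, ht.2⟩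
  obtain ⟨c, c0, hc⟩ := h.metric_lower hK
  set B := c⁻¹ + 1 with hB
  have hB0 : 0 < B := by positivity
  have hnorm : ∀ x ∈ K, ∀ v, nq (g x t) v ≤ 1 → ‖v‖ ≤ B := by
    intro x hx v hv
    have h1 := hc x hx t ht' v
    have h2 : 1 ≤ c * B ^ 2 := by
      have : c * B ^ 2 = c⁻¹ + 2 + c := by rw [hB]; field_simp; ring
      rw [this]; have := inv_pos.2 c0; linarith
    have h3 : c * ‖v‖ ^ 2 ≤ c * B ^ 2 := by linarith
    exact (abs_le_of_sq_le_sq' (le_of_mul_le_mul_left h3 c0) hB0.le).2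
  set δ1 := δ / (n + 1) with hδ1
  set δ2 := δ / (B ^ 2 + 1) with hδ2
  have hd1 : 0 < δ1 := by positivity
  have hd2 : 0 < δ2 := by positivity
  obtain ⟨h₁, h10, H1⟩ := h.uniform_vq ht' hK B M hd1
  obtain ⟨ε, e0, H2⟩ := h.uniform_nq_time ht' hK hd2
  refine ⟨min h₁ (min (√ε) (√t)), lt_min h10 (lt_min (Real.sqrt_pos.2 e0) (Real.sqrt_pos.2 ht.1)),
    fun s hs0 hs => ?_⟩
  have hs1 : s < h₁ := hs.trans_le (min_le_left _ _)
  have hs2 : s ^ 2 < ε :=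
    (Real.lt_sqrt hs0.le).1 (hs.trans_le ((min_le_right _ _).trans (min_le_left _ _)))
  have hs3 : s ^ 2 < t :=
    (Real.lt_sqrt hs0.le).1 (hs.trans_le ((min_le_right _ _).trans (min_le_right _ _)))
  refine ⟨hs3.le, fun x hx ξ P hP η hη μ S hS hμ => ?_⟩
  have hpos := (h.smooth.2 x t ht').2
  have hts : t - s ^ 2 ∈ Icc 0 T := ⟨by linarith, by linarith [ht.2, sq_nonneg s]⟩
  have hq0 := nq_nonneg hpos ξ
  have hS2 : S ^ 2 = lam ^ 2 + nq (g x t) ξ := by rw [hS, Real.sq_sqrt (by positivity)]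
  have hS0 : 0 < S := by rw [hS]; exact Real.sqrt_pos.2 (by positivity)
  set ξ' := S⁻¹ • ξ with hξ'
  have eξ : ξ = S • ξ' := by rw [hξ', smul_smul, mul_inv_cancel₀ hS0.ne', one_smul]
  have nξ : ‖ξ'‖ ≤ B := by
    refine hnorm x hx _ ?_
    rw [hξ', nq_smul, inv_pow, inv_mul_le_iff₀ (by positivity)]
    nlinarith
  have nP : ∀ a, nq (g x t) (Pᵀ a) = 1 := by
    intro a
    have := congrFun (congrFun hP a) a
    rw [Matrix.one_apply_eq, Matrix.mul_assoc] at this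
    rw [← this, nq_eq, nb]
    simp only [Matrix.mul_apply, dotProduct, Matrix.mulVec, Matrix.transpose_apply]
  set μ' := S⁻¹ * μ with hμ'
  have eμ : μ = S * μ' := by rw [hμ', ← mul_assoc, mul_inv_cancel₀ hS0.ne', one_mul]
  have nμ : |μ'| ≤ M := by
    rw [hμ', abs_mul, abs_of_pos (inv_pos.2 hS0), inv_mul_le_iff₀ hS0]
    linarith
  have hWs : ∀ a, μ • Pᵀ a - η • h.Γx x t ξ *ᵥ Pᵀ a
      = S • (μ' • Pᵀ a - η • h.Γx x t ξ' *ᵥ Pᵀ a) := by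
    intro a
    rw [eμ, eξ, h.Γx_comm, h.Γx_comm x t ξ', Matrix.mulVec_smul, smul_sub, smul_smul, smul_smul,
      smul_smul, mul_comm η]
  have ev : ∀ a s, h.vq t x ξ (η • Pᵀ a) (μ • Pᵀ a - η • h.Γx x t ξ *ᵥ Pᵀ a) s
      = S ^ 2 * h.vq t x ξ' (η • Pᵀ a) (μ' • Pᵀ a - η • h.Γx x t ξ' *ᵥ Pᵀ a) s := by
    intro a s
    rw [hWs, ← vq_smul, ← eξ]
  have hR : ∑ a, nb (g x t) ξ' (h.Rx x t (Pᵀ a) ξ' *ᵥ Pᵀ a) = -nq (h.rc x t) ξ' :=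
    h.sum_Rx ht' x ξ' hP
  have hvn : ∀ a s, 0 ≤ lam ^ 2 + h.vq t x ξ (η • Pᵀ a) (μ • Pᵀ a - η • h.Γx x t ξ *ᵥ Pᵀ a) s :=
    fun a s => add_nonneg (sq_nonneg _) (nq_nonneg (h.smooth.2 _ t ht').2 _)
  have eq1 : nq (g x t) ξ = S ^ 2 * nq (g x t) ξ' := by rw [← nq_smul, ← eξ]
  have eq2 : nq (h.rc x t) ξ = S ^ 2 * nq (h.rc x t) ξ' := by rw [← nq_smul, ← eξ]
  have hl2 : lam ^ 2 = S ^ 2 - S ^ 2 * nq (g x t) ξ' := by linarith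
  have A : ∀ a, √(lam ^ 2 + h.vq t x ξ (η • Pᵀ a) (μ • Pᵀ a - η • h.Γx x t ξ *ᵥ Pᵀ a) s)
      + √(lam ^ 2 + h.vq t x ξ (η • Pᵀ a) (μ • Pᵀ a - η • h.Γx x t ξ *ᵥ Pᵀ a) (-s)) - 2 * S
      ≤ s ^ 2 * S * (μ' ^ 2 + η ^ 2 * nb (g x t) ξ' (h.Rx x t (Pᵀ a) ξ' *ᵥ Pᵀ a))
        + δ1 * s ^ 2 * S / 2 := by
    intro a
    have k1 := sqrt_le_tangent hS0 (hvn a s)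
    have k2 := sqrt_le_tangent hS0 (hvn a (-s))
    have k3 := H1 s hs0.le hs1 x hx ξ' (Pᵀ a) nξ (hnorm x hx _ (nP a).le) μ' nμ η hη
    rw [nP, mul_one] at k3
    refine (sub_le_sub_right (add_le_add k1 k2) _).trans ?_
    rw [ev, ev]
    have e : ∀ A B : ℝ, S + (lam ^ 2 + S ^ 2 * A - S ^ 2) / (2 * S)
        + (S + (lam ^ 2 + S ^ 2 * B - S ^ 2) / (2 * S)) - 2 * S
        = S / 2 * (A + B - 2 * nq (g x t) ξ') := by
      intro A B; rw [hl2]; field_simp; ring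
    rw [e]
    refine (mul_le_mul_of_nonneg_left k3 (by positivity)).trans (le_of_eq ?_)
    ring
  have Bt : √(lam ^ 2 + nq (g x (t - s ^ 2)) ξ) - S
      ≤ s ^ 2 * S * nq (h.rc x t) ξ' + δ2 * B ^ 2 * s ^ 2 * S / 2 := by
    have k1 := sqrt_le_tangent hS0 (Y := lam ^ 2 + nq (g x (t - s ^ 2)) ξ)
      (add_nonneg (sq_nonneg _) (nq_nonneg (h.smooth.2 _ _ hts).2 _))
    have k2 := H2 (s ^ 2) (by positivity) hs2 hs3.le x hx ξ'
    have k3 : δ2 * s ^ 2 * ‖ξ'‖ ^ 2 ≤ δ2 * s ^ 2 * B ^ 2 := by gcongr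
    have eq3 : nq (g x (t - s ^ 2)) ξ = S ^ 2 * nq (g x (t - s ^ 2)) ξ' := by rw [← nq_smul, ← eξ]
    have : √(lam ^ 2 + nq (g x (t - s ^ 2)) ξ) - S
        ≤ S / 2 * (nq (g x (t - s ^ 2)) ξ' - nq (g x t) ξ') := by
      refine (sub_le_sub_right k1 _).trans (le_of_eq ?_)
      rw [eq3, hl2]; field_simp; ring
    refine this.trans ?_
    refine (mul_le_mul_of_nonneg_left (a := S / 2)
      (show _ ≤ 2 * s ^ 2 * nq (h.rc x t) ξ' + δ2 * s ^ 2 * B ^ 2 by linarith)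
      (by positivity)).trans (le_of_eq ?_)
    ring
  refine (add_le_add (Finset.sum_le_sum fun a _ => A a) Bt).trans ?_
  rw [Finset.sum_add_distrib, ← Finset.mul_sum, Finset.sum_add_distrib, ← Finset.mul_sum, hR]
  simp only [Finset.sum_const, Finset.card_univ, Fintype.card_fin, nsmul_eq_mul]
  rw [eq2, eμ]
  have e1 : (n * (S * μ') ^ 2 + (1 - η ^ 2) * (S ^ 2 * nq (h.rc x t) ξ')) / S
      = S * (n * μ' ^ 2 + (1 - η ^ 2) * nq (h.rc x t) ξ') := by field_simp
  rw [e1]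
  have d1 : n * δ1 ≤ δ := by
    rw [hδ1, mul_div_assoc', div_le_iff₀ (by positivity)]; nlinarith
  have d2 : δ2 * B ^ 2 ≤ δ := by
    rw [hδ2, div_mul_eq_mul_div, div_le_iff₀ (by positivity)]; nlinarith
  have hs2S : 0 ≤ s ^ 2 * S := by positivity
  nlinarith [mul_le_mul_of_nonneg_left d1 hs2S, mul_le_mul_of_nonneg_left d2 hs2S]

end IsRFOn

end RFlow

namespace RFlow

section LinearODE

/-- Coordinatewise truncation at height `R`. -/
def clampV (R : ℝ) (x : Fin n → ℝ) : Fin n → ℝ := fun i => max (-R) (min R (x i))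

theorem clampV_le {R : ℝ} (hR : 0 ≤ R) (x : Fin n → ℝ) : ‖clampV R x‖ ≤ R := by
  refine (pi_norm_le_iff_of_nonneg hR).2 fun i => ?_
  rw [Real.norm_eq_abs, abs_le]
  exact ⟨le_max_left _ _, max_le (by linarith) (min_le_left _ _)⟩

theorem clampV_le_self {R : ℝ} (hR : 0 ≤ R) (x : Fin n → ℝ) : ‖clampV R x‖ ≤ ‖x‖ := by
  refine (pi_norm_le_iff_of_nonneg (norm_nonneg _)).2 fun i => ?_
  have h1 := norm_le_pi_norm x i
  refine le_trans ?_ h1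
  simp only [Real.norm_eq_abs, clampV]
  rcases le_total R (x i) with h | h
  · rw [min_eq_left h, max_eq_right (by linarith), abs_of_nonneg hR]
    exact h.trans (le_abs_self _)
  · rw [min_eq_right h]
    rcases le_total (-R) (x i) with h' | h'
    · rw [max_eq_right h']
    · rw [max_eq_left h', abs_neg, abs_of_nonneg hR]
      linarith [neg_le_abs (x i)]

theorem clampV_sub_le (R : ℝ) (x y : Fin n → ℝ) : ‖clampV R x - clampV R y‖ ≤ ‖x - y‖ := by
  refine (pi_norm_le_iff_of_nonneg (norm_nonneg _)).2 fun i => ?_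
  refine le_trans ?_ (norm_le_pi_norm (x - y) i)
  simp only [Real.norm_eq_abs, clampV, Pi.sub_apply]
  have h1 := abs_max_sub_max_le_abs (min R (x i)) (min R (y i)) (-R)
  have h2 := abs_min_sub_min_le_max R (x i) R (y i)
  rw [max_comm _ (-R), max_comm _ (-R)] at h1
  simp only [sub_self, abs_zero] at h2
  exact h1.trans (h2.trans (by simp))

theorem clampV_of_le {R : ℝ} {x : Fin n → ℝ} (hx : ‖x‖ ≤ R) : clampV R x = x := by
  ext i
  have := abs_le.1 ((norm_le_pi_norm x i).trans hx)
  rw [clampV, min_eq_right this.2, max_eq_right this.1]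

theorem norm_mulVec_le {a : ℝ} {A : Matrix (Fin n) (Fin n) ℝ} (ha0 : 0 ≤ a) (hA : ∀ i j, |A i j| ≤ a)
    (x : Fin n → ℝ) : ‖A *ᵥ x‖ ≤ n * a * ‖x‖ := by
  refine (pi_norm_le_iff_of_nonneg (by positivity)).2 fun i => ?_
  rw [Matrix.mulVec, dotProduct]
  refine (norm_sum_le _ _).trans ?_
  have : ∀ j ∈ Finset.univ, ‖A i j * x j‖ ≤ a * ‖x‖ := fun j _ => by
    rw [norm_mul]
    exact mul_le_mul (hA i j) (norm_le_pi_norm x j) (norm_nonneg _) ha0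
  refine (Finset.sum_le_sum this).trans (le_of_eq ?_)
  simp [mul_assoc]

/-- Linear ordinary differential equations are solvable on the whole interval. -/
theorem exists_linear_ode {A : ℝ → Matrix (Fin n) (Fin n) ℝ}
    (hA : ∀ i j, ContinuousOn (fun s => A s i j) (Icc 0 1)) (v₀ : Fin n → ℝ) :
    ∃ v : ℝ → Fin n → ℝ, v 0 = v₀ ∧ ∀ s ∈ Icc (0:ℝ) 1,
      HasDerivWithinAt v (A s *ᵥ v s) (Icc 0 1) s := by
  obtain ⟨a, ha0, ha⟩ : ∃ a, 0 ≤ a ∧ ∀ s ∈ Icc (0:ℝ) 1, ∀ i j, |A s i j| ≤ a := by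
    have hc : ContinuousOn (fun s => ∑ i, ∑ j, |A s i j|) (Icc 0 1) :=
      continuousOn_finsetSum _ fun i _ => continuousOn_finsetSum _ fun j _ => (hA i j).abs
    obtain ⟨a, ha⟩ := isCompact_Icc.bddAbove_image hc
    have hb : ∀ s ∈ Icc (0:ℝ) 1, ∑ i, ∑ j, |A s i j| ≤ a := fun s hs => ha ⟨s, hs, rfl⟩
    have hn : ∀ s i, 0 ≤ ∑ j, |A s i j| := fun s i => Finset.sum_nonneg fun j _ => abs_nonneg _
    refine ⟨a, (Finset.sum_nonneg fun i _ => hn 0 i).trans (hb 0 (by simp)), fun s hs i j => ?_⟩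
    refine le_trans ?_ (hb s hs)
    exact (Finset.single_le_sum (f := fun j => |A s i j|) (fun j _ => abs_nonneg _)
      (Finset.mem_univ j)).trans (Finset.single_le_sum (f := fun i => ∑ j, |A s i j|)
      (fun i _ => hn s i) (Finset.mem_univ i))
  set k := (n:ℝ) * a with hk
  have hk0 : 0 ≤ k := by positivity
  set R := ‖v₀‖ * Real.exp k with hR
  have hR0 : 0 ≤ R := by positivity
  have hlip : ∀ s ∈ Icc (0:ℝ) 1, ∀ x y : Fin n → ℝ,
      ‖A s *ᵥ clampV R x - A s *ᵥ clampV R y‖ ≤ k * ‖x - y‖ := by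
    intro s hs x y
    rw [← Matrix.mulVec_sub]
    refine (norm_mulVec_le ha0 (ha s hs) _).trans ?_
    exact mul_le_mul_of_nonneg_left (clampV_sub_le R x y) hk0
  have hPL : IsPicardLindelof (fun s x => A s *ᵥ clampV R x) (tmin := 0) (tmax := 1)
      ⟨0, by simp⟩ v₀ ⟨k * R, by positivity⟩ 0 ⟨k * R, by positivity⟩ ⟨k, hk0⟩ := by
    refine ⟨fun s hs => ?_, fun x _ => ?_, fun s hs x _ => ?_, ?_⟩
    · refine (LipschitzWith.of_dist_le_mul fun x y => ?_).lipschitzOnWith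
      rw [dist_eq_norm, dist_eq_norm]
      exact hlip s hs x y
    · refine continuousOn_pi.2 fun i => ?_
      simp only [Matrix.mulVec, dotProduct]
      exact continuousOn_finsetSum _ fun j _ => (hA i j).mul continuousOn_const
    · refine (norm_mulVec_le ha0 (ha s hs) _).trans ?_
      exact mul_le_mul_of_nonneg_left (clampV_le hR0 x) hk0
    · simp
  obtain ⟨v, hv0, hv⟩ := hPL.exists_eq_forall_mem_Icc_hasDerivWithinAt₀
  refine ⟨v, hv0, fun s hs => ?_⟩
  have hbound : ∀ s ∈ Icc (0:ℝ) 1, ‖v s‖ ≤ gronwallBound ‖v₀‖ k 0 (s - 0) := by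
    refine norm_le_gronwallBound_of_norm_deriv_right_le
      (f' := fun s => A s *ᵥ clampV R (v s)) (fun s hs => (hv s hs).continuousWithinAt)
      (fun s hs => ?_) (by rw [hv0]) (fun s hs => ?_)
    · refine (hv s ⟨hs.1, hs.2.le⟩).mono_of_mem_nhdsWithin ?_
      exact mem_nhdsWithin.2 ⟨Iio 1, isOpen_Iio, hs.2, fun y hy => ⟨hs.1.trans hy.2, hy.1.le⟩⟩
    · rw [add_zero]
      refine (norm_mulVec_le ha0 (ha s ⟨hs.1, hs.2.le⟩) _).trans ?_
      exact mul_le_mul_of_nonneg_left (clampV_le_self hR0 _) hk0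
  have hvR : ‖v s‖ ≤ R := by
    refine (hbound s hs).trans ?_
    rw [gronwallBound_ε0, sub_zero, hR]
    gcongr
    nlinarith [hs.2]
  have := hv s hs
  rwa [clampV_of_le hvR] at this

end LinearODE

/-- A `C¹` path on `[0,1]` with its velocity. -/
def IsPath (γ γ' : ℝ → Fin n → ℝ) : Prop :=
  (∀ s ∈ Icc (0:ℝ) 1, HasDerivWithinAt γ (γ' s) (Icc 0 1) s) ∧ ContinuousOn γ' (Icc 0 1)

theorem IsPath.continuousOn {γ γ' : ℝ → Fin n → ℝ} (hγ : IsPath γ γ') : ContinuousOn γ (Icc 0 1) :=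
  fun s hs => (hγ.1 s hs).continuousWithinAt

theorem hasDerivWithinAt_nb {G : ℝ → Matrix (Fin n) (Fin n) ℝ} {v w : ℝ → Fin n → ℝ}
    {G' : Matrix (Fin n) (Fin n) ℝ} {v' w' : Fin n → ℝ} {D : Set ℝ} {s : ℝ}
    (hG : ∀ i j, HasDerivWithinAt (fun s => G s i j) (G' i j) D s)
    (hv : HasDerivWithinAt v v' D s) (hw : HasDerivWithinAt w w' D s) :
    HasDerivWithinAt (fun s => nb (G s) (v s) (w s))
      (nb G' (v s) (w s) + nb (G s) v' (w s) + nb (G s) (v s) w') D s := by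
  have hv' := hasDerivWithinAt_pi.1 hv
  have hw' := hasDerivWithinAt_pi.1 hw
  simp only [nb_eq_sum, ← Finset.sum_add_distrib]
  refine HasDerivWithinAt.fun_sum fun i _ => HasDerivWithinAt.fun_sum fun j _ => ?_
  refine (((hG i j).mul (hv' i)).mul (hw' j)).congr_deriv ?_
  simp only [Pi.mul_apply]
  ring

variable {g : (Fin n → ℝ) → ℝ → Matrix (Fin n) (Fin n) ℝ} {T : ℝ}

namespace IsRFOn

variable (h : IsRFOn g T)

include h in
theorem g_curve {t : ℝ} (ht : t ∈ Icc 0 T) {c : ℝ → Fin n → ℝ} {c' : Fin n → ℝ} {D : Set ℝ} {s : ℝ}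
    (hc : HasDerivWithinAt c c' D s) (i j : Fin n) :
    HasDerivWithinAt (fun s => g (c s) t i j)
      (((h.Γx (c s) t c')ᵀ * g (c s) t + g (c s) t * h.Γx (c s) t c') i j) D s := by
  have h1 := (slice_hasFDerivAt (h.G i j) ht (x := c s)).comp_hasDerivWithinAt s hc
  rw [← h.map_dG ht]
  have e : ((fun y => extS (h.G i j) (y, t)) ∘ c) = fun s => g (c s) t i j := by
    funext s; rw [Function.comp, extS_apply _ (mem_slab ht), h.ev_G]
  rw [e] at h1
  refine h1.congr_deriv ?_
  rw [Matrix.map_apply, dMat_apply, dV, evS_dirD]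
  simp

/-- Parallel frames along paths. -/
theorem exists_parallel_frame {t : ℝ} (ht : t ∈ Icc 0 T) {γ γ' : ℝ → Fin n → ℝ} (hγ : IsPath γ γ')
    {E : Matrix (Fin n) (Fin n) ℝ} (hE : Eᵀ * g (γ 1) t * E = 1) :
    ∃ P : ℝ → Matrix (Fin n) (Fin n) ℝ, P 1 = E ∧
      (∀ s ∈ Icc (0:ℝ) 1, ∀ a, HasDerivWithinAt (fun s => (P s)ᵀ a)
        (-(h.Γx (γ s) t (γ' s) *ᵥ (P s)ᵀ a)) (Icc 0 1) s) ∧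
      ∀ s ∈ Icc (0:ℝ) 1, (P s)ᵀ * g (γ s) t * P s = 1 := by
  have hrev : MapsTo (fun s : ℝ => 1 - s) (Icc 0 1) (Icc 0 1) := fun s hs =>
    ⟨by linarith [hs.2], by linarith [hs.1]⟩
  have hΓc : ∀ i j, ContinuousOn (fun s => h.Γx (γ s) t (γ' s) i j) (Icc 0 1) := by
    intro i j
    have hc := (h.contDiff_Γx (X := (Fin n → ℝ) × (Fin n → ℝ)) ht contDiff_fst contDiff_snd i
      j).continuous
    exact hc.comp_continuousOn (hγ.continuousOn.prodMk hγ.2)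
  have hAc : ∀ i j, ContinuousOn (fun s => h.Γx (γ (1 - s)) t (γ' (1 - s)) i j) (Icc 0 1) :=
    fun i j => (hΓc i j).comp (by fun_prop) hrev
  choose v hv0 hv using fun a => exists_linear_ode hAc (Eᵀ a)
  set P : ℝ → Matrix (Fin n) (Fin n) ℝ := fun s => (Matrix.of fun a => v a (1 - s))ᵀ with hP
  have hPa : ∀ s a, (P s)ᵀ a = v a (1 - s) := fun s a => rfl
  have hd : ∀ s ∈ Icc (0:ℝ) 1, ∀ a, HasDerivWithinAt (fun s => (P s)ᵀ a)
        (-(h.Γx (γ s) t (γ' s) *ᵥ (P s)ᵀ a)) (Icc 0 1) s := by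
    intro s hs a
    simp only [hPa]
    have h1 := hv a (1 - s) (hrev hs)
    have h2 : HasDerivWithinAt (fun s : ℝ => 1 - s) (-1) (Icc 0 1) s :=
      ((hasDerivAt_id s).const_sub 1).hasDerivWithinAt
    have := h1.scomp s h2 hrev
    rw [sub_sub_cancel, neg_one_smul] at this
    exact this
  refine ⟨P, ?_, hd, fun s hs => ?_⟩
  · ext i a
    have := congrFun (hv0 a) i
    simpa [hP] using this
  · have key : ∀ a b, nb (g (γ s) t) ((P s)ᵀ a) ((P s)ᵀ b) = nb (g (γ 1) t) ((P 1)ᵀ a) ((P 1)ᵀ b) := by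
      intro a b
      have hder : ∀ r ∈ Icc (0:ℝ) 1, HasDerivWithinAt
          (fun s => nb (g (γ s) t) ((P s)ᵀ a) ((P s)ᵀ b)) 0 (Icc 0 1) r := by
        intro r hr
        refine (hasDerivWithinAt_nb (h.g_curve ht (hγ.1 r hr)) (hd r hr a) (hd r hr b)).congr_deriv ?_
        rw [nb_add_mat, nb_transpose_mul, nb_mul_right]
        rw [← neg_one_smul ℝ, ← neg_one_smul ℝ (h.Γx (γ r) t (γ' r) *ᵥ (P r)ᵀ b), nb_smul_left,
          nb_smul_right]
        ring
      have hc := constant_of_has_deriv_right_zero (fun r hr => (hder r hr).continuousWithinAt)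
        (fun r hr => (hder r ⟨hr.1, hr.2.le⟩).mono_of_mem_nhdsWithin
          (mem_nhdsWithin.2 ⟨Iio 1, isOpen_Iio, hr.2, fun y hy => ⟨hr.1.trans hy.2, hy.1.le⟩⟩))
      rw [hc s hs, hc 1 (by simp)]
    have e : ∀ s a b, ((P s)ᵀ * g (γ s) t * P s) a b = nb (g (γ s) t) ((P s)ᵀ a) ((P s)ᵀ b) := by
      intro s a b
      rw [Matrix.mul_assoc, nb]
      simp only [Matrix.mul_apply, dotProduct, Matrix.mulVec, Matrix.transpose_apply]
    have hP1 : P 1 = E := by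
      ext i a
      have := congrFun (hv0 a) i
      simpa [hP] using this
    ext a b
    rw [e, key, ← e, hP1, hE]

end IsRFOn

end RFlow

namespace RFlow

variable {g : (Fin n → ℝ) → ℝ → Matrix (Fin n) (Fin n) ℝ} {T : ℝ}

/-- The regularized integrand `√(λ² + |γ'|²)`. -/
def spd (g : (Fin n → ℝ) → ℝ → Matrix (Fin n) (Fin n) ℝ) (t lam : ℝ) (γ γ' : ℝ → Fin n → ℝ)
    (s : ℝ) : ℝ :=
  √(lam ^ 2 + nq (g (γ s) t) (γ' s))

/-- The regularized length of a path. -/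
def len (g : (Fin n → ℝ) → ℝ → Matrix (Fin n) (Fin n) ℝ) (t lam : ℝ) (γ γ' : ℝ → Fin n → ℝ) : ℝ :=
  ∫ s in (0:ℝ)..1, spd g t lam γ γ' s

/-- The regularized distance function. -/
def act (g : (Fin n → ℝ) → ℝ → Matrix (Fin n) (Fin n) ℝ) (lam : ℝ) (x₁ : Fin n → ℝ) (t : ℝ)
    (x : Fin n → ℝ) : ℝ :=
  sInf {L | ∃ γ γ', IsPath γ γ' ∧ γ 0 = x₁ ∧ γ 1 = x ∧ L = len g t lam γ γ'}

theorem len_nonneg (t lam : ℝ) (γ γ' : ℝ → Fin n → ℝ) : 0 ≤ len g t lam γ γ' :=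
  intervalIntegral.integral_nonneg zero_le_one fun _ _ => Real.sqrt_nonneg _

theorem act_le {lam t : ℝ} {γ γ' : ℝ → Fin n → ℝ} (hγ : IsPath γ γ') :
    act g lam (γ 0) t (γ 1) ≤ len g t lam γ γ' :=
  csInf_le ⟨0, by rintro _ ⟨γ, γ', -, -, -, rfl⟩; exact len_nonneg _ _ _ _⟩
    ⟨γ, γ', hγ, rfl, rfl, rfl⟩

theorem isPath_segment (x y : Fin n → ℝ) : IsPath (fun s => x + s • (y - x)) fun _ => y - x := by
  refine ⟨fun s _ => ?_, continuousOn_const⟩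
  have := ((hasDerivAt_id s).smul_const (y - x)).const_add x
  rw [one_smul] at this
  exact this.hasDerivWithinAt

theorem act_nonneg (lam : ℝ) (x₁ : Fin n → ℝ) (t : ℝ) (x : Fin n → ℝ) : 0 ≤ act g lam x₁ t x :=
  Real.sInf_nonneg (by rintro _ ⟨γ, γ', -, -, -, rfl⟩; exact len_nonneg _ _ _ _)

theorem exists_len_lt {lam : ℝ} {x₁ : Fin n → ℝ} {t : ℝ} {x : Fin n → ℝ} {b : ℝ}
    (hb : act g lam x₁ t x < b) :
    ∃ γ γ', IsPath γ γ' ∧ γ 0 = x₁ ∧ γ 1 = x ∧ len g t lam γ γ' < b := by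
  have hne : {L | ∃ γ γ', IsPath γ γ' ∧ γ 0 = x₁ ∧ γ 1 = x ∧ L = len g t lam γ γ'}.Nonempty :=
    ⟨_, fun s => x₁ + s • (x - x₁), fun _ => x - x₁, isPath_segment x₁ x, by simp, by simp, rfl⟩
  obtain ⟨L, ⟨γ, γ', h1, h2, h3, rfl⟩, h4⟩ := exists_lt_of_csInf_lt hne hb
  exact ⟨γ, γ', h1, h2, h3, h4⟩

namespace IsRFOn

open scoped ContDiff

variable (h : IsRFOn g T)

include h in
theorem spd_continuousOn {t : ℝ} (ht : t ∈ Icc 0 T) (lam : ℝ) {γ γ' : ℝ → Fin n → ℝ}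
    (hγ : IsPath γ γ') : ContinuousOn (spd g t lam γ γ') (Icc 0 1) := by
  refine (continuousOn_const.add ?_).sqrt
  exact continuous_nq (fun i j => (h.contDiff_g ht i j).continuous.comp_continuousOn
    hγ.continuousOn) hγ.2

include h in
theorem spd_intervalIntegrable {t : ℝ} (ht : t ∈ Icc 0 T) (lam : ℝ) {γ γ' : ℝ → Fin n → ℝ}
    (hγ : IsPath γ γ') : IntervalIntegrable (spd g t lam γ γ') volume 0 1 :=
  ContinuousOn.intervalIntegrable (by
    rw [uIcc_of_le zero_le_one]; exact h.spd_continuousOn ht lam hγ)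

include h in
theorem spd_sq {t : ℝ} (ht : t ∈ Icc 0 T) (lam : ℝ) (γ γ' : ℝ → Fin n → ℝ) (s : ℝ) :
    spd g t lam γ γ' s ^ 2 = lam ^ 2 + nq (g (γ s) t) (γ' s) :=
  Real.sq_sqrt (add_nonneg (sq_nonneg _) (nq_nonneg (h.smooth.2 _ t ht).2 _))

include h in
theorem le_spd {t : ℝ} (ht : t ∈ Icc 0 T) (lam : ℝ) (γ γ' : ℝ → Fin n → ℝ) (s : ℝ) :
    lam ≤ spd g t lam γ γ' s := by
  refine (le_abs_self _).trans (Real.abs_le_sqrt ?_)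
  linarith [nq_nonneg (h.smooth.2 (γ s) t ht).2 (γ' s)]

theorem Γx_curve {t : ℝ} (ht : t ∈ Icc 0 T) {c V : ℝ → Fin n → ℝ} {c' V' : Fin n → ℝ} {D : Set ℝ}
    {s : ℝ} (hc : HasDerivWithinAt c c' D s) (hV : HasDerivWithinAt V V' D s) (i j : Fin n) :
    HasDerivWithinAt (fun s => h.Γx (c s) t (V s) i j)
      (h.Γx (c s) t V' i j + h.dΓx (c s) t c' (V s) i j) D s := by
  have hV' := hasDerivWithinAt_pi.1 hV
  simp only [Γx, dΓx, Matrix.of_apply, ← Finset.sum_add_distrib]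
  refine HasDerivWithinAt.fun_sum fun p _ => ?_
  have h1 := (slice_hasFDerivAt (h.Γ (some p) i j) ht (x := c s)).comp_hasDerivWithinAt s hc
  refine ((hV' p).mul h1).congr_deriv ?_
  congr 2
  have h2 := h.ext_dV (h.Γ (some p) i j) c' ht (x := c s)
  rw [← h2, extS_apply _ (mem_slab ht), dV, evS_dirD]
  simp

theorem isPath_ncurve {t : ℝ} (ht : t ∈ Icc 0 T) {γ γ' V W : ℝ → Fin n → ℝ} (hγ : IsPath γ γ')
    (hV : IsPath V W) (r : ℝ) :
    IsPath (fun s => h.ncurve t (γ s) (V s) r)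
      (fun s => γ' s + r • W s + r ^ 2 • h.zf' t (γ s) (γ' s) (V s) (W s)) := by
  constructor
  · intro s hs
    unfold ncurve
    have hA : HasDerivWithinAt (fun s => h.Γx (γ s) t (V s) *ᵥ V s)
        (h.dΓx (γ s) t (γ' s) (V s) *ᵥ V s + (2:ℝ) • h.Γx (γ s) t (V s) *ᵥ W s) (Icc 0 1) s := by
      have e : h.dΓx (γ s) t (γ' s) (V s) *ᵥ V s + (2:ℝ) • h.Γx (γ s) t (V s) *ᵥ W s
          = (h.Γx (γ s) t (W s) + h.dΓx (γ s) t (γ' s) (V s)) *ᵥ V s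
            + h.Γx (γ s) t (V s) *ᵥ W s := by
        rw [Matrix.add_mulVec, h.Γx_comm _ _ (W s), two_smul]; abel
      rw [e]
      refine hasDerivWithinAt_pi.2 fun i => ?_
      simp only [Matrix.mulVec, dotProduct, Pi.add_apply, ← Finset.sum_add_distrib]
      refine HasDerivWithinAt.fun_sum fun j _ => ?_
      exact (h.Γx_curve ht (hγ.1 s hs) (hV.1 s hs) i j).mul (hasDerivWithinAt_pi.1 (hV.1 s hs) j)
    exact ((hγ.1 s hs).add ((hV.1 s hs).const_smul r)).add
      ((hA.const_smul (-(1/2 : ℝ))).const_smul (r ^ 2))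
  · have hz := (h.contDiff_zf' (X := (Fin n → ℝ) × (Fin n → ℝ) × (Fin n → ℝ) × (Fin n → ℝ)) ht
      contDiff_fst (contDiff_fst.comp contDiff_snd)
      (contDiff_fst.comp (contDiff_snd.comp contDiff_snd))
      (contDiff_snd.comp (contDiff_snd.comp contDiff_snd))).continuous
    have hzc := hz.comp_continuousOn
      (hγ.continuousOn.prodMk (hγ.2.prodMk (hV.continuousOn.prodMk hV.2)))
    exact (hγ.2.add (hV.2.const_smul r)).add (hzc.const_smul (r ^ 2))

end IsRFOn

end RFlow

namespace RFlow

variable {g : (Fin n → ℝ) → ℝ → Matrix (Fin n) (Fin n) ℝ} {T : ℝ}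

/-- A cut-off profile along a path with speed `S ≥ lam`, concentrated at distance of order `lam`
from the initial point. -/
theorem exists_profile {S : ℝ → ℝ} (hS : ContinuousOn S (Icc 0 1)) {lam : ℝ} (hl : 0 < lam)
    (hlS : ∀ s ∈ Icc (0:ℝ) 1, lam ≤ S s) {N c : ℝ} (hN : 0 ≤ N) (hc : 0 ≤ c) :
    ∃ η μ : ℝ → ℝ, (∀ s ∈ Icc (0:ℝ) 1, HasDerivWithinAt η (μ s) (Icc 0 1) s)
      ∧ ContinuousOn μ (Icc 0 1) ∧ η 0 = 0 ∧ η 1 = 1 ∧ (∀ s ∈ Icc (0:ℝ) 1, η s ∈ Icc (0:ℝ) 1)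
      ∧ (∀ s ∈ Icc (0:ℝ) 1, |μ s| ≤ 2 / lam * S s)
      ∧ ∫ s in (0:ℝ)..1, (N * μ s ^ 2 / S s + (1 - η s ^ 2) * (c * S s))
        ≤ 2 * N / lam + 2 * c * lam := by
  set S' : ℝ → ℝ := fun s => S (projIcc 0 1 zero_le_one s) with hS'
  have hSc : Continuous S' := continuousOn_iff_continuous_domRestrict.1 hS |>.comp continuous_projIcc
  have hSS : ∀ s ∈ Icc (0:ℝ) 1, S' s = S s := fun s hs => by simp [hS', projIcc_of_mem _ hs]
  have hlS' : ∀ s, lam ≤ S' s := fun s => hlS _ (projIcc 0 1 zero_le_one s).2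
  set A : ℝ → ℝ := fun τ => ∫ s in (0:ℝ)..τ, S' s with hA
  have hAd : ∀ τ, HasDerivAt A (S' τ) τ := fun τ =>
    intervalIntegral.integral_hasDerivAt_right (hSc.intervalIntegrable _ _)
      hSc.stronglyMeasurable.stronglyMeasurableAtFilter hSc.continuousAt
  have hmono : Monotone A := monotone_of_deriv_nonneg (fun τ => (hAd τ).differentiableAt)
    fun τ => by rw [(hAd τ).deriv]; exact hl.le.trans (hlS' τ)
  have hA0 : A 0 = 0 := by simp [hA]
  set ℓ := A 1 with hℓ
  have hℓl : lam ≤ ℓ := by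
    have := intervalIntegral.integral_mono_on zero_le_one (intervalIntegrable_const (μ := volume) (c := lam))
      (hSc.intervalIntegrable 0 1) fun s _ => hlS' s
    simpa [hℓ, hA] using this
  have hℓ0 : 0 < ℓ := hl.trans_le hℓl
  obtain ⟨k, hk1, hk2⟩ : ∃ k : ℕ, (k:ℝ) * lam < ℓ ∧ ℓ ≤ (k + 1) * lam := by
    have hpos : 0 < ⌈ℓ / lam⌉₊ := Nat.ceil_pos.2 (by positivity)
    obtain ⟨k, hk⟩ := Nat.exists_eq_succ_of_ne_zero hpos.ne'
    refine ⟨k, ?_, ?_⟩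
    · have : k < ⌈ℓ / lam⌉₊ := by omega
      exact (lt_div_iff₀ hl).1 (Nat.lt_ceil.1 this)
    · have := Nat.le_ceil (ℓ / lam)
      rw [hk, div_le_iff₀ hl] at this
      exact_mod_cast this
  set u : ℝ → ℝ := fun τ => 1 - ℓ⁻¹ * A τ with hu
  have hud : ∀ τ, HasDerivAt u (-(ℓ⁻¹ * S' τ)) τ := fun τ => ((hAd τ).const_mul ℓ⁻¹).const_sub 1
  have huc : Continuous u := continuous_iff_continuousAt.2 fun τ => (hud τ).continuousAt
  have hu0 : u 0 = 1 := by simp [hu, hA0]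
  have hu1 : u 1 = 0 := by simp [hu, ← hℓ, hℓ0.ne']
  have hu01 : ∀ s ∈ Icc (0:ℝ) 1, 0 ≤ u s ∧ u s ≤ 1 := fun s hs => by
    have h1 := hmono hs.1
    have h2 := hmono hs.2
    rw [hA0] at h1
    rw [← hℓ] at h2
    have h3 : ℓ⁻¹ * A s ≤ 1 := by rw [inv_mul_le_iff₀ hℓ0]; linarith
    have h4 : 0 ≤ ℓ⁻¹ * A s := by positivity
    simp only [hu]; constructor <;> linarith
  have hkl : (k + 1) * lam ≤ 2 * ℓ := by
    rcases Nat.eq_zero_or_pos k with rfl | hk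
    · push_cast; linarith
    · have : (1:ℝ) ≤ k := by exact_mod_cast hk
      nlinarith
  refine ⟨fun τ => 1 - u τ ^ (k + 1), fun τ => (k + 1) * u τ ^ k * (ℓ⁻¹ * S' τ), ?_, ?_, ?_, ?_, ?_,
    ?_, ?_⟩
  · intro s _
    have := ((hud s).fun_pow (k + 1)).const_sub 1
    refine (this.congr_deriv ?_).hasDerivWithinAt
    push_cast
    ring
  · exact (by fun_prop : Continuous fun τ => (k + 1) * u τ ^ k * (ℓ⁻¹ * S' τ)).continuousOn
  · simp [hu0]
  · simp [hu1]
  · intro s hs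
    obtain ⟨a, b⟩ := hu01 s hs
    exact ⟨by linarith [pow_le_one₀ a b (n := k + 1)], by linarith [pow_nonneg a (k + 1)]⟩
  · intro s hs
    obtain ⟨a, b⟩ := hu01 s hs
    have h0 : 0 ≤ S s := hl.le.trans (hlS s hs)
    simp only [hSS s hs]
    rw [abs_of_nonneg (by positivity)]
    have h1 : (k + 1) * ℓ⁻¹ ≤ 2 / lam := by
      rw [← div_eq_mul_inv, div_le_div_iff₀ hℓ0 hl]; exact hkl
    have h2 : ((k:ℝ) + 1) * u s ^ k * (ℓ⁻¹ * S s) ≤ (k + 1) * 1 * (ℓ⁻¹ * S s) := by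
      gcongr; exact pow_le_one₀ a b
    calc _ ≤ _ := h2
      _ = ((k + 1) * ℓ⁻¹) * S s := by ring
      _ ≤ _ := by gcongr
  · set F : ℝ → ℝ := fun τ => -(N * (k + 1) ^ 2 / (ℓ * (2 * k + 1)) * u τ ^ (2 * k + 1)
      + 2 * c * ℓ / (k + 2) * u τ ^ (k + 2)) with hF
    have hFd : ∀ τ, HasDerivAt F (N * (k + 1) ^ 2 / ℓ ^ 2 * u τ ^ (2 * k) * S' τ
        + 2 * c * u τ ^ (k + 1) * S' τ) τ := fun τ => by
      have h1 := (((hud τ).fun_pow (2 * k + 1)).const_mul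
        (N * (k + 1) ^ 2 / (ℓ * (2 * k + 1)))).add (((hud τ).fun_pow (k + 2)).const_mul
        (2 * c * ℓ / (k + 2)))
      refine h1.neg.congr_deriv ?_
      push_cast
      field_simp
      ring
    have hgc : Continuous fun τ => N * (k + 1) ^ 2 / ℓ ^ 2 * u τ ^ (2 * k) * S' τ
        + 2 * c * u τ ^ (k + 1) * S' τ := by fun_prop
    have hint := intervalIntegral.integral_eq_sub_of_hasDerivAt (fun τ _ => hFd τ)
      (hgc.intervalIntegrable 0 1)
    have hF1 : F 1 = 0 := by simp [hF, hu1]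
    have hF0 : F 0 = -(N * (k + 1) ^ 2 / (ℓ * (2 * k + 1)) + 2 * c * ℓ / (k + 2)) := by
      simp [hF, hu0]
    have hb : F 1 - F 0 ≤ 2 * N / lam + 2 * c * lam := by
      rw [hF1, hF0]
      have h1 : N * (k + 1) ^ 2 / (ℓ * (2 * k + 1)) ≤ 2 * N / lam := by
        rw [div_le_div_iff₀ (by positivity) hl]
        have : ((k:ℝ) + 1) ^ 2 * lam ≤ 2 * (ℓ * (2 * k + 1)) := by
          nlinarith [mul_le_mul_of_nonneg_left hkl (by positivity : (0:ℝ) ≤ k + 1)]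
        nlinarith [mul_le_mul_of_nonneg_left this hN]
      have h2 : 2 * c * ℓ / (k + 2) ≤ 2 * c * lam := by
        rw [div_le_iff₀ (by positivity)]
        have : ℓ ≤ lam * (k + 2) := by linarith
        nlinarith [mul_le_mul_of_nonneg_left this hc]
      linarith
    rw [← hint] at hb
    refine le_trans (intervalIntegral.integral_mono_on zero_le_one ?_
      (hgc.intervalIntegrable 0 1) ?_) hb
    · refine ContinuousOn.intervalIntegrable ?_
      rw [uIcc_of_le zero_le_one]
      refine ContinuousOn.add (ContinuousOn.div (by fun_prop) hS fun s hs => ?_) ?_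
      · exact (hl.trans_le (hlS s hs)).ne'
      · exact (by fun_prop : Continuous fun τ => 1 - (1 - u τ ^ (k + 1)) ^ 2).continuousOn.mul
          (hS.const_smul c)
    · intro s hs
      obtain ⟨a, b⟩ := hu01 s hs
      have h0 : 0 < S s := hl.trans_le (hlS s hs)
      simp only [hSS s hs]
      refine add_le_add (le_of_eq ?_) ?_
      · field_simp
        ring
      · have h1 : 1 - (1 - u s ^ (k + 1)) ^ 2 ≤ 2 * u s ^ (k + 1) := by
          nlinarith [sq_nonneg (u s ^ (k + 1))]
        calc _ ≤ 2 * u s ^ (k + 1) * (c * S s) := by gcongr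
          _ = _ := by ring

end RFlow

namespace RFlow

variable {g : (Fin n → ℝ) → ℝ → Matrix (Fin n) (Fin n) ℝ} {T : ℝ}

namespace IsRFOn

open scoped ContDiff

variable (h : IsRFOn g T)

theorem ncurve_zero_vec (t : ℝ) (x : Fin n → ℝ) (s : ℝ) : h.ncurve t x 0 s = x := by
  simp [ncurve]

/-- Existence of variation fields along a path interpolating from zero to a frame. -/
theorem exists_variation_fields {t : ℝ} (ht : t ∈ Icc 0 T) {γ γ' : ℝ → Fin n → ℝ}
    (hγ : IsPath γ γ') {E : Matrix (Fin n) (Fin n) ℝ} (hE : Eᵀ * g (γ 1) t * E = 1)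
    {η μ : ℝ → ℝ} (hη : ∀ s ∈ Icc (0:ℝ) 1, HasDerivWithinAt η (μ s) (Icc 0 1) s)
    (hμ : ContinuousOn μ (Icc 0 1)) :
    ∃ P : ℝ → Matrix (Fin n) (Fin n) ℝ, P 1 = E ∧ (∀ s ∈ Icc (0:ℝ) 1, (P s)ᵀ * g (γ s) t * P s = 1)
      ∧ ∀ a, IsPath (fun s => η s • (P s)ᵀ a)
        fun s => μ s • (P s)ᵀ a - η s • h.Γx (γ s) t (γ' s) *ᵥ (P s)ᵀ a := by
  obtain ⟨P, hP1, hPd, hP⟩ := h.exists_parallel_frame ht hγ hE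
  refine ⟨P, hP1, hP, fun a => ⟨fun s hs => ?_, ?_⟩⟩
  · refine ((hη s hs).smul (hPd s hs a)).congr_deriv ?_
    rw [smul_neg]; abel
  · have hPc : ContinuousOn (fun s => (P s)ᵀ a) (Icc 0 1) := fun s hs =>
      (hPd s hs a).continuousWithinAt
    have hηc : ContinuousOn η (Icc 0 1) := fun s hs => (hη s hs).continuousWithinAt
    have hc := (contDiff_mulVec (A := fun p : (Fin n → ℝ) × (Fin n → ℝ) × (Fin n → ℝ) =>
      h.Γx p.1 t p.2.1) (V := fun p => p.2.2) (fun i j => h.contDiff_Γx ht contDiff_fst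
      (contDiff_fst.comp contDiff_snd) i j) (contDiff_snd.comp contDiff_snd)).continuous
    have hc' := hc.comp_continuousOn (hγ.continuousOn.prodMk (hγ.2.prodMk hPc))
    exact (hμ.smul hPc).sub (hηc.smul hc')

set_option maxHeartbeats 1000000 in
/-- Discrete heat inequality for the regularized distance function. -/
theorem act_barrier {t : ℝ} (ht : t ∈ Ioc 0 T) {K D : Set (Fin n → ℝ)} (hK : IsCompact K)
    (hDK : D ⊆ K) {lam : ℝ} (hl : 0 < lam) {x₁ x : Fin n → ℝ} {E : Matrix (Fin n) (Fin n) ℝ}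
    (hE : Eᵀ * g x t * E = 1) {R : ℝ} (hR : act g lam x₁ t x < R)
    (hconf : ∀ γ γ', IsPath γ γ' → γ 0 = x₁ → γ 1 = x → len g t lam γ γ' < R →
      ∀ s ∈ Icc (0:ℝ) 1, γ s ∈ D) {c₀ : ℝ} (hc₀ : 0 ≤ c₀)
    (hric : ∀ y ∈ D, ∀ ξ, nq (h.rc y t) ξ ≤ c₀ * nq (g y t) ξ) {δ : ℝ} (hδ : 0 < δ) :
    ∃ h₀ > 0, ∀ s, 0 < s → s < h₀ → s ^ 2 ≤ t ∧
      ∑ a, (act g lam x₁ t (h.ncurve t x (Eᵀ a) s) + act g lam x₁ t (h.ncurve t x (Eᵀ a) (-s))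
        - 2 * act g lam x₁ t x) + (act g lam x₁ (t - s ^ 2) x - act g lam x₁ t x)
      ≤ s ^ 2 * (2 * n / lam + 2 * c₀ * lam + δ) := by
  have ht' : t ∈ Icc 0 T := ⟨ht.1.le, ht.2⟩
  set N := act g lam x₁ t x with hN
  have hN0 : 0 ≤ N := act_nonneg _ _ _ _
  set δ' := δ / (2 * (N + 1)) with hδ'
  have hδ'0 : 0 < δ' := by positivity
  obtain ⟨h₀, hh₀, hvar⟩ := h.pointwise_variation ht hK hl (2 / lam) hδ'0
  refine ⟨min (min h₀ 1) (min (δ / (2 * (2 * n + 1))) (R - N)),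
    lt_min (lt_min hh₀ one_pos) (lt_min (by positivity) (by linarith)), fun s hs hs' => ?_⟩
  obtain ⟨hs1, hs2⟩ := lt_min_iff.1 hs'
  obtain ⟨hs1, hs3⟩ := lt_min_iff.1 hs1
  obtain ⟨hs2, hs4⟩ := lt_min_iff.1 hs2
  obtain ⟨hst, hvar⟩ := hvar s hs hs1
  refine ⟨hst, ?_⟩
  have hts : t - s ^ 2 ∈ Icc 0 T := ⟨by linarith, by nlinarith [ht.2]⟩
  have hs33 : s ^ 3 < s := by
    have : s ^ 2 < 1 := by nlinarith
    nlinarith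
  obtain ⟨γ, γ', hγ, hγ0, hγ1, hlen⟩ := exists_len_lt (g := g) (lam := lam) (x₁ := x₁) (t := t)
    (x := x) (b := N + s ^ 3) (by rw [← hN]; linarith [pow_pos hs 3])
  have hγD := hconf γ γ' hγ hγ0 hγ1 (by linarith)
  set S := spd g t lam γ γ' with hS
  have hSc : ContinuousOn S (Icc 0 1) := h.spd_continuousOn ht' lam hγ
  have hlS : ∀ τ ∈ Icc (0:ℝ) 1, lam ≤ S τ := fun τ _ => h.le_spd ht' lam γ γ' τ
  obtain ⟨η, μ, hη, hμ, hη0, hη1, hη01, hμS, hint⟩ := exists_profile hSc hl hlS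
    (Nat.cast_nonneg n : (0:ℝ) ≤ n) hc₀
  obtain ⟨P, hP1, hP, hV⟩ := h.exists_variation_fields ht' hγ (E := E) (by rw [hγ1]; exact hE) hη hμ
  set ℓ := len g t lam γ γ' with hℓ
  have hpath := fun (a : Fin n) (r : ℝ) => h.isPath_ncurve ht' hγ (hV a) r
  have hact : ∀ (a : Fin n) (r : ℝ), act g lam x₁ t (h.ncurve t x (Eᵀ a) r) ≤
      ∫ τ in (0:ℝ)..1, √(lam ^ 2 + h.vq t (γ τ) (γ' τ) (η τ • (P τ)ᵀ a)
        (μ τ • (P τ)ᵀ a - η τ • h.Γx (γ τ) t (γ' τ) *ᵥ (P τ)ᵀ a) r) := by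
    intro a r
    have := act_le (g := g) (lam := lam) (t := t) (hpath a r)
    simp only [hη0, hη1, zero_smul, one_smul, ncurve_zero_vec, hγ0, hγ1, hP1] at this
    exact this
  have hInt : ∀ (a : Fin n) (r : ℝ), IntervalIntegrable (fun τ => √(lam ^ 2 + h.vq t (γ τ) (γ' τ)
      (η τ • (P τ)ᵀ a) (μ τ • (P τ)ᵀ a - η τ • h.Γx (γ τ) t (γ' τ) *ᵥ (P τ)ᵀ a) r)) volume 0 1 :=
    fun a r => h.spd_intervalIntegrable ht' lam (hpath a r)
  have hIntS := h.spd_intervalIntegrable ht' lam hγ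
  have hactT : act g lam x₁ (t - s ^ 2) x ≤
      ∫ τ in (0:ℝ)..1, √(lam ^ 2 + nq (g (γ τ) (t - s ^ 2)) (γ' τ)) := by
    have := act_le (g := g) (lam := lam) (t := t - s ^ 2) hγ
    rwa [hγ0, hγ1] at this
  have hIntT : IntervalIntegrable (fun τ => √(lam ^ 2 + nq (g (γ τ) (t - s ^ 2)) (γ' τ))) volume 0 1 :=
    h.spd_intervalIntegrable hts lam hγ
  have hηc : ContinuousOn η (Icc 0 1) := fun τ hτ => (hη τ hτ).continuousWithinAt
  have hIntB : IntervalIntegrable (fun τ => n * μ τ ^ 2 / S τ + (1 - η τ ^ 2) * (c₀ * S τ))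
      volume 0 1 := by
    refine ContinuousOn.intervalIntegrable ?_
    rw [uIcc_of_le zero_le_one]
    exact ((continuousOn_const.mul (hμ.pow 2)).div hSc fun τ hτ => (hl.trans_le (hlS τ hτ)).ne').add
      ((continuousOn_const.sub (hηc.pow 2)).mul (continuousOn_const.mul hSc))
  have hmain := intervalIntegral.integral_mono_on zero_le_one
    ((IntervalIntegrable.sum Finset.univ fun a _ => ((hInt a s).add (hInt a (-s))).sub
      (hIntS.const_mul 2)).add (hIntT.sub hIntS))
    ((hIntB.add (hIntS.const_mul δ')).const_mul (s ^ 2)) (fun τ hτ => by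
      have hv := hvar (γ τ) (hDK (hγD τ hτ)) (γ' τ) (P τ) (hP τ hτ) (η τ) (hη01 τ hτ) (μ τ) (S τ) rfl
        (hμS τ hτ)
      have hS0 : 0 < S τ := hl.trans_le (hlS τ hτ)
      have hb : (n * μ τ ^ 2 + (1 - η τ ^ 2) * nq (h.rc (γ τ) t) (γ' τ)) / S τ
          ≤ n * μ τ ^ 2 / S τ + (1 - η τ ^ 2) * (c₀ * S τ) := by
        rw [add_div]
        refine add_le_add le_rfl ?_
        have h1 : 0 ≤ 1 - η τ ^ 2 := by
          have := hη01 τ hτ; nlinarith [this.1, this.2]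
        rw [mul_div_assoc]
        refine mul_le_mul_of_nonneg_left ?_ h1
        rw [div_le_iff₀ hS0]
        refine (hric _ (hγD τ hτ) _).trans ?_
        have h2 := h.spd_sq ht' lam γ γ' τ
        have h3 : nq (g (γ τ) t) (γ' τ) ≤ S τ * S τ := by
          rw [← hS] at h2; nlinarith [sq_nonneg lam]
        rw [mul_assoc]
        exact mul_le_mul_of_nonneg_left h3 hc₀
      have hb' := mul_le_mul_of_nonneg_left (add_le_add_left hb (δ' * S τ)) (sq_nonneg s)
      refine le_trans (le_of_eq ?_) (hv.trans hb')
      simp only [Finset.sum_apply]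
      rfl)
  rw [intervalIntegral.integral_const_mul, intervalIntegral.integral_add hIntB (hIntS.const_mul δ'),
    intervalIntegral.integral_const_mul] at hmain
  have e1 := intervalIntegral.integral_add
    (IntervalIntegrable.sum Finset.univ fun a _ => ((hInt a s).add (hInt a (-s))).sub
      (hIntS.const_mul 2)) (hIntT.sub hIntS)
  have e2 := intervalIntegral.integral_finsetSum (s := Finset.univ)
    fun a _ => ((hInt a s).add (hInt a (-s))).sub (hIntS.const_mul 2)
  have e3 := intervalIntegral.integral_sub hIntT hIntS
  have e4 := fun a => (intervalIntegral.integral_sub ((hInt a s).add (hInt a (-s)))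
    (hIntS.const_mul 2)).trans (by
      rw [intervalIntegral.integral_const_mul, intervalIntegral.integral_add (hInt a s) (hInt a (-s))])
  have hsum := Finset.sum_le_sum fun a (_ : a ∈ Finset.univ) => sub_le_sub
    (add_le_add (hact a s) (hact a (-s))) (le_refl (2 * ℓ))
  have hℓ' : (∫ τ in (0:ℝ)..1, S τ) = ℓ := rfl
  rw [hℓ'] at e3 hmain
  have hL := (add_le_add hsum (sub_le_sub_right hactT ℓ)).trans ((le_of_eq (by
    refine Eq.symm (e1.trans ?_)
    rw [← e3]
    refine congrArg₂ (· + ·) ?_ rfl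
    simp only [Finset.sum_apply]
    rw [hℓ'] at e4
    exact e2.trans (Finset.sum_congr rfl fun a _ => e4 a))).trans hmain)
  have hsp : ∀ b : Fin n → ℝ, ∑ a, (b a - 2 * N) = ∑ a, (b a - 2 * ℓ) + n * (2 * (ℓ - N)) := fun b => by
    simp only [Finset.sum_sub_distrib, Finset.sum_const, Finset.card_univ, Fintype.card_fin,
      nsmul_eq_mul]
    ring
  rw [hsp]
  have f1 : ℓ - N ≤ s ^ 3 := by linarith
  have f2 : s * (2 * n + 1) ≤ δ / 2 := by
    have := mul_le_mul_of_nonneg_right hs2.le (by positivity : (0:ℝ) ≤ 2 * n + 1)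
    refine this.trans (le_of_eq ?_)
    field_simp
  have f3 : δ' * ℓ ≤ δ / 2 := by
    have : ℓ ≤ N + 1 := by linarith
    have := mul_le_mul_of_nonneg_left this hδ'0.le
    refine this.trans (le_of_eq ?_)
    rw [hδ']; field_simp
  have f4 := mul_le_mul_of_nonneg_left (add_le_add hint f3) (sq_nonneg s)
  have f5 := mul_le_mul_of_nonneg_left f2 (sq_nonneg s)
  have f6 := mul_le_mul_of_nonneg_left f1 (by positivity : (0:ℝ) ≤ 2 * n + 1)
  nlinarith

end IsRFOn

end RFlow

namespace RFlow

section

open scoped MatrixOrder Matrix.Norms.L2Operator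

theorem exists_orthonormal_frame {M : Matrix (Fin n) (Fin n) ℝ} (hM : M.PosDef) :
    ∃ E : Matrix (Fin n) (Fin n) ℝ, Eᵀ * M * E = 1 := by
  obtain ⟨B, hB, rfl⟩ := CStarAlgebra.isStrictlyPositive_iff_eq_star_mul_self.mp
    hM.isStrictlyPositive
  have hd := (Matrix.isUnit_iff_isUnit_det _).1 hB
  refine ⟨B⁻¹, ?_⟩
  have e : star B = Bᵀ := by ext i j; simp [Matrix.star_apply]
  rw [e, Matrix.mul_assoc, Matrix.mul_assoc, Matrix.mul_nonsing_inv _ hd, Matrix.mul_one,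
    ← Matrix.transpose_mul, Matrix.mul_nonsing_inv _ hd, Matrix.transpose_one]

end

section

variable {A : Type*} [CommRing A] [Algebra ℝ A]
variable {d : Option (Fin n) → Derivation ℝ A A}
  {G H : Matrix (Fin n) (Fin n) A} {Γ : Option (Fin n) → Matrix (Fin n) (Fin n) A}

theorem RFData.ric_frame_le (h : RFData d G H Γ) (ev : A →ₐ[ℝ] ℝ) {E E' : Matrix (Fin n) (Fin n) ℝ}
    (hE : E * E' = 1) (hEG : Eᵀ * G.map ev * E = 1) (b c : Fin n) :
    |(Eᵀ * (ricM d Γ).map ev * E) b c| ≤ n * √(ev (h.B h.F h.F)) := by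
  have hm : ∀ M : Matrix (Fin n) (Fin n) ℝ, (M.map (algebraMap ℝ A)).map (ev : A →+* ℝ) = M := by
    intro M; ext i j; simp
  have hG1 : ((E.map (algebraMap ℝ A))ᵀ * G * E.map (algebraMap ℝ A)).map (ev : A →+* ℝ) = 1 := by
    rw [Matrix.map_mul, Matrix.map_mul, hm, ← Matrix.transpose_map, hm]; exact hEG
  have hH1 : (E'.map (algebraMap ℝ A) * H * (E'.map (algebraMap ℝ A))ᵀ).map (ev : A →+* ℝ) = 1 := by
    have := congrArg (fun M => M.map (ev : A →+* ℝ)) (h.frame hE).hGH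
    simp only [Matrix.map_mul (L := (E.map (algebraMap ℝ A))ᵀ * G * E.map (algebraMap ℝ A)), hG1,
      Matrix.one_mul] at this
    rw [this, Matrix.map_one _ (map_zero _) (map_one _)]
  have e1 : (Eᵀ * (ricM d Γ).map ev * E) =
      ((E.map (algebraMap ℝ A))ᵀ * ricM d Γ * E.map (algebraMap ℝ A)).map (ev : A →+* ℝ) := by
    rw [Matrix.map_mul, Matrix.map_mul, hm, ← Matrix.transpose_map, hm]; rfl
  rw [e1, ← ricM_frame hE, Matrix.map_apply, (h.frame hE).ric_eq, map_sum, ← h.frame_B hE]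
  exact sum_abs_le fun i => (h.frame hE).ev_le _ hG1 hH1 i b i c

end

variable {g : (Fin n → ℝ) → ℝ → Matrix (Fin n) (Fin n) ℝ} {T : ℝ}

namespace IsRFOn

variable (h : IsRFOn g T)

theorem rc_le {t : ℝ} (ht : t ∈ Icc 0 T) (x ξ : Fin n → ℝ) :
    nq (h.rc x t) ξ ≤ n ^ 2 * √(extS h.u (x, t)) * nq (g x t) ξ := by
  have hp : (x, t) ∈ slab n T := mem_slab ht
  obtain ⟨E, hE⟩ := exists_orthonormal_frame (h.smooth.2 x t ht).2
  have hEE : E * (Eᵀ * g x t) = 1 := mul_eq_one_comm.mp hE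
  set w := (Eᵀ * g x t) *ᵥ ξ with hw
  have hξ : ξ = E *ᵥ w := by rw [hw, Matrix.mulVec_mulVec, hEE, Matrix.one_mulVec]
  have hq : ∀ M, nq M ξ = nq (Eᵀ * M * E) w := fun M => by
    rw [nq_eq, nq_eq, nb_mul_right, nb_transpose_mul, ← hξ]
  have hr : h.rc x t = (ricM h.d h.Γ).map (evS hp) := by
    ext j k; simp only [rc, Matrix.of_apply, extS_apply _ hp, Matrix.map_apply]
  rw [hq, hq (g x t), hE, hr, extS_apply _ hp]
  have hb := h.rfData.ric_frame_le (evS hp) hEE (by rw [h.map_G hp]; exact hE)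
  set s := √(evS hp h.u) with hs
  have h1 : nq (1 : Matrix (Fin n) (Fin n) ℝ) w = ∑ i, w i ^ 2 := by
    simp [nq, Matrix.one_apply, pow_two]
  rw [h1]
  have h2 : (∑ i, |w i|) ^ 2 ≤ n * ∑ i, w i ^ 2 := by
    have := sq_sum_le_card_mul_sum_sq (s := Finset.univ) (f := fun i => |w i|)
    simpa using this
  calc nq (Eᵀ * (ricM h.d h.Γ).map (evS hp) * E) w
      ≤ ∑ i, ∑ j, n * s * (|w i| * |w j|) := by
        refine Finset.sum_le_sum fun i _ => Finset.sum_le_sum fun j _ => ?_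
        refine (le_abs_self _).trans ?_
        rw [mul_assoc, abs_mul, abs_mul]
        exact mul_le_mul_of_nonneg_right (hb i j) (by positivity)
    _ = n * s * (∑ i, |w i|) ^ 2 := by
        rw [pow_two, Finset.sum_mul_sum, Finset.mul_sum]
        exact Finset.sum_congr rfl fun i _ => by rw [Finset.mul_sum]
    _ ≤ n * s * (n * ∑ i, w i ^ 2) := by gcongr
    _ = _ := by ring

include h in
/-- Comparison of the metrics at different times under a Ricci upper bound. -/
theorem metric_compare {x : Fin n → ℝ} {t₁ c₀ : ℝ} (ht₁ : t₁ ∈ Icc 0 T)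
    (hu : ∀ t ∈ Icc 0 t₁, ∀ ξ, nq (h.rc x t) ξ ≤ c₀ * nq (g x t) ξ) (ξ : Fin n → ℝ) :
    nq (g x 0) ξ ≤ Real.exp (2 * c₀ * t₁) * nq (g x t₁) ξ := by
  have hd : ∀ t ∈ Icc 0 T, HasDerivWithinAt (fun s => nq (g x s) ξ) (-2 * nq (h.rc x t) ξ)
      (Icc 0 T) t := by
    intro t ht
    have e : ∀ s ∈ Icc 0 T, nq (g x s) ξ = ∑ i, ∑ j, extS (h.G i j) (x, s) * ξ i * ξ j := by
      intro s hs
      simp only [nq, extS_apply _ (mem_slab hs), h.ev_G]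
    refine HasDerivWithinAt.congr ?_ e (e t ht)
    have : -2 * nq (h.rc x t) ξ = ∑ i, ∑ j, extS (h.d none (h.G i j)) (x, t) * ξ i * ξ j := by
      simp only [nq, Finset.mul_sum, h.dG_none, rc, Matrix.of_apply, extS_apply _ (mem_slab ht),
        map_neg, map_mul, map_ofNat]
      exact Finset.sum_congr rfl fun i _ => Finset.sum_congr rfl fun j _ => by ring
    rw [this]
    exact HasDerivWithinAt.fun_sum fun i _ => HasDerivWithinAt.fun_sum fun j _ =>
      ((h.time_hasDerivWithinAt (h.G i j) ht).mul_const _).mul_const _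
  set f : ℝ → ℝ := fun t => Real.exp (2 * c₀ * t) * nq (g x t) ξ with hf
  have hfd : ∀ t ∈ Icc 0 T, HasDerivWithinAt f (Real.exp (2 * c₀ * t) * (2 * c₀) * nq (g x t) ξ
      + Real.exp (2 * c₀ * t) * (-2 * nq (h.rc x t) ξ)) (Icc 0 T) t := by
    intro t ht
    have h1 : HasDerivAt (fun t => Real.exp (2 * c₀ * t)) (Real.exp (2 * c₀ * t) * (2 * c₀)) t := by
      have := ((hasDerivAt_id t).const_mul (2 * c₀)).exp
      simpa using this
    exact h1.hasDerivWithinAt.mul (hd t ht)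
  have hsub : Icc 0 t₁ ⊆ Icc 0 T := Icc_subset_Icc_right ht₁.2
  have hm : MonotoneOn f (Icc 0 t₁) := by
    refine monotoneOn_of_hasDerivWithinAt_nonneg (convex_Icc _ _)
      (fun t ht => (hfd t (hsub ht)).continuousWithinAt.mono hsub)
      (fun t ht => (hfd t (hsub (interior_subset ht))).mono (interior_subset.trans hsub)) ?_
    intro t ht
    have := hu t (interior_subset ht) ξ
    have e : Real.exp (2 * c₀ * t) * (2 * c₀) * nq (g x t) ξ
      + Real.exp (2 * c₀ * t) * (-2 * nq (h.rc x t) ξ) =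
      2 * Real.exp (2 * c₀ * t) * (c₀ * nq (g x t) ξ - nq (h.rc x t) ξ) := by ring
    rw [e]
    exact mul_nonneg (by positivity) (by linarith)
  have := hm ⟨le_rfl, ht₁.1⟩ ⟨ht₁.1, le_rfl⟩ ht₁.1
  simpa [hf] using this

end IsRFOn

end RFlow

namespace RFlow

variable {g : (Fin n → ℝ) → ℝ → Matrix (Fin n) (Fin n) ℝ} {T : ℝ}

namespace IsRFOn

variable (h : IsRFOn g T)

/-- Short paths stay in a region on which the Ricci curvature is controlled. -/
theorem path_confined {B : Set (Fin n → ℝ)} {x₁ : Fin n → ℝ} {r c₀ t₁ t lam : ℝ}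
    (ht₁ : t₁ ∈ Icc 0 T) (ht : t ∈ Icc 0 t₁) (hc₀ : 0 ≤ c₀)
    (hB : ∀ γ γ', IsPath γ γ' → γ 0 = x₁ → ∀ s ∈ Icc (0:ℝ) 1,
      ∫ τ in (0:ℝ)..s, spd g 0 0 γ γ' τ < r → γ s ∈ B)
    (hric : ∀ y ∈ B, ∀ t ∈ Icc 0 t₁, ∀ ξ, nq (h.rc y t) ξ ≤ c₀ * nq (g y t) ξ)
    {γ γ' : ℝ → Fin n → ℝ} (hγ : IsPath γ γ') (hγ0 : γ 0 = x₁)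
    (hlen : len g t lam γ γ' < Real.exp (-(c₀ * t₁)) * r) {s : ℝ} (hs : s ∈ Icc (0:ℝ) 1) :
    γ s ∈ B := by
  have ht' : t ∈ Icc 0 T := ⟨ht.1, ht.2.trans ht₁.2⟩
  have h0 : (0:ℝ) ∈ Icc 0 T := ⟨le_rfl, h.pos.le⟩
  have hc0 := h.spd_continuousOn h0 0 hγ
  have hct := h.spd_continuousOn ht' lam hγ
  have hi0 := h.spd_intervalIntegrable h0 0 hγ
  have hit := h.spd_intervalIntegrable ht' lam hγ
  set A : ℝ → ℝ := fun s => ∫ τ in (0:ℝ)..s, spd g 0 0 γ γ' τ with hA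
  have hAc : ContinuousOn A (Icc 0 1) := by
    have := intervalIntegral.continuousOn_primitive_interval' (a := (0:ℝ)) hi0 (by simp)
    rwa [uIcc_of_le zero_le_one] at this
  refine hB γ γ' hγ hγ0 s hs ?_
  by_contra hcon
  rw [not_lt] at hcon
  have hZ : IsCompact (Icc (0:ℝ) 1 ∩ A ⁻¹' Ici r) :=
    isCompact_Icc.of_isClosed_subset (hAc.preimage_isClosed_of_isClosed isClosed_Icc isClosed_Ici)
      inter_subset_left
  obtain ⟨s₀, ⟨hs₀, hs₀r⟩, hleast⟩ := hZ.exists_isLeast ⟨s, hs, hcon⟩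
  have hs₀r' : r ≤ A s₀ := hs₀r
  have hin : ∀ τ ∈ Ico 0 s₀, γ τ ∈ B := by
    intro τ hτ
    have hτ1 : τ ∈ Icc (0:ℝ) 1 := ⟨hτ.1, (hτ.2.trans_le hs₀.2).le⟩
    refine hB γ γ' hγ hγ0 τ hτ1 ?_
    by_contra hc
    exact absurd (hleast ⟨hτ1, not_lt.1 hc⟩) (not_le.2 hτ.2)
  have hpt : ∀ τ ∈ Ioo 0 s₀, spd g 0 0 γ γ' τ ≤ Real.exp (c₀ * t₁) * spd g t lam γ γ' τ := by
    intro τ hτ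
    have hmem := hin τ ⟨hτ.1.le, hτ.2⟩
    have hcmp := h.metric_compare (x := γ τ) ht'
      (fun t' ht'' => hric _ hmem t' ⟨ht''.1, ht''.2.trans ht.2⟩) (γ' τ)
    have h1 : nq (g (γ τ) 0) (γ' τ) ≤ Real.exp (c₀ * t₁) ^ 2 * nq (g (γ τ) t) (γ' τ) := by
      refine hcmp.trans (mul_le_mul_of_nonneg_right ?_ (nq_nonneg (h.smooth.2 _ t ht').2 _))
      rw [← Real.exp_nat_mul]
      refine Real.exp_le_exp.2 ?_
      push_cast
      nlinarith [ht.2]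
    unfold spd
    refine Real.sqrt_le_iff.2 ⟨by positivity, ?_⟩
    rw [mul_pow, Real.sq_sqrt (add_nonneg (sq_nonneg _)
      (nq_nonneg (h.smooth.2 _ t ht').2 _)), mul_add]
    have : 0 ≤ Real.exp (c₀ * t₁) ^ 2 * lam ^ 2 := by positivity
    linarith
  have hsub : uIcc (0:ℝ) s₀ ⊆ uIcc 0 1 := by
    rw [uIcc_of_le hs₀.1, uIcc_of_le zero_le_one]; exact Icc_subset_Icc_right hs₀.2
  have hint := intervalIntegral.integral_mono_on_of_le_Ioo hs₀.1 (hi0.mono_set hsub)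
    ((hit.mono_set hsub).const_mul (Real.exp (c₀ * t₁))) hpt
  rw [intervalIntegral.integral_const_mul] at hint
  have hle : ∫ τ in (0:ℝ)..s₀, spd g t lam γ γ' τ ≤ len g t lam γ γ' := by
    refine intervalIntegral.integral_mono_interval le_rfl hs₀.1 hs₀.2 ?_ hit
    exact Filter.Eventually.of_forall fun _ => Real.sqrt_nonneg _
  have e1 : Real.exp (c₀ * t₁) * (Real.exp (-(c₀ * t₁)) * r) = r := by
    rw [← mul_assoc, ← Real.exp_add]; simp
  have : Real.exp (c₀ * t₁) * len g t lam γ γ' < r := by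
    rw [← e1]; exact mul_lt_mul_of_pos_left hlen (Real.exp_pos _)
  have := mul_le_mul_of_nonneg_left hle (Real.exp_pos (c₀ * t₁)).le
  linarith [hs₀r', hint]

include h in
theorem uniform_perturb {K : Set (Fin n → ℝ)} (hK : IsCompact K) {lam ε : ℝ} (hl : 0 < lam)
    (hε : 0 < ε) : ∃ r > 0, ∀ z ∈ K, ∀ t ∈ Icc 0 T, ∀ s ∈ Icc 0 T, |s - t| < r → ∀ z' w v,
      ‖z' - z‖ < r → ‖w‖ < r →
      √(lam ^ 2 + nq (g z' s) (v + w)) ≤ (1 + ε) * √(lam ^ 2 + nq (g z t) v) := by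
  obtain ⟨c, c0, hc⟩ := h.metric_lower hK
  set B := c⁻¹ + 1 with hB
  have hB0 : 0 < B := by positivity
  set C : Set (((Fin n → ℝ) × ℝ) × ℝ × (Fin n → ℝ)) :=
    (Metric.cthickening 1 K ×ˢ Icc 0 T) ×ˢ (Icc 0 1 ×ˢ Metric.closedBall 0 (B + 1)) with hC
  have hCc : IsCompact C := (hK.cthickening.prod isCompact_Icc).prod
    (isCompact_Icc.prod (isCompact_closedBall _ _))
  have hΦ : ContinuousOn (fun p : ((Fin n → ℝ) × ℝ) × ℝ × (Fin n → ℝ) =>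
      √(p.2.1 ^ 2 + nq (g p.1.1 p.1.2) p.2.2)) C := by
    refine ((continuous_fst.comp continuous_snd).continuousOn.pow 2 |>.add ?_).sqrt
    refine continuous_nq (fun i j => (h.g_continuousOn i j).comp continuous_fst.continuousOn
      fun p hp => mem_slab hp.1.2) (continuous_snd.comp continuous_snd).continuousOn
  obtain ⟨r, hr, hunif⟩ := Metric.uniformContinuousOn_iff.1
    (hCc.uniformContinuousOn_of_continuous hΦ) ε hε
  refine ⟨min (min r 1) (min (r * lam) lam), by positivity, ?_⟩
  intro z hz t ht s hs hst z' w v hz' hw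
  simp only [lt_min_iff] at hst hz' hw
  set S := √(lam ^ 2 + nq (g z t) v) with hS
  have hq0 := nq_nonneg (h.smooth.2 z t ht).2 v
  have hSl : lam ≤ S := (le_abs_self _).trans (Real.abs_le_sqrt (by linarith))
  have hS0 : 0 < S := hl.trans_le hSl
  have hSS : S ^ 2 = lam ^ 2 + nq (g z t) v := Real.sq_sqrt (by positivity)
  have hscale : ∀ (M : Matrix (Fin n) (Fin n) ℝ) v, √(lam ^ 2 + nq M v)
      = S * √((lam / S) ^ 2 + nq M (S⁻¹ • v)) := by
    intro M v
    have : lam ^ 2 + nq M v = S ^ 2 * ((lam / S) ^ 2 + nq M (S⁻¹ • v)) := by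
      rw [nq_smul]; field_simp
    rw [this, Real.sqrt_mul (sq_nonneg _), Real.sqrt_sq hS0.le]
  have hvb : ‖S⁻¹ • v‖ ≤ B := by
    have h1 := hc z hz t ht (S⁻¹ • v)
    have h2 : 1 ≤ c * B ^ 2 := by
      have : c * B ^ 2 = c⁻¹ + 2 + c := by rw [hB]; field_simp; ring
      rw [this]; have := inv_pos.2 c0; linarith
    have h4 : nq (g z t) (S⁻¹ • v) ≤ 1 := by
      rw [nq_smul, inv_pow, inv_mul_le_iff₀ (by positivity), hSS]; nlinarith
    have h3 : c * ‖S⁻¹ • v‖ ^ 2 ≤ c * B ^ 2 := by linarith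
    exact (abs_le_of_sq_le_sq' (le_of_mul_le_mul_left h3 c0) hB0.le).2
  have hwb : ‖S⁻¹ • w‖ < r ∧ ‖S⁻¹ • w‖ ≤ 1 := by
    rw [norm_smul, norm_inv, Real.norm_of_nonneg hS0.le, inv_mul_lt_iff₀ hS0, inv_mul_le_iff₀ hS0]
    constructor <;> nlinarith
  have hm : lam / S ∈ Icc (0:ℝ) 1 := ⟨by positivity, by rw [div_le_one hS0]; exact hSl⟩
  have key := hunif ((z', s), lam / S, S⁻¹ • (v + w)) ⟨⟨?_, hs⟩, hm, ?_⟩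
    ((z, t), lam / S, S⁻¹ • v) ⟨⟨Metric.self_subset_cthickening _ hz, ht⟩, hm, ?_⟩ ?_
  · have e1 := hscale (g z t) v
    rw [← hS] at e1
    have e2 : √((lam / S) ^ 2 + nq (g z t) (S⁻¹ • v)) = 1 := by
      have : S * √((lam / S) ^ 2 + nq (g z t) (S⁻¹ • v)) = S * 1 := by rw [← e1, mul_one]
      exact mul_left_cancel₀ hS0.ne' this
    rw [Real.dist_eq] at key
    simp only [e2] at key
    have := (abs_lt.1 key).2
    rw [hscale (g z' s), mul_comm (1 + ε)]
    exact mul_le_mul_of_nonneg_left (by linarith) hS0.le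
  · refine Metric.mem_cthickening_of_dist_le z' z 1 K hz ?_
    rw [dist_eq_norm]; exact hz'.1.2.le
  · rw [mem_closedBall_zero_iff, smul_add]
    exact (norm_add_le _ _).trans (add_le_add hvb hwb.2)
  · rw [mem_closedBall_zero_iff]; linarith
  · rw [Prod.dist_eq, Prod.dist_eq, Prod.dist_eq]
    simp only [dist_eq_norm, max_lt_iff, sub_self, norm_zero, smul_add,
      add_sub_cancel_left]
    exact ⟨⟨hz'.1.1, hst.1.1⟩, hr, hwb.1⟩

end IsRFOn

end RFlow

namespace RFlow

variable {g : (Fin n → ℝ) → ℝ → Matrix (Fin n) (Fin n) ℝ} {T : ℝ}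

namespace IsRFOn

variable (h : IsRFOn g T)

include h in
theorem act_perturb {K : Set (Fin n → ℝ)} (hK : IsCompact K) {lam ε R t₁ : ℝ} (hl : 0 < lam)
    (hε : 0 < ε) (hR : 0 ≤ R) (ht₁ : t₁ ∈ Icc 0 T) {x₁ : Fin n → ℝ}
    (hconf : ∀ t ∈ Icc 0 t₁, ∀ γ γ', IsPath γ γ' → γ 0 = x₁ → len g t lam γ γ' < R →
      ∀ s ∈ Icc (0:ℝ) 1, γ s ∈ K) :
    ∃ r > 0, ∀ t ∈ Icc 0 t₁, ∀ s ∈ Icc 0 t₁, ∀ x y, |t - s| < r → ‖x - y‖ < r →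
      min (act g lam x₁ t x) R ≤ (1 + ε) * min (act g lam x₁ s y) R := by
  obtain ⟨r, hr, hper⟩ := h.uniform_perturb hK hl hε
  have hsub : Icc 0 t₁ ⊆ Icc 0 T := Icc_subset_Icc_right ht₁.2
  refine ⟨r, hr, fun t ht s hs x y hts hxy => ?_⟩
  rcases le_or_gt R (act g lam x₁ s y) with hge | hlt
  · rw [min_eq_right hge]
    exact (min_le_right _ _).trans (by nlinarith)
  · rw [min_eq_left hlt.le]
    refine (min_le_left _ _).trans ?_
    have hb : ∀ b, act g lam x₁ s y < b → b < R → (1 + ε)⁻¹ * act g lam x₁ t x ≤ b := by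
      intro b hb hbR
      obtain ⟨γ, γ', hγ, h0, h1, hlen⟩ := exists_len_lt hb
      have hin := hconf s hs γ γ' hγ h0 (hlen.trans hbR)
      have hp : IsPath (fun τ => γ τ + τ • (x - y)) fun τ => γ' τ + (x - y) := by
        refine ⟨fun τ hτ => (hγ.1 τ hτ).add ?_, hγ.2.add continuousOn_const⟩
        have := (hasDerivAt_id τ).smul_const (x - y)
        rw [one_smul] at this
        exact this.hasDerivWithinAt
      have hle := act_le (g := g) (lam := lam) (t := t) hp
      simp only [zero_smul, add_zero, one_smul, h0, h1, add_sub_cancel] at hle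
      have hmono : len g t lam (fun τ => γ τ + τ • (x - y)) (fun τ => γ' τ + (x - y))
          ≤ (1 + ε) * len g s lam γ γ' := by
        unfold len
        rw [← intervalIntegral.integral_const_mul]
        refine intervalIntegral.integral_mono_on zero_le_one
          (h.spd_intervalIntegrable (hsub ht) lam hp)
          ((h.spd_intervalIntegrable (hsub hs) lam hγ).const_mul _) fun τ hτ => ?_
        refine hper _ (hin τ hτ) s (hsub hs) t (hsub ht) hts _ _ _ ?_ hxy
        rw [add_sub_cancel_left, norm_smul, Real.norm_of_nonneg hτ.1]
        nlinarith [hτ.2, norm_nonneg (x - y)]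
      rw [inv_mul_le_iff₀ (by positivity)]
      nlinarith
    have := le_of_forall_gt_imp_ge_of_dense (a₁ := (1 + ε)⁻¹ * act g lam x₁ t x)
      (a₂ := act g lam x₁ s y) fun b hb' => by
        rcases lt_or_ge b R with hbR | hbR
        · exact hb b hb' hbR
        · obtain ⟨b', h1, h2⟩ := exists_between hlt
          exact (hb b' h1 h2).trans (by linarith)
    rwa [inv_mul_le_iff₀ (by positivity)] at this

include h in
theorem act_continuousOn {K : Set (Fin n → ℝ)} (hK : IsCompact K) {lam R t₁ : ℝ} (hl : 0 < lam)
    (hR : 0 ≤ R) (ht₁ : t₁ ∈ Icc 0 T) {x₁ : Fin n → ℝ}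
    (hconf : ∀ t ∈ Icc 0 t₁, ∀ γ γ', IsPath γ γ' → γ 0 = x₁ → len g t lam γ γ' < R →
      ∀ s ∈ Icc (0:ℝ) 1, γ s ∈ K) :
    ContinuousOn (fun p : (Fin n → ℝ) × ℝ => min (act g lam x₁ p.2 p.1) R) (univ ×ˢ Icc 0 t₁) := by
  refine UniformContinuousOn.continuousOn (Metric.uniformContinuousOn_iff.2 fun η hη => ?_)
  obtain ⟨r, hr, hper⟩ := h.act_perturb hK hl (ε := η / (R + 1)) (by positivity) hR ht₁ hconf
  have hone : ∀ t ∈ Icc 0 t₁, ∀ s ∈ Icc 0 t₁, ∀ x y, |t - s| < r → ‖x - y‖ < r →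
      min (act g lam x₁ t x) R - min (act g lam x₁ s y) R < η := by
    intro t ht s hs x y hts hxy
    have h1 := hper t ht s hs x y hts hxy
    have h2 : η / (R + 1) * min (act g lam x₁ s y) R ≤ η / (R + 1) * R :=
      mul_le_mul_of_nonneg_left (min_le_right _ _) (by positivity)
    have h3 : η / (R + 1) * R < η := by
      rw [div_mul_eq_mul_div, div_lt_iff₀ (by positivity)]; nlinarith
    linarith
  refine ⟨r, hr, fun p hp q hq hpq => ?_⟩
  rw [Prod.dist_eq, max_lt_iff, dist_eq_norm, Real.dist_eq] at hpq
  rw [Real.dist_eq, abs_sub_lt_iff]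
  exact ⟨hone _ hp.2 _ hq.2 _ _ hpq.2 hpq.1, hone _ hq.2 _ hp.2 _ _
    (by rw [abs_sub_comm]; exact hpq.2) (by rw [norm_sub_rev]; exact hpq.1)⟩

end IsRFOn

end RFlow

namespace RFlow

variable {g : (Fin n → ℝ) → ℝ → Matrix (Fin n) (Fin n) ℝ} {T : ℝ}

open Filter Topology in
theorem eventually_nhdsGT_zero {P : ℝ → Prop} (hP : ∃ h₀ > 0, ∀ s, 0 < s → s < h₀ → P s) :
    ∀ᶠ s in 𝓝[>] (0:ℝ), P s := by
  obtain ⟨h₀, h0, hs⟩ := hP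
  filter_upwards [Ioo_mem_nhdsGT h0] with s hs' using hs s hs'.1 hs'.2

namespace IsRFOn

variable (h : IsRFOn g T)

open Filter Topology in
/-- At an interior maximum of `e^{-at} u - κ N - c t` the constant `c` cannot be too large. -/
theorem no_interior_max {K D : Set (Fin n → ℝ)} (hK : IsCompact K) (hDK : D ⊆ K)
    (hDo : IsOpen D) {x₁ x : Fin n → ℝ} {t c₀ lam κ a c R : ℝ} (ht : t ∈ Ioc 0 T) (hx : x ∈ D)
    (hl : 0 < lam) (hκ : 0 ≤ κ) (ha : 0 ≤ a) (hc₀ : 0 ≤ c₀)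
    (hR : act g lam x₁ t x < R)
    (hconf : ∀ γ γ', IsPath γ γ' → γ 0 = x₁ → γ 1 = x → len g t lam γ γ' < R →
      ∀ s ∈ Icc (0:ℝ) 1, γ s ∈ D)
    (hric : ∀ y ∈ D, ∀ ξ, nq (h.rc y t) ξ ≤ c₀ * nq (g y t) ξ)
    (hU : 0 < extS h.u (x, t))
    (hau : 20 * n ^ 6 * √(extS h.u (x, t)) ≤ a)
    (hc : κ * (2 * n / lam + 2 * c₀ * lam) < c)
    (hmax : ∀ y ∈ D, ∀ s, 0 ≤ s → s ≤ t →
      Real.exp (-(a * s)) * extS h.u (y, s) - κ * min (act g lam x₁ s y) R - c * s ≤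
      Real.exp (-(a * t)) * extS h.u (x, t) - κ * act g lam x₁ t x - c * t) : False := by
  have ht' : t ∈ Icc 0 T := ⟨ht.1.le, ht.2⟩
  obtain ⟨E, hE⟩ := exists_orthonormal_frame (h.smooth.2 x t ht').2
  set U := extS h.u (x, t) with hUdef
  set N := act g lam x₁ t x with hN
  set μ := c - κ * (2 * n / lam + 2 * c₀ * lam) with hμ
  have hμ0 : 0 < μ := by rw [hμ]; linarith
  have hδ : 0 < μ / (2 * (κ + 1)) := by positivity
  have hη : 0 < μ / (4 * (a + 1)) := by positivity
  have ev1 := eventually_nhdsGT_zero (h.discrete_heat ht hE hδ)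
  have ev2 := eventually_nhdsGT_zero (h.act_barrier ht hK hDK hl hE hR hconf hc₀ hric hδ)
  have hcont : ∀ V : Fin n → ℝ, Continuous fun s => h.ncurve t x V s := by
    intro V; unfold ncurve; fun_prop
  have ev3 : ∀ᶠ s in 𝓝[>] (0:ℝ), ∀ i, h.ncurve t x (Eᵀ i) s ∈ D ∧
      h.ncurve t x (Eᵀ i) (-s) ∈ D := by
    refine eventually_all.2 fun i => (Eventually.and ?_ ?_).filter_mono nhdsWithin_le_nhds
    · refine (hcont _).continuousAt.eventually_mem ?_
      simpa [ncurve] using hDo.mem_nhds hx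
    · refine ((hcont _).comp continuous_neg).continuousAt.eventually_mem ?_
      simpa [ncurve] using hDo.mem_nhds hx
  have ev4 : ∀ᶠ s in 𝓝[>] (0:ℝ), s ^ 2 ≤ t → max 0 (U - μ / (4 * (a + 1))) < extS h.u (x, t - s ^ 2) := by
    have hcu := (extS_contDiffOn h.u).continuousOn (x, t) (mem_slab ht')
    have hev := hcu.eventually (lt_mem_nhds (show max 0 (U - μ / (4 * (a + 1))) < extS h.u (x, t) by
      rw [← hUdef]; exact max_lt hU (by linarith)))
    rw [eventually_nhdsWithin_iff] at hev
    have hc2 : Continuous fun s : ℝ => (x, t - s ^ 2) := by fun_prop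
    have h0 : Tendsto (fun s : ℝ => (x, t - s ^ 2)) (𝓝[>] 0) (𝓝 (x, t)) := by
      have := hc2.tendsto 0
      simp only [ne_eq, OfNat.ofNat_ne_zero, not_false_eq_true, zero_pow, sub_zero] at this
      exact this.mono_left nhdsWithin_le_nhds
    filter_upwards [h0.eventually hev] with s hs hst
    exact hs (mem_slab ⟨by linarith, by nlinarith [ht.2, sq_nonneg s]⟩)
  obtain ⟨s, ⟨hst, h1⟩, ⟨-, h2⟩, h3, h4, hs0⟩ :=
    (ev1.and (ev2.and (ev3.and (ev4.and self_mem_nhdsWithin)))).exists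
  have hs0 : 0 < s := hs0
  obtain ⟨h4, h5⟩ := max_lt_iff.1 (h4 hst)
  set u' := extS h.u (x, t - s ^ 2) with hu'
  set N' := act g lam x₁ (t - s ^ 2) x with hN'
  set e := Real.exp (-(a * t)) with he
  have he0 : 0 < e := Real.exp_pos _
  have he1 : e ≤ 1 := Real.exp_le_one_iff.2 (by have := mul_nonneg ha ht.1.le; linarith)
  have hsp : ∀ y ∈ D, e * extS h.u (y, t) - e * U ≤ κ * (act g lam x₁ t y - N) := by
    intro y hy
    have := hmax y hy t ht.1.le le_rfl
    have hm := mul_le_mul_of_nonneg_left (min_le_left (act g lam x₁ t y) R) hκ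
    linarith
  have hsum : e * ∑ i, (extS h.u (h.ncurve t x (Eᵀ i) s, t)
      + extS h.u (h.ncurve t x (Eᵀ i) (-s), t) - 2 * U) ≤
      κ * ∑ i, (act g lam x₁ t (h.ncurve t x (Eᵀ i) s)
        + act g lam x₁ t (h.ncurve t x (Eᵀ i) (-s)) - 2 * N) := by
    rw [Finset.mul_sum, Finset.mul_sum]
    refine Finset.sum_le_sum fun i _ => ?_
    have ha := hsp _ (h3 i).1
    have hb := hsp _ (h3 i).2
    linarith
  have htime : e * (1 + a * s ^ 2) * u' - e * U ≤ κ * (N' - N) - c * s ^ 2 := by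
    have := hmax x hx (t - s ^ 2) (by linarith) (by nlinarith [sq_nonneg s])
    have hm := mul_le_mul_of_nonneg_left (min_le_left N' R) hκ
    have hexp : e * (1 + a * s ^ 2) ≤ Real.exp (-(a * (t - s ^ 2))) := by
      have : Real.exp (-(a * (t - s ^ 2))) = e * Real.exp (a * s ^ 2) := by
        rw [he, ← Real.exp_add]; ring_nf
      rw [this]
      exact mul_le_mul_of_nonneg_left (by linarith [Real.add_one_le_exp (a * s ^ 2)]) he0.le
    have := mul_le_mul_of_nonneg_right hexp h4.le
    linarith
  have h1' := mul_le_mul_of_nonneg_left h1 he0.le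
  have h2' := mul_le_mul_of_nonneg_left h2 hκ
  have hss : 0 < s ^ 2 := by positivity
  have hA : 20 * n ^ 6 * (U * √U) ≤ a * U := by
    have := mul_le_mul_of_nonneg_right hau hU.le
    linarith
  have hB : a * U - μ / 4 ≤ a * u' := by
    have : a * (μ / (4 * (a + 1))) ≤ μ / 4 := by
      rw [mul_div_assoc', div_le_div_iff₀ (by positivity) (by norm_num)]; nlinarith
    have := mul_le_mul_of_nonneg_left h5.le ha
    linarith
  have hC : (κ + 1) * (μ / (2 * (κ + 1))) = μ / 2 := by field_simp
  set δ := μ / (2 * (κ + 1))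
  have hfin : s ^ 2 * (e * (a * u' - (20 * n ^ 6 * (U * √U) + δ))) ≤
      s ^ 2 * (κ * (2 * n / lam + 2 * c₀ * lam + δ) - c) := by
    linarith
  have hfin := le_of_mul_le_mul_left hfin hss
  have hlow : -(μ / 4 + δ) ≤ e * (a * u' - (20 * n ^ 6 * (U * √U) + δ)) := by
    have h6 : -(μ / 4 + δ) ≤ a * u' - (20 * n ^ 6 * (U * √U) + δ) := by linarith
    have h7 : 0 < μ / 4 + δ := by linarith
    nlinarith [mul_le_mul_of_nonneg_left h6 he0.le]
  linarith

end IsRFOn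

end RFlow

namespace RFlow

variable {g : (Fin n → ℝ) → ℝ → Matrix (Fin n) (Fin n) ℝ} {T : ℝ}

namespace IsRFOn

variable (h : IsRFOn g T)

/-- Localized maximum principle for `|Rm|²` with the regularized distance as barrier. -/
theorem localized_bound {K D : Set (Fin n → ℝ)} (hK : IsCompact K) (hDK : D ⊆ K)
    (hDo : IsOpen D) {x₁ : Fin n → ℝ} {t₁ c₀ lam κ a c r b Um : ℝ} (ht₁ : t₁ ∈ Ioc 0 T)
    (hx₁ : x₁ ∈ D) (hr : 0 < r) (hl : 0 < lam) (hκ : 0 ≤ κ) (ha : 0 ≤ a) (hc₀ : 0 ≤ c₀)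
    (hB : ∀ γ γ', IsPath γ γ' → γ 0 = x₁ → ∀ s ∈ Icc (0:ℝ) 1,
      ∫ τ in (0:ℝ)..s, spd g 0 0 γ γ' τ < r → γ s ∈ D)
    (hric : ∀ y ∈ D, ∀ t ∈ Icc 0 t₁, ∀ ξ, nq (h.rc y t) ξ ≤ c₀ * nq (g y t) ξ)
    (hUm : ∀ y ∈ K, ∀ t ∈ Icc 0 t₁, extS h.u (y, t) ≤ Um)
    (hκR : Um ≤ κ * (Real.exp (-(c₀ * t₁)) * r))
    (hau : 20 * n ^ 6 * √Um ≤ a) (hb : 0 ≤ b)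
    (hu0 : ∀ y ∈ D, extS h.u (y, 0) ≤ b)
    (hc : κ * (2 * n / lam + 2 * c₀ * lam) < c) :
    Real.exp (-(a * t₁)) * extS h.u (x₁, t₁) ≤ b + κ * lam + c * t₁ := by
  have ht₁' : t₁ ∈ Icc 0 T := ⟨ht₁.1.le, ht₁.2⟩
  set R := Real.exp (-(c₀ * t₁)) * r with hR
  have hR0 : 0 < R := by positivity
  have hconf : ∀ t ∈ Icc 0 t₁, ∀ γ γ', IsPath γ γ' → γ 0 = x₁ → len g t lam γ γ' < R →
      ∀ s ∈ Icc (0:ℝ) 1, γ s ∈ D := fun t ht γ γ' hγ hγ0 hlen s hs =>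
    h.path_confined ht₁' ht hc₀ hB hric hγ hγ0 hlen hs
  have hc0 : 0 ≤ c := by
    refine le_trans ?_ hc.le
    positivity
  set W : (Fin n → ℝ) × ℝ → ℝ := fun p => Real.exp (-(a * p.2)) * extS h.u p
    - κ * min (act g lam x₁ p.2 p.1) R - c * p.2 with hW
  have hWc : ContinuousOn W (K ×ˢ Icc 0 t₁) := by
    have hM := (h.act_continuousOn hK hl hR0.le ht₁'
      (fun t ht γ γ' hγ h0 hlen s hs => hDK (hconf t ht γ γ' hγ h0 hlen s hs))).mono
      (prod_mono_left (subset_univ K))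
    have hu : ContinuousOn (extS h.u) (K ×ˢ Icc 0 t₁) := (extS_contDiffOn h.u).continuousOn.mono
      (prod_mono (subset_univ K) (Icc_subset_Icc_right ht₁.2))
    have he : Continuous fun p : (Fin n → ℝ) × ℝ => Real.exp (-(a * p.2)) := by fun_prop
    exact ((he.continuousOn.mul hu).sub (continuousOn_const.mul hM)).sub
      (continuous_const.mul continuous_snd).continuousOn
  obtain ⟨⟨x, t⟩, ⟨hx, ht⟩, hmax⟩ := (hK.prod isCompact_Icc).exists_isMaxOn
    ⟨(x₁, t₁), hDK hx₁, right_mem_Icc.2 ht₁.1.le⟩ hWc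
  simp only at hx ht
  have hend : W (x, t) ≤ b := by
    by_contra hcon
    rw [not_le] at hcon
    set N := act g lam x₁ t x with hN
    have hN0 : 0 ≤ N := act_nonneg _ _ _ _
    have he0 := Real.exp_pos (-(a * t))
    have he1 : Real.exp (-(a * t)) ≤ 1 :=
      Real.exp_le_one_iff.2 (by have := mul_nonneg ha ht.1; linarith)
    have hWx : b < Real.exp (-(a * t)) * extS h.u (x, t) - κ * min N R - c * t := hcon
    have hm0 : 0 ≤ min N R := le_min hN0 hR0.le
    have hct := mul_nonneg hc0 ht.1
    have hκm := mul_nonneg hκ hm0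
    have heU : 0 < Real.exp (-(a * t)) * extS h.u (x, t) := by linarith
    have hU : 0 < extS h.u (x, t) := pos_of_mul_pos_right heU he0.le
    have hUU := hUm x hx t ht
    have hNR : N < R := by
      by_contra hge
      rw [min_eq_right (not_lt.1 hge)] at hWx
      nlinarith
    have hxD : x ∈ D := by
      obtain ⟨γ, γ', hγ, h0, h1, hlen⟩ := exists_len_lt hNR
      rw [← h1]
      exact hconf t ht γ γ' hγ h0 hlen 1 (by simp)
    have htpos : 0 < t := by
      rcases ht.1.eq_or_lt with h0 | h0
      · rw [← h0] at hWx hct hU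
        have := hu0 x hxD
        have e : Real.exp (-(a * (0:ℝ))) = 1 := by simp
        rw [e] at hWx
        have : 0 ≤ κ * min N R := mul_nonneg hκ hm0
        linarith
      · exact h0
    refine h.no_interior_max hK hDK hDo ⟨htpos, ht.2.trans ht₁.2⟩ hxD hl hκ ha hc₀ hNR
      (fun γ γ' hγ h0 _ hlen => hconf t ht γ γ' hγ h0 hlen)
      (fun y hy => hric y hy t ht) hU (le_trans ?_ hau) hc fun y hy s hs0 hst => ?_
    · exact mul_le_mul_of_nonneg_left (Real.sqrt_le_sqrt hUU) (by positivity)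
    · have := hmax (show (y, s) ∈ K ×ˢ Icc 0 t₁ from ⟨hDK hy, hs0, hst.trans ht.2⟩)
      simp only [hW, mem_ofPred_eq] at this
      rwa [min_eq_left (show act g lam x₁ t x ≤ R from hNR.le)] at this
  have hfirst := (hmax (show (x₁, t₁) ∈ K ×ˢ Icc 0 t₁ from ⟨hDK hx₁, right_mem_Icc.2 ht₁.1.le⟩))
  have hact : act g lam x₁ t₁ x₁ ≤ lam := by
    have := act_le (g := g) (lam := lam) (t := t₁) (isPath_segment x₁ x₁)
    simpa [len, spd, nq, Real.sqrt_sq hl.le] using this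
  have hm : κ * min (act g lam x₁ t₁ x₁) R ≤ κ * lam :=
    mul_le_mul_of_nonneg_left ((min_le_left _ _).trans hact) hκ
  have : W (x₁, t₁) ≤ b := hfirst.trans hend
  simp only [hW] at this
  linarith

end IsRFOn

/-- The exponent in the final estimate. -/
def expConst (n : ℕ) : ℝ := 2 * (80 * n ^ 6 + 12 * n ^ 2 + 2 * n + 5)

theorem numeric_bound {n : ℕ} {m k E : ℝ} (hm : 1 ≤ m) (hk : 1 ≤ k)
    (hE : Real.exp (-(80 * n ^ 6 * k)) ≤ E)
    (h : E ≤ 1 / m ^ 4 + 32 * Real.exp (4 * n ^ 2 * k) * (1 + (2 * n + 8 * n ^ 2 + 1) * k) / m) :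
    m ^ 2 ≤ Real.exp (expConst n * k) := by
  have hm0 : 0 < m := by linarith
  set D : ℝ := 2 * n + 8 * n ^ 2 + 1 with hD
  have h1 : 1 / m ^ 4 ≤ 1 / m :=
    one_div_le_one_div_of_le hm0 (by simpa using pow_le_pow_right₀ hm (show 1 ≤ 4 by norm_num))
  have hX1 : 1 + D * k ≤ Real.exp (D * k) := by linarith [Real.add_one_le_exp (D * k)]
  have hX : 32 * Real.exp (4 * n ^ 2 * k) * (1 + D * k) ≤ 32 * Real.exp (4 * n ^ 2 * k + D * k) := by
    rw [Real.exp_add, ← mul_assoc]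
    exact mul_le_mul_of_nonneg_left hX1 (by positivity)
  have h4 : (33:ℝ) ≤ Real.exp (4 * k) := by
    have h5 : (2.7:ℝ) ≤ Real.exp 1 := by linarith [Real.exp_one_gt_d9]
    have : Real.exp 1 ^ 4 = Real.exp 4 := by rw [← Real.exp_nat_mul]; norm_num
    have h6 : (2.7:ℝ) ^ 4 ≤ Real.exp 1 ^ 4 := pow_le_pow_left₀ (by norm_num) h5 4
    have h7 : Real.exp 4 ≤ Real.exp (4 * k) := Real.exp_le_exp.2 (by linarith)
    norm_num at h6
    linarith
  have h8 : 1 ≤ Real.exp (4 * n ^ 2 * k + D * k) := Real.one_le_exp (by positivity)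
  have h9 : 1 + 32 * Real.exp (4 * n ^ 2 * k) * (1 + D * k)
      ≤ Real.exp (4 * k) * Real.exp (4 * n ^ 2 * k + D * k) := by nlinarith
  have h10 : Real.exp (-(80 * n ^ 6 * k)) * m
      ≤ Real.exp (4 * k) * Real.exp (4 * n ^ 2 * k + D * k) := by
    refine le_trans ?_ h9
    have := (hE.trans h).trans (add_le_add_left h1 _)
    rw [← add_div, le_div_iff₀ hm0] at this
    exact this
  have h11 : m ≤ Real.exp ((80 * n ^ 6 + 12 * n ^ 2 + 2 * n + 5) * k) := by
    have h12 := mul_le_mul_of_nonneg_left h10 (Real.exp_pos (80 * n ^ 6 * k)).le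
    rw [← mul_assoc, ← Real.exp_add, ← Real.exp_add, ← Real.exp_add, add_neg_cancel,
      Real.exp_zero, one_mul] at h12
    refine h12.trans (Real.exp_le_exp.2 (le_of_eq ?_))
    rw [hD]; ring
  calc m ^ 2 ≤ Real.exp ((80 * n ^ 6 + 12 * n ^ 2 + 2 * n + 5) * k) ^ 2 :=
        pow_le_pow_left₀ hm0.le h11 2
    _ = _ := by rw [← Real.exp_nat_mul, expConst]; push_cast; ring_nf

namespace IsRFOn

variable (h : IsRFOn g T)

theorem scale_bound {K D : Set (Fin n → ℝ)} (hK : IsCompact K) (hDK : D ⊆ K)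
    (hDo : IsOpen D) {x₁ : Fin n → ℝ} {t₁ q ρ k : ℝ} (ht₁ : t₁ ∈ Ioc 0 T)
    (hx₁ : x₁ ∈ D) (hq : 0 < q) (hρ : 0 < ρ) (hk : 1 ≤ k) (hqt : q ^ 2 * t₁ ≤ k)
    (hB : ∀ γ γ', IsPath γ γ' → γ 0 = x₁ → ∀ s ∈ Icc (0:ℝ) 1,
      ∫ τ in (0:ℝ)..s, spd g 0 0 γ γ' τ < ρ / 2 → γ s ∈ D)
    (hUm : ∀ y ∈ K, ∀ t ∈ Icc 0 t₁, extS h.u (y, t) ≤ (4 * q ^ 2) ^ 2)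
    (hu0 : ∀ y ∈ D, extS h.u (y, 0) ≤ 1 / ρ ^ 4)
    (hu1 : extS h.u (x₁, t₁) = q ^ 4) :
    (ρ * q) ^ 2 ≤ Real.exp (expConst n * k) := by
  rcases lt_or_ge (ρ * q) 1 with hm | hm
  · refine le_trans (pow_le_one₀ (by positivity) hm.le) (Real.one_le_exp ?_)
    unfold expConst; positivity
  set c₀ : ℝ := n ^ 2 * (4 * q ^ 2) with hc₀
  set e := Real.exp (c₀ * t₁) with he
  have he0 : 0 < e := Real.exp_pos _
  set κ : ℝ := 32 * q ^ 4 * e / ρ with hκ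
  have hκ0 : 0 < κ := by positivity
  set D' : ℝ := 2 * n + 8 * n ^ 2 + 1 with hD'
  have hbound := h.localized_bound hK hDK hDo (lam := 1 / q) (κ := κ) (a := 80 * n ^ 6 * q ^ 2)
    (c := κ * q * D') (c₀ := c₀) (r := ρ / 2) (b := 1 / ρ ^ 4) (Um := (4 * q ^ 2) ^ 2) ht₁ hx₁
    (by positivity) (by positivity) hκ0.le (by positivity) (by positivity) hB ?_ hUm ?_ ?_
    (by positivity) hu0 ?_
  · have ht0 := ht₁.1
    rw [hu1] at hbound
    refine numeric_bound hm hk (E := Real.exp (-(80 * n ^ 6 * q ^ 2 * t₁))) ?_ ?_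
    · refine Real.exp_le_exp.2 (neg_le_neg ?_)
      rw [mul_assoc _ (q ^ 2)]
      exact mul_le_mul_of_nonneg_left hqt (by positivity)
    · have h1 : κ * (1 / q) + κ * q * D' * t₁ = κ / q * (1 + D' * (q ^ 2 * t₁)) := by
        field_simp
      have h2 : κ / q ≤ q ^ 4 * (32 * Real.exp (4 * n ^ 2 * k) / (ρ * q)) := by
        have : e ≤ Real.exp (4 * n ^ 2 * k) := by
          refine Real.exp_le_exp.2 ?_
          have : c₀ * t₁ = 4 * n ^ 2 * (q ^ 2 * t₁) := by rw [hc₀]; ring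
          rw [this]
          exact mul_le_mul_of_nonneg_left hqt (by positivity)
        have e2 : κ / q = q ^ 4 * (32 * e / (ρ * q)) := by rw [hκ]; field_simp
        rw [e2]
        gcongr
      have h3 : 1 + D' * (q ^ 2 * t₁) ≤ 1 + D' * k := by
        have := mul_le_mul_of_nonneg_left hqt (show 0 ≤ D' by positivity)
        linarith
      have h4 : κ / q * (1 + D' * (q ^ 2 * t₁)) ≤
          q ^ 4 * (32 * Real.exp (4 * n ^ 2 * k) / (ρ * q)) * (1 + D' * k) :=
        mul_le_mul h2 h3 (by positivity) (by positivity)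
      have h5 : (1:ℝ) / ρ ^ 4 = q ^ 4 * (1 / (ρ * q) ^ 4) := by field_simp
      have h6 : q ^ 4 * Real.exp (-(80 * n ^ 6 * q ^ 2 * t₁)) ≤ q ^ 4 * (1 / (ρ * q) ^ 4
          + 32 * Real.exp (4 * n ^ 2 * k) * (1 + D' * k) / (ρ * q)) := by
        have e3 : 32 * Real.exp (4 * n ^ 2 * k) * (1 + D' * k) / (ρ * q)
          = 32 * Real.exp (4 * n ^ 2 * k) / (ρ * q) * (1 + D' * k) := by ring
        rw [mul_add, e3, ← h5, ← mul_assoc]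
        linarith
      exact le_of_mul_le_mul_left h6 (by positivity)
  · intro y hy t ht ξ
    have ht' : t ∈ Icc 0 T := ⟨ht.1, ht.2.trans ht₁.2⟩
    refine (h.rc_le ht' y ξ).trans (mul_le_mul_of_nonneg_right ?_
      (nq_nonneg (h.smooth.2 y t ht').2 ξ))
    refine mul_le_mul_of_nonneg_left ?_ (by positivity)
    exact Real.sqrt_le_iff.2 ⟨by positivity, hUm y (hDK hy) t ht⟩
  · have : Real.exp (-(c₀ * t₁)) * e = 1 := by rw [he, ← Real.exp_add]; simp
    have e4 : κ * (Real.exp (-(c₀ * t₁)) * (ρ / 2)) = 16 * q ^ 4 * (Real.exp (-(c₀ * t₁)) * e) := by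
      rw [hκ]; field_simp; ring
    rw [e4, this]; exact le_of_eq (by ring)
  · rw [Real.sqrt_sq (by positivity)]
    exact le_of_eq (by ring)
  · have : κ * (2 * n / (1 / q) + 2 * c₀ * (1 / q)) = κ * q * (2 * n + 8 * n ^ 2) := by
      rw [hc₀]; field_simp; ring
    rw [this, hD']
    have : 0 < κ * q := by positivity
    nlinarith

end IsRFOn

end RFlow

namespace RFlow

variable {g : (Fin n → ℝ) → ℝ → Matrix (Fin n) (Fin n) ℝ} {T : ℝ}

theorem pathLength_eq (t : ℝ) {γ γ' : ℝ → Fin n → ℝ} (hγ : IsPath γ γ') :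
    pathLength (fun y => g y t) γ = len g t 0 γ γ' := by
  unfold pathLength len
  refine intervalIntegral.integral_congr_ae ?_
  have h1 : ∀ᵐ s : ℝ, s ≠ 1 := by simp [ae_iff]
  filter_upwards [h1] with s hs1 hs
  rw [uIoc_of_le zero_le_one] at hs
  have hd := (hγ.1 s ⟨hs.1.le, hs.2⟩).hasDerivAt (Icc_mem_nhds hs.1 (lt_of_le_of_ne hs.2 hs1))
  rw [hd.deriv, spd, nq]
  simp

theorem riemDist_eq (x y : Fin n → ℝ) (t : ℝ) :
    riemDist (fun y => g y t) x y = act g 0 x t y := by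
  unfold riemDist act
  congr 1
  ext L
  constructor
  · rintro ⟨γ, hγ, h0, h1, rfl⟩
    have hp : IsPath γ (derivWithin γ (Icc 0 1)) :=
      ⟨fun s hs => (hγ.differentiableOn one_ne_zero s hs).hasDerivWithinAt,
        hγ.continuousOn_derivWithin (uniqueDiffOn_Icc zero_lt_one) le_rfl⟩
    exact ⟨γ, _, hp, h0, h1, pathLength_eq t hp⟩
  · rintro ⟨γ, γ', hγ, h0, h1, rfl⟩
    refine ⟨γ, ?_, h0, h1, (pathLength_eq t hγ).symm⟩
    refine (contDiffOn_one_iff_derivWithin (uniqueDiffOn_Icc zero_lt_one)).2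
      ⟨fun s hs => (hγ.1 s hs).differentiableWithinAt, hγ.2.congr fun s hs => ?_⟩
    exact (hγ.1 s hs).derivWithin (uniqueDiffOn_Icc zero_lt_one s hs)

theorem nq_smul_sqrt {M : Matrix (Fin n) (Fin n) ℝ} {c : ℝ} (hc : 0 ≤ c) (v : Fin n → ℝ) :
    √(nq M (c • v)) = √(nq M v) * c := by
  rw [nq_smul, Real.sqrt_mul (sq_nonneg _), Real.sqrt_sq hc, mul_comm]

theorem deriv_smoothTransition_nonneg (x : ℝ) : 0 ≤ deriv Real.smoothTransition x :=
  Real.smoothTransition.monotone.deriv_nonneg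

theorem deriv_smoothTransition_of_nonpos {x : ℝ} (hx : x ≤ 0) :
    deriv Real.smoothTransition x = 0 := by
  refine IsLocalMin.deriv_eq_zero (Filter.Eventually.of_forall fun y => ?_)
  rw [Real.smoothTransition.zero_of_nonpos hx]
  exact Real.smoothTransition.nonneg y

theorem deriv_smoothTransition_of_one_le {x : ℝ} (hx : 1 ≤ x) :
    deriv Real.smoothTransition x = 0 := by
  refine IsLocalMax.deriv_eq_zero (Filter.Eventually.of_forall fun y => ?_)
  rw [Real.smoothTransition.one_of_one_le hx]
  exact Real.smoothTransition.le_one y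

namespace IsRFOn

variable (h : IsRFOn g T)

include h in
theorem act_concat {x₀ : Fin n → ℝ} {t : ℝ} (ht : t ∈ Icc 0 T) {γ γ' : ℝ → Fin n → ℝ}
    (hγ : IsPath γ γ') {s : ℝ} (hs : s ∈ Icc (0:ℝ) 1) :
    act g 0 x₀ t (γ s) ≤ act g 0 x₀ t (γ 0) + ∫ τ in (0:ℝ)..s, spd g t 0 γ γ' τ := by
  rw [← sub_le_iff_le_add]
  refine le_of_forall_gt_imp_ge_of_dense fun b hb => ?_
  obtain ⟨β, β', hβ, hβ0, hβ1, hlen⟩ := exists_len_lt hb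
  rw [sub_le_iff_le_add]
  set ψ := Real.smoothTransition with hψ
  have hψd : Differentiable ℝ ψ := (Real.smoothTransition.contDiff (n := 1)).differentiable (by simp)
  have hψc : Continuous (deriv ψ) :=
    (Real.smoothTransition.contDiff (n := 1)).continuous_deriv (by simp)
  set A : ℝ → ℝ := fun τ => ψ (2 * τ) with hA
  set A' : ℝ → ℝ := fun τ => 2 * deriv ψ (2 * τ) with hA'
  set B : ℝ → ℝ := fun τ => s * ψ (2 * τ - 1) with hB
  set B' : ℝ → ℝ := fun τ => 2 * s * deriv ψ (2 * τ - 1) with hB'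
  have hAd : ∀ τ, HasDerivAt A (A' τ) τ := by
    intro τ
    have := (hψd (2 * τ)).hasDerivAt.comp τ ((hasDerivAt_id τ).const_mul 2)
    refine this.congr_deriv ?_
    rw [hA']; ring
  have hBd : ∀ τ, HasDerivAt B (B' τ) τ := by
    intro τ
    have := ((hψd (2 * τ - 1)).hasDerivAt.comp τ
      (((hasDerivAt_id τ).const_mul 2).sub_const 1)).const_mul s
    refine this.congr_deriv ?_
    rw [hB']; ring
  have hA'c : Continuous A' := by
    have := hψc.comp (continuous_const.mul continuous_id : Continuous fun τ : ℝ => 2 * τ)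
    exact continuous_const.mul this
  have hB'c : Continuous B' := by
    have := hψc.comp (by fun_prop : Continuous fun τ : ℝ => 2 * τ - 1)
    exact continuous_const.mul this
  have hAc : Continuous A := continuous_iff_continuousAt.2 fun τ => (hAd τ).continuousAt
  have hBc : Continuous B := continuous_iff_continuousAt.2 fun τ => (hBd τ).continuousAt
  have hA1 : ∀ τ, A τ ∈ Icc (0:ℝ) 1 := fun τ =>
    ⟨Real.smoothTransition.nonneg _, Real.smoothTransition.le_one _⟩
  have hBs : ∀ τ, B τ ∈ Icc (0:ℝ) s := fun τ =>
    ⟨mul_nonneg hs.1 (Real.smoothTransition.nonneg _),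
      mul_le_of_le_one_right hs.1 (Real.smoothTransition.le_one _)⟩
  have hB1 : ∀ τ, B τ ∈ Icc (0:ℝ) 1 := fun τ => ⟨(hBs τ).1, (hBs τ).2.trans hs.2⟩
  set α : ℝ → Fin n → ℝ := fun τ => β (A τ) + γ (B τ) - γ 0 with hα
  set α' : ℝ → Fin n → ℝ := fun τ => A' τ • β' (A τ) + B' τ • γ' (B τ) with hα'
  have hp : IsPath α α' := by
    constructor
    · intro τ hτ
      have h1 := (hβ.1 (A τ) (hA1 τ)).scomp τ (hAd τ).hasDerivWithinAt
        (s := Icc 0 1) fun x _ => hA1 x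
      have h2 := (hγ.1 (B τ) (hB1 τ)).scomp τ (hBd τ).hasDerivWithinAt
        (s := Icc 0 1) fun x _ => hB1 x
      exact (h1.add h2).sub_const _
    · exact (hA'c.continuousOn.smul (hβ.2.comp hAc.continuousOn fun x _ => hA1 x)).add
        (hB'c.continuousOn.smul (hγ.2.comp hBc.continuousOn fun x _ => hB1 x))
  have e0 : α 0 = x₀ := by
    simp [hα, hA, hB, hψ, hβ0, Real.smoothTransition.zero_of_nonpos]
  have e1 : α 1 = γ s := by
    have h2 : ψ 2 = 1 := Real.smoothTransition.one_of_one_le (by norm_num)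
    have h3 : ψ (2 - 1) = 1 := Real.smoothTransition.one_of_one_le (by norm_num)
    simp only [hα, hA, hB, h2, h3, mul_one, hβ1]
    abel
  have hle := act_le (g := g) (lam := 0) (t := t) hp
  rw [e0, e1] at hle
  have hfirst : ∀ τ ∈ uIcc (0:ℝ) (1/2), spd g t 0 α α' τ = (spd g t 0 β β' ∘ A) τ * A' τ := by
    intro τ hτ
    rw [uIcc_of_le (by norm_num)] at hτ
    have h2 : ψ (2 * τ - 1) = 0 := Real.smoothTransition.zero_of_nonpos (by linarith [hτ.2])
    have h3 : deriv ψ (2 * τ - 1) = 0 := deriv_smoothTransition_of_nonpos (by linarith [hτ.2])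
    have h4 : α τ = β (A τ) := by simp [hα, hB, h2]
    have h5 : α' τ = A' τ • β' (A τ) := by simp [hα', hB', h3]
    have h6 : 0 ≤ A' τ := mul_nonneg zero_le_two (deriv_smoothTransition_nonneg _)
    simp only [spd, Function.comp, h4, h5, ne_eq, OfNat.ofNat_ne_zero, not_false_eq_true, zero_pow,
      zero_add, nq_smul_sqrt h6]
  have hsecond : ∀ τ ∈ uIcc (1/2:ℝ) 1, spd g t 0 α α' τ = (spd g t 0 γ γ' ∘ B) τ * B' τ := by
    intro τ hτ
    rw [uIcc_of_le (by norm_num)] at hτ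
    have h2 : ψ (2 * τ) = 1 := Real.smoothTransition.one_of_one_le (by linarith [hτ.1])
    have h3 : deriv ψ (2 * τ) = 0 := deriv_smoothTransition_of_one_le (by linarith [hτ.1])
    have h4 : α τ = γ (B τ) := by simp [hα, hA, h2, hβ1]
    have h5 : α' τ = B' τ • γ' (B τ) := by simp [hα', hA', h3]
    have h6 : 0 ≤ B' τ := mul_nonneg (mul_nonneg zero_le_two hs.1) (deriv_smoothTransition_nonneg _)
    simp only [spd, Function.comp, h4, h5, ne_eq, OfNat.ofNat_ne_zero, not_false_eq_true, zero_pow,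
      zero_add, nq_smul_sqrt h6]
  have hi1 : ∫ τ in (0:ℝ)..(1/2), spd g t 0 α α' τ = len g t 0 β β' := by
    rw [intervalIntegral.integral_congr hfirst, intervalIntegral.integral_comp_mul_deriv''
      hAc.continuousOn (fun x _ => (hAd x).hasDerivWithinAt) hA'c.continuousOn
      ((h.spd_continuousOn ht 0 hβ).mono (image_subset_iff.2 fun x _ => hA1 x))]
    simp [hA, hψ, len]
  have hi2 : ∫ τ in (1/2:ℝ)..1, spd g t 0 α α' τ = ∫ τ in (0:ℝ)..s, spd g t 0 γ γ' τ := by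
    rw [intervalIntegral.integral_congr hsecond, intervalIntegral.integral_comp_mul_deriv''
      hBc.continuousOn (fun x _ => (hBd x).hasDerivWithinAt) hB'c.continuousOn
      ((h.spd_continuousOn ht 0 hγ).mono (image_subset_iff.2 fun x _ => hB1 x))]
    have h3 : ψ (2 * 1 - 1) = 1 := Real.smoothTransition.one_of_one_le (by norm_num)
    simp only [hB, h3]
    simp [hψ]
  have hint := h.spd_intervalIntegrable ht 0 hp
  have hsplit : len g t 0 α α' = len g t 0 β β' + ∫ τ in (0:ℝ)..s, spd g t 0 γ γ' τ := by
    rw [← hi1, ← hi2, len]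
    refine (intervalIntegral.integral_add_adjacent_intervals (hint.mono_set ?_)
      (hint.mono_set ?_)).symm <;>
    · rw [uIcc_of_le (by norm_num), uIcc_of_le (by norm_num)]
      exact Icc_subset_Icc (by norm_num) (by norm_num)
  linarith

include h in
theorem act_zero_continuous (x₀ : Fin n → ℝ) {t : ℝ} (ht : t ∈ Icc 0 T) :
    Continuous (act g 0 x₀ t) := by
  rw [Metric.continuous_iff]
  intro x ε hε
  have hc : Continuous fun p : (Fin n → ℝ) × (Fin n → ℝ) => √(nq (g p.1 t) p.2) := by
    refine Real.continuous_sqrt.comp ?_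
    rw [← continuousOn_univ]
    exact continuous_nq (fun i j => ((h.contDiff_g ht i j).continuous.comp
      continuous_fst).continuousOn) continuous_snd.continuousOn
  obtain ⟨δ, hδ, hδ'⟩ := Metric.continuous_iff.1 hc (x, 0) (ε / 2) (by positivity)
  have hsmall : ∀ p v : Fin n → ℝ, ‖p - x‖ < δ → ‖v‖ < δ → √(nq (g p t) v) ≤ ε / 2 := by
    intro p v hp hv
    have := hδ' (p, v) (by
      rw [Prod.dist_eq, max_lt_iff, dist_eq_norm, dist_eq_norm, sub_zero]; exact ⟨hp, hv⟩)
    have h0 : √(nq (g x t) (0 : Fin n → ℝ)) = 0 := by simp [nq]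
    rw [Real.dist_eq, h0, sub_zero] at this
    exact (le_abs_self _).trans this.le
  have hseg : ∀ y z : Fin n → ℝ, ‖z - y‖ < δ → (∀ s ∈ Icc (0:ℝ) 1, ‖y + s • (z - y) - x‖ < δ) →
      act g 0 x₀ t z ≤ act g 0 x₀ t y + ε / 2 := by
    intro y z hyz hin
    have hp := isPath_segment y z
    have := h.act_concat (x₀ := x₀) ht hp (right_mem_Icc.2 zero_le_one)
    simp only [zero_smul, add_zero, one_smul, add_sub_cancel] at this
    have hi := intervalIntegral.integral_mono_on zero_le_one (h.spd_intervalIntegrable ht 0 hp)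
      (intervalIntegrable_const (c := ε / 2)) fun s hs => (show _ ≤ ε / 2 by
        simpa [spd] using hsmall _ _ (hin s hs) hyz)
    simp only [intervalIntegral.integral_const, sub_zero, one_smul] at hi
    linarith
  refine ⟨δ, hδ, fun y hy => ?_⟩
  rw [dist_eq_norm] at hy
  have h1 := hseg x y hy fun s hs => by
    rw [add_sub_cancel_left, norm_smul, Real.norm_of_nonneg hs.1]
    nlinarith [hs.2, norm_nonneg (y - x)]
  have h2 := hseg y x (by rwa [norm_sub_rev]) fun s hs => by
    have : y + s • (x - y) - x = (1 - s) • (y - x) := by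
      rw [sub_smul, one_smul, smul_sub, smul_sub]; abel
    rw [this, norm_smul, Real.norm_of_nonneg (by linarith [hs.2])]
    nlinarith [hs.1, norm_nonneg (y - x)]
  rw [Real.dist_eq, abs_lt]
  constructor <;> linarith

end IsRFOn

end RFlow

namespace RFlow

variable {g : (Fin n → ℝ) → ℝ → Matrix (Fin n) (Fin n) ℝ} {T : ℝ}

namespace IsRFOn

variable (h : IsRFOn g T)

/-- The curvature estimate at a point maximizing `(r₀ - d)² |Rm|`. -/
theorem bound_at_max {x₀ x₁ : Fin n → ℝ} {r₀ K t₁ : ℝ} (hK : 1 ≤ K)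
    (ht₁ : t₁ ∈ Icc 0 T)
    (hcomp : IsCompact (closure {x | act g 0 x₀ 0 x < r₀}))
    (h0 : ∀ x, act g 0 x₀ 0 x < r₀ → √(extS h.u (x, 0)) ≤ 1 / r₀ ^ 2)
    (ht : ∀ t, 0 < t → t ≤ T → ∀ x, act g 0 x₀ 0 x < r₀ → √(extS h.u (x, t)) ≤ K / t)
    (hx₁ : act g 0 x₀ 0 x₁ < r₀)
    (hmax : ∀ y, act g 0 x₀ 0 y < r₀ → ∀ t ∈ Icc 0 t₁,
      (r₀ - act g 0 x₀ 0 y) ^ 2 * √(extS h.u (y, t)) ≤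
        (r₀ - act g 0 x₀ 0 x₁) ^ 2 * √(extS h.u (x₁, t₁))) :
    (r₀ - act g 0 x₀ 0 x₁) ^ 2 * √(extS h.u (x₁, t₁)) ≤ Real.exp (expConst n * K) := by
  have h0T : (0:ℝ) ∈ Icc 0 T := ⟨le_rfl, h.pos.le⟩
  have hdc := h.act_zero_continuous x₀ h0T
  have hd0 : ∀ y, 0 ≤ act g 0 x₀ 0 y := fun y => act_nonneg _ _ _ _
  set d := act g 0 x₀ 0 with hd
  set ρ := r₀ - d x₁ with hρ
  set Q := √(extS h.u (x₁, t₁)) with hQ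
  have hρ0 : 0 < ρ := by rw [hρ]; linarith
  have hρr : ρ ≤ r₀ := by rw [hρ]; linarith [hd0 x₁]
  have hexp : 1 ≤ Real.exp (expConst n * K) := Real.one_le_exp (by unfold expConst; positivity)
  rcases (Real.sqrt_nonneg (extS h.u (x₁, t₁))).eq_or_lt with hQ0 | hQ0
  · rw [hQ, ← hQ0]; linarith
  have hQ0 : 0 < Q := hQ0
  have hinv : 1 / r₀ ^ 2 ≤ 1 / ρ ^ 2 :=
    one_div_le_one_div_of_le (by positivity) (pow_le_pow_left₀ hρ0.le hρr 2)
  rcases ht₁.1.eq_or_lt with ht0 | ht0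
  · refine le_trans ?_ hexp
    have h1 : Q ≤ 1 / ρ ^ 2 := by
      rw [hQ, ← ht0]; exact (h0 x₁ hx₁).trans hinv
    calc ρ ^ 2 * Q ≤ ρ ^ 2 * (1 / ρ ^ 2) := mul_le_mul_of_nonneg_left h1 (by positivity)
      _ = 1 := by field_simp
  have hDo : IsOpen {y | d y < d x₁ + ρ / 2} := isOpen_lt hdc continuous_const
  have hDball : ∀ y, d y ≤ d x₁ + ρ / 2 → d y < r₀ := fun y hy => by linarith
  have hKc : IsCompact (closure {x | d x < r₀} ∩ {y | d y ≤ d x₁ + ρ / 2}) :=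
    hcomp.inter_right (isClosed_le hdc continuous_const)
  have hqq : √Q ^ 2 = Q := Real.sq_sqrt hQ0.le
  have key := h.scale_bound hKc (D := {y | d y < d x₁ + ρ / 2}) (x₁ := x₁) (t₁ := t₁) (q := √Q)
    (ρ := ρ) (k := K) (fun y (hy : d y < _) => ⟨subset_closure (hDball y hy.le), hy.le⟩) hDo
    ⟨ht0, ht₁.2⟩ (show d x₁ < d x₁ + ρ / 2 by linarith) (Real.sqrt_pos.2 hQ0) hρ0 hK ?_ ?_ ?_ ?_ ?_
  · rwa [mul_pow, hqq] at key
  · rw [hqq]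
    exact (le_div_iff₀ ht0).1 (ht t₁ ht0 ht₁.2 x₁ hx₁)
  · intro γ γ' hγ hγ0 s hs hlt
    have := h.act_concat (x₀ := x₀) h0T hγ hs
    rw [hγ0] at this
    show d (γ s) < d x₁ + ρ / 2
    linarith
  · rintro y ⟨-, hy⟩ t ht'
    have hy' : d y ≤ d x₁ + ρ / 2 := hy
    rw [hqq]
    refine (Real.sqrt_le_left (by positivity)).1 ?_
    have h1 := hmax y (hDball y hy') t ht'
    have h2 : (ρ / 2) ^ 2 ≤ (r₀ - d y) ^ 2 := pow_le_pow_left₀ (by positivity) (by linarith) 2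
    have h3 := mul_le_mul_of_nonneg_right h2 (Real.sqrt_nonneg (extS h.u (y, t)))
    have h4 : ρ ^ 2 * √(extS h.u (y, t)) ≤ ρ ^ 2 * (4 * Q) := by linarith
    exact le_of_mul_le_mul_left h4 (by positivity)
  · intro y hy
    have hy' : d y < d x₁ + ρ / 2 := hy
    have := (Real.sqrt_le_left (by positivity)).1 ((h0 y (hDball y hy'.le)).trans hinv)
    refine this.trans (le_of_eq ?_)
    rw [div_pow, one_pow, ← pow_mul]
  · have h1 : √Q ^ 4 = Q ^ 2 := by rw [← hqq]; ring_nf; rw [hqq]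
    rw [h1, hQ, Real.sq_sqrt (Real.sqrt_pos.1 hQ0).le]

theorem curvature_bound {x₀ : Fin n → ℝ} {r₀ K : ℝ} (hK : 1 ≤ K)
    (hcomp : IsCompact (closure {x | act g 0 x₀ 0 x < r₀}))
    (h0 : ∀ x, act g 0 x₀ 0 x < r₀ → √(extS h.u (x, 0)) ≤ 1 / r₀ ^ 2)
    (ht : ∀ t, 0 < t → t ≤ T → ∀ x, act g 0 x₀ 0 x < r₀ → √(extS h.u (x, t)) ≤ K / t)
    {x : Fin n → ℝ} (hx : act g 0 x₀ 0 x < r₀) {t : ℝ} (htT : t ∈ Icc 0 T) :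
    (r₀ - act g 0 x₀ 0 x) ^ 2 * √(extS h.u (x, t)) ≤ Real.exp (expConst n * K) := by
  have h0T : (0:ℝ) ∈ Icc 0 T := ⟨le_rfl, h.pos.le⟩
  have hdc := h.act_zero_continuous x₀ h0T
  have hcl : closure {x | act g 0 x₀ 0 x < r₀} ⊆ {x | act g 0 x₀ 0 x ≤ r₀} :=
    closure_minimal (fun y (hy : act g 0 x₀ 0 y < r₀) => hy.le) (isClosed_le hdc continuous_const)
  have hfc : ContinuousOn (fun p : (Fin n → ℝ) × ℝ =>
      (r₀ - act g 0 x₀ 0 p.1) ^ 2 * √(extS h.u p))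
      (closure {x | act g 0 x₀ 0 x < r₀} ×ˢ Icc 0 t) := by
    refine ContinuousOn.mul (by fun_prop) (ContinuousOn.sqrt ?_)
    exact (extS_contDiffOn h.u).continuousOn.mono
      (prod_mono (subset_univ _) (Icc_subset_Icc_right htT.2))
  obtain ⟨⟨x₁, t₁⟩, ⟨hx₁, ht₁⟩, hmax⟩ := (hcomp.prod isCompact_Icc).exists_isMaxOn
    ⟨(x, t), subset_closure hx, right_mem_Icc.2 htT.1⟩ hfc
  refine (isMaxOn_iff.1 hmax (x, t) (mk_mem_prod (subset_closure hx) (right_mem_Icc.2 htT.1))).trans ?_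
  simp only
  rcases (show act g 0 x₀ 0 x₁ ≤ r₀ from hcl hx₁).eq_or_lt with heq | hlt
  · rw [heq, sub_self, zero_pow two_ne_zero, zero_mul]
    exact (Real.exp_pos _).le
  · exact h.bound_at_max hK ⟨ht₁.1, ht₁.2.trans htT.2⟩ hcomp h0 ht hlt fun y hy s hs =>
      isMaxOn_iff.1 hmax (y, s) (mk_mem_prod (subset_closure hy) ⟨hs.1, hs.2.trans ht₁.2⟩)

end IsRFOn

end RFlow

/-- Interior curvature estimate in terms of the initial distance
(Corollary 3.2). -/
theorem stmt_9 (n : ℕ) (hn : 2 ≤ n) :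
    ∃ C : ℝ, ∀ (T : ℝ) (g : (Fin n → ℝ) → ℝ → Matrix (Fin n) (Fin n) ℝ)
      (x₀ : Fin n → ℝ) (r₀ K : ℝ), 0 < r₀ → 1 ≤ K →
      SmoothMetricFamily g (Icc 0 T) → IsRicciFlow g (Icc 0 T) →
      IsCompact (closure (rBall (fun y => g y 0) x₀ r₀)) →
      (∀ x ∈ rBall (fun y => g y 0) x₀ r₀, riemNorm (fun y => g y 0) x ≤ 1/r₀^2) →
      (∀ t : ℝ, 0 < t → t ≤ T → ∀ x ∈ rBall (fun y => g y 0) x₀ r₀,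
        riemNorm (fun y => g y t) x ≤ K/t) →
      ∀ x ∈ rBall (fun y => g y 0) x₀ r₀, ∀ t ∈ Icc (0:ℝ) T,
        riemNorm (fun y => g y t) x
          ≤ Real.exp (C*K) / (r₀ - riemDist (fun y => g y 0) x₀ x)^2 := by
  refine ⟨RFlow.expConst n, fun T g x₀ r₀ K hr₀ hK hsm hfl hcomp h0 ht x hx t htT => ?_⟩
  have hxr : riemDist (fun y => g y 0) x₀ x < r₀ := hx
  have hd0 : 0 ≤ riemDist (fun y => g y 0) x₀ x := by
    rw [RFlow.riemDist_eq (g := g) x₀ x 0]; exact RFlow.act_nonneg _ _ _ _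
  have hpos : 0 < r₀ - riemDist (fun y => g y 0) x₀ x := sub_pos.2 hxr
  rcases (htT.1.trans htT.2).eq_or_lt with hT | hT
  · obtain rfl : t = 0 := le_antisymm (htT.2.trans hT.ge) htT.1
    refine (h0 x hx).trans (div_le_div₀ (Real.exp_pos _).le (Real.one_le_exp ?_) (by positivity) ?_)
    · unfold RFlow.expConst; positivity
    · exact pow_le_pow_left₀ hpos.le (by linarith) 2
  have h : RFlow.IsRFOn g T := ⟨hT, hsm, hfl⟩
  have hball : rBall (fun y => g y 0) x₀ r₀ = {x | RFlow.act g 0 x₀ 0 x < r₀} := by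
    ext y
    show riemDist (fun y => g y 0) x₀ y < r₀ ↔ _
    rw [RFlow.riemDist_eq (g := g) x₀ y 0]; rfl
  rw [hball] at hcomp h0 ht hx
  rw [le_div_iff₀ (by positivity), h.riemNorm_eq htT, RFlow.riemDist_eq (g := g) x₀ x 0, mul_comm]
  refine h.curvature_bound hK hcomp (fun y hy => ?_) (fun s hs hsT y hy => ?_) hx htT
  · rw [← h.riemNorm_eq ⟨le_rfl, hT.le⟩]; exact h0 y hy
  · rw [← h.riemNorm_eq ⟨hs.le, hsT⟩]; exact ht s hs hsT y hy

end
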